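/- arXiv:2302.01655 — 4 statements merged into one kernel-verified Lean document; each statement's English description precedes it below -/
import Mathlib

section
/- There is an absolute constant C > 0 with the following property. Let F be a finite field with q elements, let n ≥ 2, and let a ∈ {1, −1}. Let N be the total number of *-symmetric monic polynomials of degree n over F with constant coefficient a. Then the number of *-symmetric monic polynomials f of degree n over F with constant coefficient a such that for every positive integer k ≤ n/2 divisible by 4, f has an even number of *-symmetric monic irreducible factors of degree k (counted with multiplicity), is at most C·N·n^{−1/4}·log n. -/
open Polynomial

/-- `f` is *-symmetric: `f(0) ≠ 0` and `f* = f`, where `f*(X) = Xⁿ f(1/X)/f(0)`. -/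
def IsStarSymm {F : Type} [Field F] (f : F[X]) : Prop :=
  f.coeff 0 ≠ 0 ∧ f.reverse = Polynomial.C (f.coeff 0) * f

open scoped Classical in
/-- The number of monic irreducible *-symmetric factors of `f` of degree `k`, counted with
multiplicity. -/
noncomputable def starFactorCount {F : Type} [Field F] (f : F[X]) (k : ℕ) : ℕ :=
  Multiset.card ((UniqueFactorizationMonoid.normalizedFactors f).filter
    (fun g => g.Monic ∧ Irreducible g ∧ IsStarSymm g ∧ g.natDegree = k))

section Counting

variable {F : Type} [Field F] [Fintype F]

lemma finite_monic_natDegree_eq (F : Type) [Field F] [Fintype F] (d : ℕ) :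
    {f : F[X] | f.Monic ∧ f.natDegree = d}.Finite := by
  have : Finite {p : F[X] // p.Monic ∧ p.natDegree = d} :=
    Finite.of_equiv _ ((monicEquivDegreeLT (R := F) d).trans (degreeLTEquiv F d).toEquiv).symm
  exact Set.finite_coe_iff.1 this

/-- The monic polynomials of degree `d` over a finite field. -/
noncomputable def monicFin (F : Type) [Field F] [Fintype F] (d : ℕ) : Finset F[X] :=
  (finite_monic_natDegree_eq F d).toFinset

@[simp] lemma mem_monicFin {d : ℕ} {f : F[X]} :
    f ∈ monicFin F d ↔ f.Monic ∧ f.natDegree = d := by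
  simp [monicFin]

lemma card_monicFin (d : ℕ) : (monicFin F d).card = Fintype.card F ^ d := by
  classical
  rw [monicFin, ← Set.ncard_eq_toFinset_card _ (finite_monic_natDegree_eq F d),
    ← Nat.card_coe_set_eq]
  change Nat.card {p : F[X] // p.Monic ∧ p.natDegree = d} = _
  rw [Nat.card_congr ((monicEquivDegreeLT (R := F) d).trans (degreeLTEquiv F d).toEquiv)]
  simp

open scoped Classical in
/-- The monic irreducible polynomials of degree at most `m` over a finite field. -/
noncomputable def irredFin (F : Type) [Field F] [Fintype F] (m : ℕ) : Finset F[X] :=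
  ((Finset.range (m + 1)).biUnion (monicFin F)).filter Irreducible

lemma mem_irredFin {m : ℕ} {p : F[X]} :
    p ∈ irredFin F m ↔ p.Monic ∧ Irreducible p ∧ p.natDegree ≤ m := by
  simp only [irredFin, Finset.mem_filter, Finset.mem_biUnion, Finset.mem_range, mem_monicFin]
  grind

omit [Fintype F] in
lemma sum_natDegree_le_of_dvd {s : Finset F[X]} {T : F[X]} (hT : T ≠ 0)
    (hs : ∀ p ∈ s, p.Monic ∧ Irreducible p ∧ p ∣ T) :
    ∑ p ∈ s, p.natDegree ≤ T.natDegree := by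
  rw [← natDegree_prod_of_monic s (fun p => p) fun p hp => (hs p hp).1]
  refine natDegree_le_of_dvd (Finset.prod_dvd_of_coprime ?_ fun p hp => (hs p hp).2.2) hT
  intro p hp r hr hne
  refine ((hs p hp).2.1.coprime_iff_not_dvd).2 fun hdvd => hne ?_
  exact eq_of_monic_of_associated (hs p hp).1 (hs r hr).1
    ((hs p hp).2.1.associated_of_dvd (hs r hr).2.1 hdvd)

lemma sum_natDegree_le_card_pow {s : Finset F[X]} {r : ℕ} (hr : r ≠ 0)
    (hs : ∀ p ∈ s, p.Monic ∧ Irreducible p ∧ p.natDegree ∣ r) :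
    ∑ p ∈ s, p.natDegree ≤ Fintype.card F ^ r := by
  have h1 : 1 < Fintype.card F := Fintype.one_lt_card
  have hne := FiniteField.X_pow_card_pow_sub_X_ne_zero F hr h1
  have hdeg := FiniteField.X_pow_card_pow_sub_X_natDegree_eq F hr h1
  rw [← hdeg]
  refine sum_natDegree_le_of_dvd hne fun p hp => ⟨(hs p hp).1, (hs p hp).2.1, ?_⟩
  have := ((hs p hp).2.1.natDegree_dvd_iff_dvd_X_pow_card_pow_sub_X).1 (hs p hp).2.2
  rwa [Nat.card_eq_fintype_card] at this

open scoped Classical in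
lemma natDegree_le_sum_pow_dvd {m : ℕ} {f : F[X]} (hf : f ∈ monicFin F m) :
    m ≤ ∑ p ∈ irredFin F m, ∑ j ∈ Finset.Icc 1 m, if p ^ j ∣ f then p.natDegree else 0 := by
  obtain ⟨hmon, hdeg⟩ := mem_monicFin.1 hf
  set s := UniqueFactorizationMonoid.normalizedFactors f with hs
  have hmem : ∀ p ∈ s, p.Monic ∧ Irreducible p ∧ p ∣ f := fun p hp => by
    have h1 := UniqueFactorizationMonoid.irreducible_of_normalized_factor p hp
    have h2 := UniqueFactorizationMonoid.normalize_normalized_factor p hp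
    exact ⟨h2 ▸ monic_normalize h1.ne_zero, h1,
      UniqueFactorizationMonoid.dvd_of_mem_normalizedFactors hp⟩
  have hprod : s.prod = f := by
    rw [hs, UniqueFactorizationMonoid.prod_normalizedFactors_eq hmon.ne_zero,
      hmon.normalize_eq_self]
  have hsum : m = ∑ p ∈ s.toFinset, s.count p * p.natDegree := by
    rw [← hdeg]
    conv_lhs => rw [← hprod]
    rw [natDegree_multiset_prod_of_monic _ fun p hp => (hmem p hp).1,
      Finset.sum_multiset_map_count]
    simp
  calc m = ∑ p ∈ s.toFinset, s.count p * p.natDegree := hsum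
    _ ≤ ∑ p ∈ s.toFinset, ∑ j ∈ Finset.Icc 1 m, if p ^ j ∣ f then p.natDegree else 0 := by
        refine Finset.sum_le_sum fun p hp => ?_
        have hps : p ∈ s := by simpa using hp
        have hpos := (hmem p hps).2.1.natDegree_pos
        have hpow : p ^ s.count p ∣ f := by
          rw [← hprod]
          rw [← Multiset.prod_replicate]
          exact Multiset.prod_dvd_prod_of_le (Multiset.le_count_iff_replicate_le.1 le_rfl)
        have hle : s.count p ≤ m := by
          have := natDegree_le_of_dvd hpow hmon.ne_zero
          rw [natDegree_pow, hdeg] at this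
          nlinarith
        rw [← Finset.sum_filter, Finset.sum_const, smul_eq_mul]
        refine Nat.mul_le_mul_right _ ?_
        calc s.count p = (Finset.Icc 1 (s.count p)).card := by simp
          _ ≤ _ := by
            refine Finset.card_le_card fun j hj => ?_
            rw [Finset.mem_Icc] at hj
            simp only [Finset.mem_filter, Finset.mem_Icc]
            exact ⟨⟨hj.1, hj.2.trans hle⟩, (pow_dvd_pow p hj.2).trans hpow⟩
    _ ≤ _ := by
        refine Finset.sum_le_sum_of_subset fun p hp => ?_
        have hps : p ∈ s := by simpa using hp
        obtain ⟨h1, h2, h3⟩ := hmem p hps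
        exact mem_irredFin.2 ⟨h1, h2, hdeg ▸ natDegree_le_of_dvd h3 hmon.ne_zero⟩

/-- A Hall–Tenenbaum type inequality: a sum over monic polynomials of degree `m` is controlled by
sums over smaller degrees, provided removing a prime power changes `g` into something at most
`w`. -/
lemma mul_sum_monicFin_le {g w : F[X] → ℝ} (hg : ∀ f, 0 ≤ g f) (hw : ∀ f, 0 ≤ w f)
    (hgw : ∀ (p h : F[X]) (j : ℕ), p.Monic → Irreducible p → h.Monic → g (p ^ j * h) ≤ w h)
    (m : ℕ) :
    m * ∑ f ∈ monicFin F m, g f ≤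
      ∑ r ∈ Finset.Icc 1 m, (Fintype.card F : ℝ) ^ r * ∑ h ∈ monicFin F (m - r), w h := by
  classical
  set W : ℕ → ℝ := fun k => ∑ h ∈ monicFin F k, w h with hW
  have hW0 : ∀ k, 0 ≤ W k := fun k => Finset.sum_nonneg fun h _ => hw h
  have key : ∀ p ∈ irredFin F m, ∀ j ∈ Finset.Icc 1 m,
      ∑ f ∈ monicFin F m, (if p ^ j ∣ f then g f else 0) ≤
        ∑ r ∈ Finset.Icc 1 m, if j * p.natDegree = r then W (m - r) else 0 := by
    intro p hp j hj
    obtain ⟨hpm, hpi, -⟩ := mem_irredFin.1 hp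
    rw [Finset.mem_Icc] at hj
    have hpj : (p ^ j).Monic := hpm.pow j
    rw [Finset.sum_ite_eq]
    split_ifs with hr
    · rw [← Finset.sum_filter]
      have hsub : (monicFin F m).filter (fun f => p ^ j ∣ f) ⊆
          (monicFin F (m - j * p.natDegree)).image (fun h => p ^ j * h) := by
        intro f hf
        simp only [Finset.mem_filter, mem_monicFin] at hf
        obtain ⟨⟨hfm, hfd⟩, h, rfl⟩ := hf
        have hh : h.Monic := hpj.of_mul_monic_left hfm
        refine Finset.mem_image.2 ⟨h, mem_monicFin.2 ⟨hh, ?_⟩, rfl⟩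
        rw [hpj.natDegree_mul hh, natDegree_pow] at hfd
        omega
      refine (Finset.sum_le_sum_of_subset_of_nonneg hsub fun f _ _ => hg f).trans ?_
      rw [Finset.sum_image fun a _ b _ hab => mul_left_cancel₀ hpj.ne_zero hab]
      exact Finset.sum_le_sum fun h hh => hgw p h j hpm hpi (mem_monicFin.1 hh).1
    · refine (Finset.sum_eq_zero fun f hf => ?_).le
      obtain ⟨hfm, hfd⟩ := mem_monicFin.1 hf
      refine if_neg fun hdvd => hr ?_
      have := natDegree_le_of_dvd hdvd hfm.ne_zero
      rw [natDegree_pow, hfd] at this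
      exact Finset.mem_Icc.2 ⟨Nat.mul_pos hj.1 hpi.natDegree_pos, this⟩
  calc (m : ℝ) * ∑ f ∈ monicFin F m, g f = ∑ f ∈ monicFin F m, (m : ℝ) * g f := Finset.mul_sum ..
    _ ≤ ∑ f ∈ monicFin F m, (∑ p ∈ irredFin F m, ∑ j ∈ Finset.Icc 1 m,
          if p ^ j ∣ f then (p.natDegree : ℝ) else 0) * g f := by
        refine Finset.sum_le_sum fun f hf => mul_le_mul_of_nonneg_right ?_ (hg f)
        exact_mod_cast natDegree_le_sum_pow_dvd hf
    _ = ∑ p ∈ irredFin F m, ∑ j ∈ Finset.Icc 1 m, (p.natDegree : ℝ) *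
          ∑ f ∈ monicFin F m, (if p ^ j ∣ f then g f else 0) := by
        simp_rw [Finset.sum_mul, Finset.mul_sum]
        rw [Finset.sum_comm]
        refine Finset.sum_congr rfl fun p _ => ?_
        rw [Finset.sum_comm]
        refine Finset.sum_congr rfl fun j _ => Finset.sum_congr rfl fun f _ => ?_
        split_ifs <;> simp
    _ ≤ ∑ p ∈ irredFin F m, ∑ j ∈ Finset.Icc 1 m, (p.natDegree : ℝ) *
          ∑ r ∈ Finset.Icc 1 m, if j * p.natDegree = r then W (m - r) else 0 :=
        Finset.sum_le_sum fun p hp => Finset.sum_le_sum fun j hj =>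
          mul_le_mul_of_nonneg_left (key p hp j hj) (Nat.cast_nonneg _)
    _ = ∑ r ∈ Finset.Icc 1 m, (∑ p ∈ irredFin F m, ∑ j ∈ Finset.Icc 1 m,
          if j * p.natDegree = r then (p.natDegree : ℝ) else 0) * W (m - r) := by
        simp_rw [Finset.mul_sum, Finset.sum_mul]
        symm
        rw [Finset.sum_comm]
        refine Finset.sum_congr rfl fun p _ => ?_
        rw [Finset.sum_comm]
        refine Finset.sum_congr rfl fun j _ => Finset.sum_congr rfl fun f _ => ?_
        split_ifs <;> simp
    _ ≤ _ := by
        refine Finset.sum_le_sum fun r hr => mul_le_mul_of_nonneg_right ?_ (hW0 _)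
        rw [Finset.mem_Icc] at hr
        calc (∑ p ∈ irredFin F m, ∑ j ∈ Finset.Icc 1 m,
              if j * p.natDegree = r then (p.natDegree : ℝ) else 0)
            ≤ ∑ p ∈ irredFin F m, if p.natDegree ∣ r then (p.natDegree : ℝ) else 0 := by
              refine Finset.sum_le_sum fun p hp => ?_
              have hpos := (mem_irredFin.1 hp).2.1.natDegree_pos
              rw [← Finset.sum_filter, Finset.sum_const, nsmul_eq_mul]
              have hcard : ((Finset.Icc 1 m).filter fun j => j * p.natDegree = r).card ≤ 1 :=
                Finset.card_le_one.2 fun a ha b hb => by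
                  simp only [Finset.mem_filter] at ha hb
                  exact Nat.eq_of_mul_eq_mul_right hpos (ha.2.trans hb.2.symm)
              split_ifs with hd
              · exact mul_le_of_le_one_left (Nat.cast_nonneg _) (by exact_mod_cast hcard)
              · rw [Finset.filter_false_of_mem fun j _ hj => hd ⟨j, by rw [← hj, mul_comm]⟩]
                simp
          _ ≤ (Fintype.card F : ℝ) ^ r := by
              rw [← Finset.sum_filter]
              have := sum_natDegree_le_card_pow (F := F) (r := r)
                (s := (irredFin F m).filter fun p => p.natDegree ∣ r) (by omega) fun p hp => by
                  rw [Finset.mem_filter, mem_irredFin] at hp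
                  exact ⟨hp.1.1, hp.1.2.1, hp.2⟩
              exact_mod_cast this

end Counting

section WeightedSum

variable {F : Type} [Field F] [Fintype F]

/-- The sum of `g h * v ^ deg h` over all monic polynomials `h`. -/
noncomputable def monicSum (v : ℝ) (g : F[X] → ℝ) : ℝ :=
  ∑' h : {h : F[X] // h.Monic}, g h * v ^ h.1.natDegree

lemma sum_pow_natDegree_le {v : ℝ} (hv : 0 ≤ v) (hqv : Fintype.card F * v < 1)
    (u : Finset {h : F[X] // h.Monic}) :
    ∑ h ∈ u, v ^ h.1.natDegree ≤ (1 - Fintype.card F * v)⁻¹ := by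
  classical
  have hq : (0 : ℝ) ≤ Fintype.card F * v := by positivity
  set N := u.sup (fun h => h.1.natDegree) + 1
  have hN : ∀ h ∈ u, h.1.natDegree ∈ Finset.range N := fun h hh =>
    Finset.mem_range.2 (Nat.lt_succ_of_le (Finset.le_sup (f := fun h => h.1.natDegree) hh))
  rw [← Finset.sum_fiberwise_of_maps_to hN]
  calc ∑ d ∈ Finset.range N, ∑ h ∈ u.filter (fun h => h.1.natDegree = d), v ^ h.1.natDegree
      ≤ ∑ d ∈ Finset.range N, (Fintype.card F * v) ^ d := by
        refine Finset.sum_le_sum fun d _ => ?_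
        rw [Finset.sum_congr rfl fun h hh => by rw [(Finset.mem_filter.1 hh).2],
          Finset.sum_const, nsmul_eq_mul, mul_pow]
        refine mul_le_mul_of_nonneg_right ?_ (pow_nonneg hv d)
        have : (u.filter fun h => h.1.natDegree = d).card ≤ (monicFin F d).card :=
          Finset.card_le_card_of_injOn (fun h => h.1)
            (fun h hh => by
              have := (Finset.mem_filter.1 (Finset.mem_coe.1 hh)).2
              exact Finset.mem_coe.2 (mem_monicFin.2 ⟨h.2, this⟩))
            Subtype.val_injective.injOn
        rw [card_monicFin] at this
        exact_mod_cast this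
    _ ≤ ∑' d : ℕ, (Fintype.card F * v) ^ d :=
        (summable_geometric_of_lt_one hq hqv).sum_le_tsum _ fun d _ => pow_nonneg hq d
    _ = _ := tsum_geometric_of_lt_one hq hqv

lemma summable_pow_natDegree {v : ℝ} (hv : 0 ≤ v) (hqv : Fintype.card F * v < 1) :
    Summable fun h : {h : F[X] // h.Monic} => v ^ h.1.natDegree :=
  summable_of_sum_le (fun _ => pow_nonneg hv _) (sum_pow_natDegree_le hv hqv)

lemma monicSum_one_le {v : ℝ} (hv : 0 ≤ v) (hqv : Fintype.card F * v < 1) :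
    monicSum (F := F) v (fun _ => 1) ≤ (1 - Fintype.card F * v)⁻¹ := by
  simp only [monicSum, one_mul]
  exact (summable_pow_natDegree hv hqv).tsum_le_of_sum_le (sum_pow_natDegree_le hv hqv)

lemma summable_mul_pow_natDegree {v : ℝ} (hv : 0 ≤ v) (hqv : Fintype.card F * v < 1)
    {g : F[X] → ℝ} {B : ℝ} (hg : ∀ h, |g h| ≤ B) :
    Summable fun h : {h : F[X] // h.Monic} => g h * v ^ h.1.natDegree := by
  refine Summable.of_norm_bounded ((summable_pow_natDegree (F := F) hv hqv).mul_left B) fun h => ?_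
  rw [norm_mul, Real.norm_eq_abs, Real.norm_of_nonneg (pow_nonneg hv _)]
  exact mul_le_mul_of_nonneg_right (hg _) (pow_nonneg hv _)

lemma sum_monicFin_le_monicSum {v : ℝ} (hv : 0 ≤ v) (hqv : Fintype.card F * v < 1)
    {g : F[X] → ℝ} {B : ℝ} (hg0 : ∀ h, 0 ≤ g h) (hg : ∀ h, |g h| ≤ B) (s : Finset ℕ) :
    ∑ d ∈ s, v ^ d * ∑ h ∈ monicFin F d, g h ≤ monicSum v g := by
  classical
  have hmon : ∀ h ∈ s.biUnion (monicFin F), h.Monic := fun h hh => by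
    obtain ⟨d, -, hd⟩ := Finset.mem_biUnion.1 hh
    exact (mem_monicFin.1 hd).1
  have hdisj : (s : Set ℕ).PairwiseDisjoint (monicFin F) := fun a _ b _ hab =>
    Finset.disjoint_left.2 fun f ha hb =>
      hab ((mem_monicFin.1 ha).2.symm.trans (mem_monicFin.1 hb).2)
  calc ∑ d ∈ s, v ^ d * ∑ h ∈ monicFin F d, g h
      = ∑ h ∈ s.biUnion (monicFin F), g h * v ^ h.natDegree := by
        rw [Finset.sum_biUnion hdisj]
        refine Finset.sum_congr rfl fun d _ => ?_
        rw [Finset.mul_sum]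
        refine Finset.sum_congr rfl fun h hh => ?_
        rw [(mem_monicFin.1 hh).2, mul_comm]
    _ = ∑ h ∈ (s.biUnion (monicFin F)).subtype Monic, g h * v ^ h.1.natDegree := by
        rw [Finset.sum_subtype_of_mem (fun h => g h * v ^ h.natDegree) hmon]
    _ ≤ _ := (summable_mul_pow_natDegree hv hqv hg).sum_le_tsum _
        fun h _ => mul_nonneg (hg0 _) (pow_nonneg hv _)

/-- The behaviour of `monicSum` for a function multiplied by `c` under multiplication by `p`. -/
lemma monicSum_mul_one_sub {v : ℝ} (hv : 0 ≤ v) (hqv : Fintype.card F * v < 1)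
    {p : F[X]} (hp : p.Monic) {g : F[X] → ℝ} {c B : ℝ} (hg : ∀ h, |g h| ≤ B)
    (hgp : ∀ h, h.Monic → g (p * h) = c * g h) :
    monicSum v g * (1 - c * v ^ p.natDegree) =
      monicSum v ({h | ¬ p ∣ h}.indicator g) := by
  classical
  have hsplit : g = {h | ¬ p ∣ h}.indicator g + {h | p ∣ h}.indicator g := by
    ext h
    by_cases hh : p ∣ h <;> simp [hh]
  have hb : ∀ s : Set F[X], ∀ h, |s.indicator g h| ≤ B := fun s h => by
    by_cases hh : h ∈ s
    · simpa [hh] using hg h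
    · simpa [hh] using (abs_nonneg _).trans (hg h)
  have hsum := fun s : Set F[X] => summable_mul_pow_natDegree hv hqv (hb s)
  have hmul : monicSum v ({h | p ∣ h}.indicator g) = c * v ^ p.natDegree * monicSum v g := by
    let e : {h : F[X] // h.Monic} → {h : F[X] // h.Monic} := fun h => ⟨p * h.1, hp.mul h.2⟩
    have he : Function.Injective e := fun a b hab =>
      Subtype.ext (mul_left_cancel₀ hp.ne_zero (congrArg Subtype.val hab))
    rw [monicSum, ← he.tsum_eq]
    · rw [monicSum, ← tsum_mul_left]
      refine tsum_congr fun h => ?_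
      simp only [e]
      rw [Set.indicator_of_mem (by exact dvd_mul_right p h.1), hgp _ h.2, hp.natDegree_mul h.2]
      ring
    · intro h hh
      have hdvd : p ∣ h.1 := by
        by_contra hnd
        simp [hnd] at hh
      obtain ⟨k, hk⟩ := hdvd
      exact ⟨⟨k, hp.of_mul_monic_left (hk ▸ h.2)⟩, Subtype.ext hk.symm⟩
  have hadd : monicSum v g = monicSum v ({h | ¬ p ∣ h}.indicator g) +
      monicSum v ({h | p ∣ h}.indicator g) := by
    rw [monicSum, monicSum, monicSum, ← (hsum _).tsum_add (hsum _)]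
    refine tsum_congr fun h => ?_
    conv_lhs => rw [hsplit]
    rw [Pi.add_apply, add_mul]
  rw [hmul] at hadd
  linear_combination hadd

/-- If `g` is invariant under multiplication by `p` and `g'` changes sign under it, and both agree
away from the multiples of `p`, then their sums are proportional. -/
lemma monicSum_sign_flip {v : ℝ} (hv : 0 ≤ v) (hqv : Fintype.card F * v < 1)
    {p : F[X]} (hp : p.Monic) {g g' : F[X] → ℝ} {B : ℝ} (hg : ∀ h, |g h| ≤ B)
    (hg' : ∀ h, |g' h| ≤ B) (hgp : ∀ h, h.Monic → g (p * h) = g h)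
    (hgp' : ∀ h, h.Monic → g' (p * h) = - g' h) (hgg : ∀ h, ¬ p ∣ h → g' h = g h) :
    monicSum v g' = monicSum v g * ((1 - v ^ p.natDegree) / (1 + v ^ p.natDegree)) := by
  have h1 := monicSum_mul_one_sub hv hqv hp (c := 1) hg fun h hh => by rw [hgp h hh, one_mul]
  have h2 := monicSum_mul_one_sub hv hqv hp (c := -1) hg' fun h hh => by rw [hgp' h hh]; ring
  have h3 : {h | ¬ p ∣ h}.indicator g' = {h | ¬ p ∣ h}.indicator g := by
    ext h
    by_cases hh : p ∣ h
    · simp [hh]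
    · simp [hh, hgg h hh]
  rw [h3, ← h1] at h2
  have : 0 < 1 + v ^ p.natDegree := by positivity
  field_simp
  linarith

open scoped Classical in
/-- The number of prime factors of `h`, with multiplicity, that belong to `I`. -/
noncomputable def primeCount (I : Finset F[X]) (h : F[X]) : ℕ :=
  ∑ p ∈ I, (UniqueFactorizationMonoid.normalizedFactors h).count p

/-- The sign `(-1) ^ primeCount I h`. -/
noncomputable def primeSign (I : Finset F[X]) (h : F[X]) : ℝ := (-1) ^ primeCount I h

omit [Fintype F] in
lemma abs_primeSign (I : Finset F[X]) (h : F[X]) : |primeSign I h| = 1 := by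
  simp [primeSign]

omit [Fintype F] in
lemma primeSign_eq (I : Finset F[X]) (h : F[X]) : primeSign I h = 1 ∨ primeSign I h = -1 :=
  neg_one_pow_eq_or ℝ _

omit [Fintype F] in
open scoped Classical in
lemma primeCount_mul (I : Finset F[X]) {f g : F[X]} (hf : f ≠ 0) (hg : g ≠ 0) :
    primeCount I (f * g) = primeCount I f + primeCount I g := by
  simp [primeCount, UniqueFactorizationMonoid.normalizedFactors_mul hf hg, Finset.sum_add_distrib]

omit [Fintype F] in
open scoped Classical in
lemma primeCount_irreducible (I : Finset F[X]) {p : F[X]} (hp : p.Monic) (hi : Irreducible p) :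
    primeCount I p = if p ∈ I then 1 else 0 := by
  simp [primeCount, UniqueFactorizationMonoid.normalizedFactors_irreducible hi,
    hp.normalize_eq_self, Multiset.count_singleton]

omit [Fintype F] in
open scoped Classical in
lemma primeSign_mul_irreducible (I : Finset F[X]) {p h : F[X]} (hp : p.Monic)
    (hi : Irreducible p) (hh : h ≠ 0) :
    primeSign I (p * h) = (if p ∈ I then -1 else 1) * primeSign I h := by
  rw [primeSign, primeCount_mul I hp.ne_zero hh, primeCount_irreducible I hp hi, pow_add]
  split_ifs <;> simp [primeSign]

lemma monicSum_mul_primeSign {v : ℝ} (hv : 0 ≤ v) (hqv : Fintype.card F * v < 1) {d : ℕ}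
    (I : Finset F[X]) (hI : ∀ p ∈ I, p.Monic ∧ Irreducible p ∧ p.natDegree = d)
    {g : F[X] → ℝ} {B : ℝ} (hg : ∀ h, |g h| ≤ B)
    (hgp : ∀ p ∈ I, ∀ h, h.Monic → g (p * h) = g h) :
    monicSum v (fun h => g h * primeSign I h) =
      monicSum v g * ((1 - v ^ d) / (1 + v ^ d)) ^ I.card := by
  classical
  induction I using Finset.induction_on with
  | empty => simp [primeSign, primeCount]
  | insert p I hpI ih =>
    obtain ⟨hpm, hpi, hpd⟩ := hI p (Finset.mem_insert_self p I)
    have ih := ih (fun r hr => hI r (Finset.mem_insert_of_mem hr))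
      (fun r hr => hgp r (Finset.mem_insert_of_mem hr))
    have hbd : ∀ J : Finset F[X], ∀ h, |g h * primeSign J h| ≤ B := fun J h => by
      rw [abs_mul, abs_primeSign, mul_one]
      exact hg h
    rw [monicSum_sign_flip hv hqv hpm (hbd I) (hbd _), ih, hpd, Finset.card_insert_of_notMem hpI,
      pow_succ, mul_assoc]
    · intro h hh
      rw [primeSign_mul_irreducible I hpm hpi hh.ne_zero, if_neg hpI, one_mul,
        hgp p (Finset.mem_insert_self p I) h hh]
    · intro h hh
      rw [primeSign_mul_irreducible _ hpm hpi hh.ne_zero, if_pos (Finset.mem_insert_self p I),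
        hgp p (Finset.mem_insert_self p I) h hh]
      ring
    · intro h hh
      have : (UniqueFactorizationMonoid.normalizedFactors h).count p = 0 :=
        Multiset.count_eq_zero_of_notMem fun hmem =>
          hh (UniqueFactorizationMonoid.dvd_of_mem_normalizedFactors hmem)
      simp only [primeSign, primeCount, Finset.sum_insert hpI, this, zero_add]

/-- The product of the projections `(1 + c d * primeSign (I d)) / 2` for `d ∈ D`. -/
noncomputable def signProj (I : ℕ → Finset F[X]) (c : ℕ → ℝ) (D : Finset ℕ) (h : F[X]) : ℝ :=
  ∏ d ∈ D, (1 + c d * primeSign (I d) h) / 2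

omit [Fintype F] in
lemma signProj_nonneg {I : ℕ → Finset F[X]} {c : ℕ → ℝ} (hc : ∀ d, c d = 1 ∨ c d = -1)
    (D : Finset ℕ) (h : F[X]) : 0 ≤ signProj I c D h := by
  refine Finset.prod_nonneg fun d _ => ?_
  rcases hc d with h1 | h1 <;> rcases primeSign_eq (I d) h with h2 | h2 <;> rw [h1, h2] <;> norm_num

omit [Fintype F] in
lemma abs_signProj_le {I : ℕ → Finset F[X]} {c : ℕ → ℝ} (hc : ∀ d, c d = 1 ∨ c d = -1)
    (D : Finset ℕ) (h : F[X]) : |signProj I c D h| ≤ 1 := by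
  rw [abs_of_nonneg (signProj_nonneg hc D h)]
  refine Finset.prod_le_one (fun d _ => ?_) fun d _ => ?_ <;>
  rcases hc d with h1 | h1 <;> rcases primeSign_eq (I d) h with h2 | h2 <;> rw [h1, h2] <;> norm_num

lemma monicSum_signProj {v : ℝ} (hv : 0 ≤ v) (hqv : Fintype.card F * v < 1)
    {I : ℕ → Finset F[X]} (hI : ∀ d, ∀ p ∈ I d, p.Monic ∧ Irreducible p ∧ p.natDegree = d)
    {c : ℕ → ℝ} (hc : ∀ d, c d = 1 ∨ c d = -1) (D : Finset ℕ) :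
    monicSum v (signProj I c D) = monicSum (F := F) v (fun _ => 1) *
      ∏ d ∈ D, (1 + c d * ((1 - v ^ d) / (1 + v ^ d)) ^ (I d).card) / 2 := by
  classical
  induction D using Finset.induction_on with
  | empty => simp [signProj, monicSum]
  | insert d D hd ih =>
    have hbd := abs_signProj_le (I := I) hc D
    have hflip := monicSum_mul_primeSign hv hqv (I d) (hI d) hbd fun p hp h hh => by
      obtain ⟨hpm, hpi, hpd⟩ := hI d p hp
      refine Finset.prod_congr rfl fun d' hd' => ?_
      rw [primeSign_mul_irreducible _ hpm hpi hh.ne_zero, if_neg, one_mul]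
      intro hmem
      exact hd ((hpd.symm.trans (hI d' p hmem).2.2) ▸ hd')
    have hbd' : ∀ h, |signProj I c D h * primeSign (I d) h| ≤ 1 := fun h => by
      rw [abs_mul, abs_primeSign, mul_one]
      exact hbd h
    have hsplit : monicSum v (signProj I c (insert d D)) = (monicSum v (signProj I c D) +
        c d * monicSum v (fun h => signProj I c D h * primeSign (I d) h)) / 2 := by
      rw [monicSum, monicSum, monicSum, ← tsum_mul_left,
        ← (summable_mul_pow_natDegree hv hqv hbd).tsum_add
          ((summable_mul_pow_natDegree hv hqv hbd').mul_left _), ← tsum_div_const]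
      refine tsum_congr fun h => ?_
      simp only [signProj, Finset.prod_insert hd]
      ring
    rw [hsplit, hflip, ih, Finset.prod_insert hd]
    ring

end WeightedSum

section MeanValue

variable {F : Type} [Field F] [Fintype F]

omit [Fintype F] in
open scoped Classical in
lemma primeSign_pow_mul (I : Finset F[X]) {p h : F[X]} (hp : p.Monic)
    (hi : Irreducible p) (hh : h ≠ 0) (j : ℕ) :
    primeSign I (p ^ j * h) = (if p ∈ I then -1 else 1) ^ j * primeSign I h := by
  induction j with
  | zero => simp
  | succ j ih =>
    rw [pow_succ', mul_assoc,
      primeSign_mul_irreducible I hp hi (mul_ne_zero (pow_ne_zero j hp.ne_zero) hh), ih]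
    ring

/-- The sign vector that is `-1` at `d` and `1` elsewhere. -/
def flipAt (d : ℕ) : ℕ → ℝ := fun e => if e = d then -1 else 1

lemma flipAt_eq (d e : ℕ) : flipAt d e = 1 ∨ flipAt d e = -1 := by
  unfold flipAt
  split_ifs <;> simp

omit [Fintype F] in
lemma signProj_pow_mul_le {I : ℕ → Finset F[X]}
    (hI : ∀ d, ∀ p ∈ I d, p.Monic ∧ Irreducible p ∧ p.natDegree = d) (D : Finset ℕ)
    (p h : F[X]) (j : ℕ) (hp : p.Monic) (hi : Irreducible p) (hh : h.Monic) :
    signProj I (fun _ => 1) D (p ^ j * h) ≤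
      signProj I (fun _ => 1) D h + ∑ d ∈ D, signProj I (flipAt d) D h := by
  classical
  have h0 := signProj_nonneg (I := I) (c := fun _ => 1) (fun _ => Or.inl rfl) D h
  have h1 : ∀ d ∈ D, 0 ≤ signProj I (flipAt d) D h := fun d _ => signProj_nonneg (flipAt_eq d) D h
  by_cases hcase : p ∈ I p.natDegree ∧ p.natDegree ∈ D ∧ Odd j
  · obtain ⟨hpI, hpD, hj⟩ := hcase
    have : signProj I (fun _ => 1) D (p ^ j * h) = signProj I (flipAt p.natDegree) D h := by
      refine Finset.prod_congr rfl fun d _ => ?_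
      rw [primeSign_pow_mul _ hp hi hh.ne_zero, flipAt]
      by_cases hd : d = p.natDegree
      · rw [if_pos hd, hd, if_pos hpI, hj.neg_one_pow, one_mul]
      · rw [if_neg hd, if_neg fun hm => hd (hI d p hm).2.2.symm, one_pow, one_mul]
    rw [this]
    have := Finset.single_le_sum h1 hpD
    linarith
  · have : signProj I (fun _ => 1) D (p ^ j * h) = signProj I (fun _ => 1) D h := by
      refine Finset.prod_congr rfl fun d hd => ?_
      rw [primeSign_pow_mul _ hp hi hh.ne_zero]
      by_cases hm : p ∈ I d
      · have hdp := (hI d p hm).2.2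
        have hj : ¬ Odd j := fun hj => hcase ⟨hdp ▸ hm, hdp ▸ hd, hj⟩
        rw [if_pos hm, (Nat.not_odd_iff_even.1 hj).neg_one_pow, one_mul]
      · rw [if_neg hm, one_pow, one_mul]
    rw [this]
    have := Finset.sum_nonneg h1
    linarith

lemma ratio_pow_bounds {x : ℝ} (hx : 0 ≤ x) (hx1 : x ≤ 1) (s : ℕ) :
    0 ≤ ((1 - x) / (1 + x)) ^ s ∧ 1 - 2 * (s * x) ≤ ((1 - x) / (1 + x)) ^ s ∧
      ((1 - x) / (1 + x)) ^ s ≤ Real.exp (-2 * (s * x)) := by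
  have h0 : 0 ≤ (1 - x) / (1 + x) := div_nonneg (by linarith) (by linarith)
  have hlow : 1 - 2 * x ≤ (1 - x) / (1 + x) := by
    rw [le_div_iff₀ (by linarith)]
    nlinarith
  have hup : (1 - x) / (1 + x) ≤ Real.exp (-2 * x) := by
    rcases hx1.eq_or_lt with rfl | hx1
    · rw [sub_self, zero_div]
      exact (Real.exp_pos _).le
    have hlog : x ≤ 1 / 2 * Real.log ((1 + x) / (1 - x)) := by
      simpa using Real.sum_range_le_log_div hx hx1 1
    have hpos : 0 < (1 + x) / (1 - x) := div_pos (by linarith) (by linarith)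
    rw [← Real.log_le_iff_le_exp (div_pos (by linarith) (by linarith)), ← inv_div, Real.log_inv]
    linarith
  refine ⟨pow_nonneg h0 s, ?_, ?_⟩
  · have := one_add_mul_le_pow (a := (1 - x) / (1 + x) - 1) (by linarith) s
    rw [add_sub_cancel] at this
    have hs : (0 : ℝ) ≤ s := Nat.cast_nonneg s
    nlinarith
  · refine (pow_le_pow_left₀ h0 hup s).trans ?_
    rw [← Real.exp_nat_mul]
    exact Real.exp_le_exp.2 (by linarith)

lemma half_one_add_exp_le (y : ℝ) :
    (1 + Real.exp (-2 * y)) / 2 ≤ Real.exp (-y + y ^ 2) := by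
  have hcosh : Real.cosh y ≤ Real.exp (y ^ 2 / 2) := Real.cosh_le_exp_half_sq y
  have h1 : (1 + Real.exp (-2 * y)) / 2 = Real.exp (-y) * Real.cosh y := by
    rw [Real.cosh_eq, mul_div_assoc', mul_add, ← Real.exp_add, ← Real.exp_add]
    ring_nf
    rw [Real.exp_zero]
    ring
  rw [h1, Real.exp_add]
  refine mul_le_mul_of_nonneg_left (hcosh.trans (Real.exp_le_exp.2 ?_)) (Real.exp_pos _).le
  nlinarith [sq_nonneg y]

lemma prod_flipAt_le {r : ℕ → ℝ} (h0 : ∀ d, 0 ≤ r d) (h1 : ∀ d, r d ≤ 1) {D : Finset ℕ} {e : ℕ}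
    (he : e ∈ D) :
    ∏ d ∈ D, (1 + flipAt e d * r d) / 2 ≤ (∏ d ∈ D, (1 + r d) / 2) * (1 - r e) := by
  rw [← Finset.mul_prod_erase D _ he, ← Finset.mul_prod_erase D _ he]
  have hrest : ∏ d ∈ D.erase e, (1 + flipAt e d * r d) / 2 = ∏ d ∈ D.erase e, (1 + r d) / 2 :=
    Finset.prod_congr rfl fun d hd => by simp [flipAt, Finset.ne_of_mem_erase hd]
  have hpos : 0 ≤ ∏ d ∈ D.erase e, (1 + r d) / 2 :=
    Finset.prod_nonneg fun d _ => by linarith [h0 d]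
  rw [hrest]
  have : (1 + flipAt e e * r e) / 2 ≤ (1 + r e) / 2 * (1 - r e) := by
    simp only [flipAt, if_true]
    nlinarith [h0 e, h1 e]
  calc _ ≤ (1 + r e) / 2 * (1 - r e) * ∏ d ∈ D.erase e, (1 + r d) / 2 :=
        mul_le_mul_of_nonneg_right this hpos
    _ = _ := by ring

/-- The mean value of `signProj` over monic polynomials of degree `m`, bounded by an Euler
product. -/
lemma mul_sum_signProj_le {I : ℕ → Finset F[X]}
    (hI : ∀ d, ∀ p ∈ I d, p.Monic ∧ Irreducible p ∧ p.natDegree = d) (D : Finset ℕ)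
    (m : ℕ) {t : ℝ} (ht : 0 < t) (ht1 : t < 1) {y : ℕ → ℝ}
    (hy : ∀ d, y d = (I d).card * (t / Fintype.card F) ^ d) :
    m * ∑ f ∈ monicFin F m, signProj I (fun _ => 1) D f ≤
      (Fintype.card F : ℝ) ^ m * (t⁻¹ ^ m * ((1 - t)⁻¹ *
        (Real.exp (∑ d ∈ D, (-y d + y d ^ 2)) * (1 + ∑ d ∈ D, 2 * y d)))) := by
  set q : ℝ := (Fintype.card F : ℝ) with hq
  have hq0 : 0 < q := by
    have : 0 < Fintype.card F := Fintype.card_pos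
    rw [hq]
    exact_mod_cast this
  have hq1 : 1 ≤ q := by
    have : 1 ≤ Fintype.card F := Fintype.card_pos
    rw [hq]
    exact_mod_cast this
  set v : ℝ := t / q with hv
  have hv0 : 0 ≤ v := by positivity
  have hqv' : q * v = t := by rw [hv]; field_simp
  have hqv : (Fintype.card F : ℝ) * v < 1 := by rw [← hq, hqv']; exact ht1
  have hv1 : v ≤ 1 := by
    rw [hv, div_le_one hq0]
    linarith
  set r : ℕ → ℝ := fun d => ((1 - v ^ d) / (1 + v ^ d)) ^ (I d).card with hr
  have hrb : ∀ d, 0 ≤ r d ∧ 1 - 2 * y d ≤ r d ∧ r d ≤ Real.exp (-2 * y d) := fun d => by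
    have := ratio_pow_bounds (pow_nonneg hv0 d) (pow_le_one₀ hv0 hv1) (I d).card
    rwa [← hy d] at this
  have hy0 : ∀ d, 0 ≤ y d := fun d => by rw [hy]; positivity
  have hr1 : ∀ d, r d ≤ 1 := fun d =>
    (hrb d).2.2.trans (Real.exp_le_one_iff.2 (by linarith [hy0 d]))
  set w : F[X] → ℝ := fun h =>
    signProj I (fun _ => 1) D h + ∑ d ∈ D, signProj I (flipAt d) D h with hw
  have hone : ∀ d : ℕ, (fun _ : ℕ => (1 : ℝ)) d = 1 ∨ (fun _ : ℕ => (1 : ℝ)) d = -1 :=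
    fun _ => Or.inl rfl
  have hg0 : ∀ h : F[X], 0 ≤ signProj I (fun _ => 1) D h := signProj_nonneg hone D
  have hw0 : ∀ h, 0 ≤ w h := fun h =>
    add_nonneg (hg0 h) (Finset.sum_nonneg fun d _ => signProj_nonneg (flipAt_eq d) D h)
  have hwB : ∀ h, |w h| ≤ 1 + D.card := fun h => by
    rw [abs_of_nonneg (hw0 h)]
    refine add_le_add ((le_abs_self _).trans (abs_signProj_le hone D h)) ?_
    refine (Finset.sum_le_card_nsmul D _ 1 fun d _ =>
      (le_abs_self _).trans (abs_signProj_le (flipAt_eq d) D h)).trans ?_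
    simp
  have hS : monicSum v w ≤ (1 - t)⁻¹ *
      (Real.exp (∑ d ∈ D, (-y d + y d ^ 2)) * (1 + ∑ d ∈ D, 2 * y d)) := by
    have hsplit : monicSum v w = monicSum v (signProj I (fun _ => 1) D) +
        ∑ d ∈ D, monicSum v (signProj I (flipAt d) D) := by
      have hs := fun d => summable_mul_pow_natDegree (F := F) hv0 hqv
        (abs_signProj_le (I := I) (flipAt_eq d) D)
      simp only [monicSum]
      rw [← Summable.tsum_finsetSum fun d _ => hs d,
        ← (summable_mul_pow_natDegree hv0 hqv (abs_signProj_le hone D)).tsum_add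
          (summable_sum fun d _ => hs d)]
      refine tsum_congr fun h => ?_
      rw [hw]
      simp only [add_mul, Finset.sum_mul]
    have hP0 : 0 ≤ ∏ d ∈ D, (1 + r d) / 2 := Finset.prod_nonneg fun d _ => by
      linarith [(hrb d).1]
    have hP : ∏ d ∈ D, (1 + r d) / 2 ≤ Real.exp (∑ d ∈ D, (-y d + y d ^ 2)) := by
      rw [Real.exp_sum]
      refine Finset.prod_le_prod (fun d _ => by linarith [(hrb d).1]) fun d _ => ?_
      exact le_trans (by linarith [(hrb d).2.2]) (half_one_add_exp_le (y d))
    have hA : monicSum (F := F) v (fun _ => 1) ≤ (1 - t)⁻¹ := by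
      rw [← hqv']
      exact monicSum_one_le hv0 hqv
    have hA0 : 0 ≤ monicSum (F := F) v (fun _ => 1) :=
      tsum_nonneg fun h => mul_nonneg zero_le_one (pow_nonneg hv0 _)
    have hy2 : 0 ≤ ∑ d ∈ D, 2 * y d := Finset.sum_nonneg fun d _ => by linarith [hy0 d]
    rw [hsplit, monicSum_signProj hv0 hqv hI hone,
      Finset.sum_congr rfl fun d _ => monicSum_signProj hv0 hqv hI (flipAt_eq d) D,
      ← Finset.mul_sum, ← mul_add]
    refine mul_le_mul hA ?_ ?_ (inv_nonneg.2 (by linarith))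
    · calc (∏ d ∈ D, (1 + 1 * r d) / 2) + ∑ e ∈ D, ∏ d ∈ D, (1 + flipAt e d * r d) / 2
          ≤ (∏ d ∈ D, (1 + r d) / 2) + ∑ e ∈ D, (∏ d ∈ D, (1 + r d) / 2) * (2 * y e) := by
            refine add_le_add (by simp) (Finset.sum_le_sum fun e he => ?_)
            refine (prod_flipAt_le (fun d => (hrb d).1) hr1 he).trans ?_
            exact mul_le_mul_of_nonneg_left (by linarith [(hrb e).2.1]) hP0
        _ = (∏ d ∈ D, (1 + r d) / 2) * (1 + ∑ d ∈ D, 2 * y d) := by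
            rw [← Finset.mul_sum]
            ring
        _ ≤ _ := mul_le_mul_of_nonneg_right hP (by linarith)
    · refine add_nonneg (Finset.prod_nonneg fun d _ => ?_)
        (Finset.sum_nonneg fun e _ => Finset.prod_nonneg fun d _ => ?_)
      · have := (hrb d).1
        simp only [hr] at this
        linarith
      · have h2 := (hrb d).1
        have h3 := hr1 d
        simp only [hr] at h2 h3
        rcases flipAt_eq e d with h | h <;> rw [h] <;> linarith
  calc m * ∑ f ∈ monicFin F m, signProj I (fun _ => 1) D f
      ≤ ∑ k ∈ Finset.Icc 1 m, q ^ k * ∑ h ∈ monicFin F (m - k), w h :=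
        mul_sum_monicFin_le hg0 hw0 (signProj_pow_mul_le hI D) m
    _ ≤ ∑ k ∈ Finset.Icc 1 m, q ^ m * t⁻¹ ^ m * (v ^ (m - k) * ∑ h ∈ monicFin F (m - k), w h) := by
        refine Finset.sum_le_sum fun k hk => ?_
        rw [Finset.mem_Icc] at hk
        rw [← mul_assoc]
        refine mul_le_mul_of_nonneg_right ?_ (Finset.sum_nonneg fun h _ => hw0 h)
        obtain ⟨l, rfl⟩ := Nat.exists_eq_add_of_le hk.2
        rw [Nat.add_sub_cancel_left, hv, div_pow, pow_add, pow_add, inv_pow, inv_pow]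
        have : 1 ≤ (t ^ k)⁻¹ := (one_le_inv₀ (by positivity)).2 (pow_le_one₀ ht.le ht1.le)
        calc q ^ k = q ^ k * 1 := (mul_one _).symm
          _ ≤ q ^ k * (t ^ k)⁻¹ := by gcongr
          _ = _ := by field_simp
    _ = q ^ m * t⁻¹ ^ m * ∑ l ∈ Finset.range m, v ^ l * ∑ h ∈ monicFin F l, w h := by
        rw [← Finset.mul_sum]
        congr 1
        refine Finset.sum_bij' (fun k _ => m - k) (fun l _ => m - l) ?_ ?_ ?_ ?_ fun _ _ => rfl <;>
          simp only [Finset.mem_Icc, Finset.mem_range] <;> intros <;> omega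
    _ ≤ q ^ m * t⁻¹ ^ m * monicSum v w := by
        refine mul_le_mul_of_nonneg_left ?_ (by positivity)
        exact sum_monicFin_le_monicSum hv0 hqv hw0 hwB _
    _ ≤ q ^ m * t⁻¹ ^ m * _ := mul_le_mul_of_nonneg_left hS (by positivity)
    _ = _ := by ring

lemma sum_inv_sq_le (n : ℕ) : ∑ e ∈ Finset.Icc 1 n, ((e : ℝ) ^ 2)⁻¹ ≤ 2 := by
  have key : ∀ n : ℕ, ∑ e ∈ Finset.Icc 1 (n + 1), ((e : ℝ) ^ 2)⁻¹ ≤ 2 - 1 / ((n : ℝ) + 1) := by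
    intro n
    induction n with
    | zero => norm_num
    | succ n ih =>
      rw [Finset.sum_Icc_succ_top (by omega)]
      have : (((n + 1 + 1 : ℕ) : ℝ) ^ 2)⁻¹ ≤ 1 / ((n : ℝ) + 1) - 1 / (((n + 1 : ℕ) : ℝ) + 1) := by
        push_cast
        rw [div_sub_div _ _ (by positivity) (by positivity), inv_eq_one_div,
          div_le_div_iff₀ (by positivity) (by positivity)]
        ring_nf
        nlinarith [(Nat.cast_nonneg n : (0 : ℝ) ≤ n)]
      linarith
  rcases n with _ | n
  · simp
  · have : (0 : ℝ) ≤ 1 / ((n : ℝ) + 1) := by positivity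
    linarith [key n]

/-- The even integers in `[1, m / 2]`. -/
def evenUpTo (m : ℕ) : Finset ℕ := (Finset.Icc 1 (m / 4)).image (2 * ·)

lemma sum_evenUpTo (m : ℕ) (f : ℕ → ℝ) :
    ∑ d ∈ evenUpTo m, f d = ∑ e ∈ Finset.Icc 1 (m / 4), f (2 * e) :=
  Finset.sum_image fun a _ b _ h => by simpa using h

lemma sum_evenUpTo_bounds {m : ℕ} (hm : 1 ≤ m) {y : ℕ → ℝ}
    (hyb : ∀ d : ℕ, Even d → 0 < d →
      0 ≤ y d ∧ y d ≤ 1 / d ∧ 1 / (2 * d) - 3 / (d : ℝ) ^ 2 - 1 / (m + 1) ≤ y d) :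
    ∑ d ∈ evenUpTo m, (-y d + y d ^ 2) ≤ 3 - 1 / 4 * Real.log ((m : ℝ) / 4) ∧
      1 + ∑ d ∈ evenUpTo m, 2 * y d ≤ 2 + Real.log m := by
  have hm0 : (0 : ℝ) < m := by exact_mod_cast hm
  have hm1 : (1 : ℝ) ≤ m := by exact_mod_cast hm
  have hye : ∀ e ∈ Finset.Icc 1 (m / 4), 0 ≤ y (2 * e) ∧ y (2 * e) ≤ (e : ℝ)⁻¹ / 2 ∧
      (e : ℝ)⁻¹ / 4 - 3 / 4 * ((e : ℝ) ^ 2)⁻¹ - 1 / (m + 1) ≤ y (2 * e) := by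
    intro e he
    have he1 := (Finset.mem_Icc.1 he).1
    have he0 : (0 : ℝ) < e := by exact_mod_cast he1
    obtain ⟨h1, h2, h3⟩ := hyb (2 * e) (even_two_mul e) (by omega)
    refine ⟨h1, h2.trans (le_of_eq ?_), le_trans (le_of_eq ?_) h3⟩
    · push_cast
      field_simp
    · push_cast
      field_simp
      ring
  have hharm : ∑ e ∈ Finset.Icc 1 (m / 4), (e : ℝ)⁻¹ = (harmonic (m / 4) : ℝ) := by
    rw [harmonic_eq_sum_Icc]
    push_cast
    rfl
  have hcard : ((m / 4 : ℕ) : ℝ) * (1 / (m + 1)) ≤ 1 := by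
    rw [mul_one_div, div_le_one (by positivity)]
    have : m / 4 ≤ m + 1 := by omega
    exact_mod_cast this
  have hlogm : Real.log ((m : ℝ) / 4) ≤ harmonic (m / 4) := by
    refine le_trans (Real.log_le_log (by positivity) ?_) (log_add_one_le_harmonic (m / 4))
    have : m ≤ 4 * (m / 4 + 1) := by omega
    have : (m : ℝ) ≤ 4 * (((m / 4 : ℕ) : ℝ) + 1) := by exact_mod_cast this
    push_cast
    linarith
  have hlogm' : (harmonic (m / 4) : ℝ) ≤ 1 + Real.log m := by
    refine (harmonic_le_one_add_log (m / 4)).trans (add_le_add_right ?_ 1)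
    rcases Nat.eq_zero_or_pos (m / 4) with h | h
    · rw [h, Nat.cast_zero, Real.log_zero]
      exact Real.log_nonneg hm1
    · exact Real.log_le_log (by exact_mod_cast h) (by exact_mod_cast Nat.div_le_self m 4)
  constructor
  · rw [sum_evenUpTo]
    calc ∑ e ∈ Finset.Icc 1 (m / 4), (-y (2 * e) + y (2 * e) ^ 2)
        ≤ ∑ e ∈ Finset.Icc 1 (m / 4),
            (-(1 / 4) * (e : ℝ)⁻¹ + ((e : ℝ) ^ 2)⁻¹ + 1 / (m + 1)) := by
          refine Finset.sum_le_sum fun e he => ?_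
          obtain ⟨h1, h2, h3⟩ := hye e he
          have h4 : y (2 * e) ^ 2 ≤ ((e : ℝ)⁻¹ / 2) ^ 2 := pow_le_pow_left₀ h1 h2 2
          rw [div_pow, inv_pow] at h4
          linarith
      _ = -(1 / 4) * (harmonic (m / 4) : ℝ) + ∑ e ∈ Finset.Icc 1 (m / 4), ((e : ℝ) ^ 2)⁻¹ +
            ((m / 4 : ℕ) : ℝ) * (1 / (m + 1)) := by
          rw [Finset.sum_add_distrib, Finset.sum_add_distrib, ← Finset.mul_sum, hharm,
            Finset.sum_const, Nat.card_Icc, nsmul_eq_mul, Nat.add_sub_cancel]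
      _ ≤ _ := by linarith [sum_inv_sq_le (m / 4)]
  · rw [sum_evenUpTo]
    have : ∑ e ∈ Finset.Icc 1 (m / 4), 2 * y (2 * e) ≤ (harmonic (m / 4) : ℝ) := by
      rw [← hharm]
      exact Finset.sum_le_sum fun e he => by linarith [(hye e he).2.1]
    linarith

lemma sum_signProj_evenUpTo_le {I : ℕ → Finset F[X]}
    (hI : ∀ d, ∀ p ∈ I d, p.Monic ∧ Irreducible p ∧ p.natDegree = d)
    (hlow : ∀ d, Even d → 0 < d →
      (Fintype.card F : ℝ) ^ d * (1 - 6 / d) ≤ 2 * d * (I d).card) {m : ℕ} (hm : 1 ≤ m) :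
    ∑ f ∈ monicFin F m, signProj I (fun _ => 1) (evenUpTo m) f ≤
      2 * Real.exp 4 * (Fintype.card F : ℝ) ^ m * ((m : ℝ) / 4) ^ (-(1 / 4) : ℝ) *
        (2 + Real.log m) := by
  have hm0 : (0 : ℝ) < m := by exact_mod_cast hm
  have hm1 : (1 : ℝ) ≤ m := by exact_mod_cast hm
  set q : ℝ := (Fintype.card F : ℝ) with hq
  have hq0 : 0 < q := by
    have : 0 < Fintype.card F := Fintype.card_pos
    rw [hq]
    exact_mod_cast this
  set t : ℝ := m / (m + 1) with ht
  have ht0 : 0 < t := by positivity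
  have ht1 : t < 1 := by rw [ht, div_lt_one (by positivity)]; linarith
  have htinv : t⁻¹ = 1 + 1 / m := by rw [ht]; field_simp
  have h1t : 1 - t = 1 / (m + 1) := by rw [ht]; field_simp; ring
  set y : ℕ → ℝ := fun d => (I d).card * (t / q) ^ d with hy
  have hmain := mul_sum_signProj_le hI (evenUpTo m) m ht0 ht1 (y := y) fun _ => rfl
  have hyb : ∀ d : ℕ, Even d → 0 < d →
      0 ≤ y d ∧ y d ≤ 1 / d ∧ 1 / (2 * d) - 3 / (d : ℝ) ^ 2 - 1 / (m + 1) ≤ y d := by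
    intro d hde hd
    have hd0 : (0 : ℝ) < d := by exact_mod_cast hd
    set z : ℝ := (I d).card / q ^ d with hz
    have hz0 : 0 ≤ z := by positivity
    have hyz : y d = z * t ^ d := by
      simp only [hy, hz, div_pow]
      ring
    have hz1 : z ≤ 1 / d := by
      have h := sum_natDegree_le_card_pow hd.ne' fun p hp =>
        ⟨(hI d p hp).1, (hI d p hp).2.1, (hI d p hp).2.2.dvd⟩
      rw [Finset.sum_congr rfl fun p hp => (hI d p hp).2.2, Finset.sum_const, smul_eq_mul] at h
      rw [hz, div_le_div_iff₀ (by positivity) hd0, one_mul]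
      rw [hq]
      exact_mod_cast h
    have hz2 : 1 / (2 * d) - 3 / (d : ℝ) ^ 2 ≤ z := by
      rw [hz, le_div_iff₀ (by positivity)]
      have := hlow d hde hd
      have h2 : (1 / (2 * d) - 3 / (d : ℝ) ^ 2) * q ^ d = q ^ d * (1 - 6 / d) / (2 * d) := by
        field_simp
        ring
      rw [h2, div_le_iff₀ (by positivity)]
      linarith
    have htd : 1 - d / (m + 1) ≤ t ^ d := by
      have := one_add_mul_le_pow (a := t - 1) (by linarith) d
      rw [add_sub_cancel] at this
      have h3 : 1 + (d : ℝ) * (t - 1) = 1 - d / (m + 1) := by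
        rw [show t - 1 = -(1 - t) by ring, h1t]
        ring
      linarith
    have htd1 : t ^ d ≤ 1 := pow_le_one₀ ht0.le ht1.le
    rw [hyz]
    refine ⟨by positivity, (mul_le_of_le_one_right hz0 htd1).trans hz1, ?_⟩
    have h4 : z * (1 - d / (m + 1)) ≤ z * t ^ d := mul_le_mul_of_nonneg_left htd hz0
    have h5 : z * (d / (m + 1)) ≤ 1 / d * (d / (m + 1)) :=
      mul_le_mul_of_nonneg_right hz1 (by positivity)
    have h6 : 1 / (d : ℝ) * (d / (m + 1)) = 1 / (m + 1) := by field_simp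
    linarith
  obtain ⟨hexp, hlin⟩ := sum_evenUpTo_bounds hm hyb
  have htm : t⁻¹ ^ m ≤ Real.exp 1 := by
    rw [htinv]
    calc (1 + 1 / (m : ℝ)) ^ m ≤ Real.exp (1 / m) ^ m :=
          pow_le_pow_left₀ (by positivity) (by linarith [Real.add_one_le_exp (1 / (m : ℝ))]) m
      _ = Real.exp 1 := by rw [← Real.exp_nat_mul, mul_one_div_cancel hm0.ne']
  have hrpow : Real.exp (3 - 1 / 4 * Real.log ((m : ℝ) / 4)) =
      Real.exp 3 * ((m : ℝ) / 4) ^ (-(1 / 4) : ℝ) := by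
    rw [Real.rpow_def_of_pos (by positivity), ← Real.exp_add]
    ring_nf
  have hlog0 : 0 ≤ Real.log m := Real.log_nonneg hm1
  have hbound : t⁻¹ ^ m * ((1 - t)⁻¹ * (Real.exp (∑ d ∈ evenUpTo m, (-y d + y d ^ 2)) *
      (1 + ∑ d ∈ evenUpTo m, 2 * y d))) ≤ Real.exp 1 * ((m + 1) *
        (Real.exp 3 * ((m : ℝ) / 4) ^ (-(1 / 4) : ℝ) * (2 + Real.log m))) := by
    rw [h1t, one_div, inv_inv, ← hrpow]
    have hnn : 0 ≤ 1 + ∑ d ∈ evenUpTo m, 2 * y d :=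
      add_nonneg zero_le_one (Finset.sum_nonneg fun d _ => mul_nonneg zero_le_two
        (mul_nonneg (Nat.cast_nonneg _) (pow_nonneg (div_nonneg ht0.le hq0.le) d)))
    have hm2 : (0 : ℝ) ≤ m + 1 := by linarith
    exact mul_le_mul htm (mul_le_mul_of_nonneg_left
      (mul_le_mul (Real.exp_le_exp.2 hexp) hlin hnn (Real.exp_pos _).le) hm2)
      (mul_nonneg hm2 (mul_nonneg (Real.exp_pos _).le hnn)) (Real.exp_pos _).le
  refine le_of_mul_le_mul_left ?_ hm0
  refine hmain.trans ((mul_le_mul_of_nonneg_left hbound (by positivity)).trans ?_)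
  have hexp4 : Real.exp 4 = Real.exp 1 * Real.exp 3 := by
    rw [← Real.exp_add]
    norm_num
  have hA : 0 ≤ q ^ m * Real.exp 4 * ((m : ℝ) / 4) ^ (-(1 / 4) : ℝ) * (2 + Real.log m) := by
    positivity
  calc q ^ m * (Real.exp 1 * ((m + 1) * (Real.exp 3 * ((m : ℝ) / 4) ^ (-(1 / 4) : ℝ) *
        (2 + Real.log m))))
      = (m + 1) * (q ^ m * Real.exp 4 * ((m : ℝ) / 4) ^ (-(1 / 4) : ℝ) * (2 + Real.log m)) := by
        rw [hexp4]
        ring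
    _ ≤ (2 * m) * (q ^ m * Real.exp 4 * ((m : ℝ) / 4) ^ (-(1 / 4) : ℝ) * (2 + Real.log m)) :=
        mul_le_mul_of_nonneg_right (by linarith) hA
    _ = _ := by ring

end MeanValue

section Palindromic

variable {F : Type} [Field F]

/-- `f` has degree at most `2 * m` and its coefficients are symmetric about `m`. -/
def PalSym (m : ℕ) (f : F[X]) : Prop := f.natDegree ≤ 2 * m ∧ f.reflect (2 * m) = f

lemma PalSym.add {m : ℕ} {f g : F[X]} (hf : PalSym m f) (hg : PalSym m g) : PalSym m (f + g) :=
  ⟨(natDegree_add_le f g).trans (max_le hf.1 hg.1), by rw [reflect_add, hf.2, hg.2]⟩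

lemma PalSym.sub {m : ℕ} {f g : F[X]} (hf : PalSym m f) (hg : PalSym m g) : PalSym m (f - g) :=
  ⟨(natDegree_sub_le f g).trans (max_le hf.1 hg.1), by rw [reflect_sub, hf.2, hg.2]⟩

lemma PalSym.mul {m k : ℕ} {f g : F[X]} (hf : PalSym m f) (hg : PalSym k g) :
    PalSym (m + k) (f * g) :=
  ⟨natDegree_mul_le.trans (by have := hf.1; have := hg.1; omega), by
    rw [mul_add, reflect_mul f g hf.1 hg.1, hf.2, hg.2]⟩

lemma palSym_C (c : F) : PalSym 0 (C c) := ⟨by simp, by simp⟩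

lemma palSym_X_pow (j : ℕ) : PalSym j (X ^ j : F[X]) :=
  ⟨by rw [natDegree_X_pow]; omega, by
    rw [reflect_monomial, revAt_le (by omega)]
    congr 1
    omega⟩

lemma palSym_X_sq_add_one_pow (i : ℕ) : PalSym i ((X ^ 2 + 1 : F[X]) ^ i) := by
  induction i with
  | zero => simpa using palSym_C (1 : F)
  | succ i ih =>
    rw [pow_succ]
    refine ih.mul ⟨by compute_degree, ?_⟩
    rw [reflect_add, reflect_monomial, reflect_one, revAt_le (by omega)]
    simp [add_comm]

lemma PalSym.coeff_two_mul {m : ℕ} {f : F[X]} (hf : PalSym m f) :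
    f.coeff (2 * m) = f.coeff 0 := by
  conv_rhs => rw [← hf.2]
  rw [coeff_reflect, revAt_zero]

/-- The polynomial `X ^ m * H (X + 1 / X)` for `H` of degree at most `m`. -/
noncomputable def palOfDegree (m : ℕ) (H : F[X]) : F[X] :=
  ∑ i ∈ Finset.range (m + 1), C (H.coeff i) * X ^ (m - i) * (X ^ 2 + 1) ^ i

/-- The palindromic polynomial `X ^ m * H (X + 1 / X)` where `m` is the degree of `H`. -/
noncomputable def pal (H : F[X]) : F[X] := palOfDegree H.natDegree H

lemma palSym_palOfDegree (m : ℕ) (H : F[X]) : PalSym m (palOfDegree m H) := by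
  refine Finset.sum_induction _ (PalSym m) (fun _ _ => PalSym.add) ⟨by simp, by simp⟩ fun i hi => ?_
  have hi : i ≤ m := Nat.lt_succ_iff.1 (Finset.mem_range.1 hi)
  have := ((palSym_C (H.coeff i)).mul (palSym_X_pow (m - i))).mul (palSym_X_sq_add_one_pow i)
  rwa [zero_add, Nat.sub_add_cancel hi] at this

lemma coeff_zero_palOfDegree (m : ℕ) (H : F[X]) : (palOfDegree m H).coeff 0 = H.coeff m := by
  rw [coeff_zero_eq_eval_zero, palOfDegree, eval_finsetSum, Finset.sum_range_succ,
    Finset.sum_eq_zero]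
  · simp
  · intro i hi
    have : m - i ≠ 0 := by have := Finset.mem_range.1 hi; omega
    simp [this]

lemma coeff_zero_pal (H : F[X]) : (pal H).coeff 0 = H.leadingCoeff :=
  coeff_zero_palOfDegree _ _

lemma monic_pal {H : F[X]} (hH : H.Monic) :
    (pal H).Monic ∧ (pal H).natDegree = 2 * H.natDegree := by
  have hsym := palSym_palOfDegree H.natDegree H
  have hc : (pal H).coeff (2 * H.natDegree) = 1 :=
    hsym.coeff_two_mul.trans ((coeff_zero_pal H).trans hH)
  have hdeg : (pal H).natDegree = 2 * H.natDegree :=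
    le_antisymm hsym.1 (le_natDegree_of_ne_zero (by rw [hc]; exact one_ne_zero))
  exact ⟨by rw [Monic, leadingCoeff, hdeg, hc], hdeg⟩

lemma isStarSymm_iff_of_coeff_zero {f : F[X]} (h0 : f.coeff 0 = 1) :
    IsStarSymm f ↔ f.reverse = f := by
  simp [IsStarSymm, h0]

lemma isStarSymm_pal {H : F[X]} (hH : H.Monic) : IsStarSymm (pal H) := by
  rw [isStarSymm_iff_of_coeff_zero ((coeff_zero_pal H).trans hH), reverse, (monic_pal hH).2]
  exact (palSym_palOfDegree H.natDegree H).2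

lemma algebraMap_palOfDegree {m : ℕ} {H : F[X]} (hm : H.natDegree ≤ m) :
    algebraMap F[X] (RatFunc F) (palOfDegree m H) =
      (RatFunc.X : RatFunc F) ^ m * aeval (RatFunc.X + (RatFunc.X : RatFunc F)⁻¹) H := by
  have hX : (RatFunc.X : RatFunc F) ≠ 0 := RatFunc.X_ne_zero
  rw [aeval_eq_sum_range' (Nat.lt_succ_of_le hm), palOfDegree, map_sum, Finset.mul_sum]
  refine Finset.sum_congr rfl fun i hi => ?_
  obtain ⟨k, rfl⟩ := Nat.exists_eq_add_of_le (Nat.lt_succ_iff.1 (Finset.mem_range.1 hi))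
  have h1 : (RatFunc.X : RatFunc F) ^ 2 + 1 =
      RatFunc.X * (RatFunc.X + (RatFunc.X : RatFunc F)⁻¹) := by
    field_simp
  simp only [map_mul, map_pow, map_add, map_one, RatFunc.algebraMap_X, RatFunc.algebraMap_C,
    Nat.add_sub_cancel_left, h1, Algebra.smul_def, RatFunc.algebraMap_eq_C, mul_pow, pow_add]
  generalize (RatFunc.X : RatFunc F) + (RatFunc.X : RatFunc F)⁻¹ = y
  ring

lemma aeval_X_add_inv_eq_zero {D : F[X]}
    (hD : aeval (RatFunc.X + (RatFunc.X : RatFunc F)⁻¹) D = 0) : D = 0 := by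
  have h : algebraMap F[X] (RatFunc F) (pal D) = 0 := by
    rw [pal, algebraMap_palOfDegree le_rfl, hD, mul_zero]
  have h0 : pal D = 0 := (map_eq_zero_iff _ (RatFunc.algebraMap_injective F)).1 h
  have := coeff_zero_pal D
  rw [h0, coeff_zero] at this
  exact leadingCoeff_eq_zero.1 this.symm

lemma pal_mul {G H : F[X]} (hG : G ≠ 0) (hH : H ≠ 0) : pal (G * H) = pal G * pal H := by
  apply RatFunc.algebraMap_injective F
  rw [map_mul, pal, pal, pal, algebraMap_palOfDegree le_rfl, algebraMap_palOfDegree le_rfl,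
    algebraMap_palOfDegree le_rfl, natDegree_mul hG hH, map_mul]
  ring

lemma pal_one : pal (1 : F[X]) = 1 := by
  simp [pal, palOfDegree]

lemma pal_injOn {G H : F[X]} (hG : G.Monic) (hH : H.Monic) (h : pal G = pal H) : G = H := by
  have hdeg : G.natDegree = H.natDegree := by
    have h1 := (monic_pal hG).2
    rw [h, (monic_pal hH).2] at h1
    omega
  have h2 := congrArg (algebraMap F[X] (RatFunc F)) h
  rw [pal, pal, algebraMap_palOfDegree le_rfl, algebraMap_palOfDegree le_rfl, hdeg] at h2
  have h3 := mul_left_cancel₀ (pow_ne_zero _ RatFunc.X_ne_zero) h2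
  exact sub_eq_zero.1 (aeval_X_add_inv_eq_zero (by rw [map_sub, h3, sub_self]))

lemma PalSym.exists_palOfDegree {m : ℕ} {f : F[X]} (hf : PalSym m f) :
    ∃ H : F[X], H.natDegree ≤ m ∧ palOfDegree m H = f := by
  induction m generalizing f with
  | zero =>
    obtain ⟨c, rfl⟩ := natDegree_eq_zero.1 (Nat.le_zero.1 hf.1)
    exact ⟨C c, by simp, by simp [palOfDegree]⟩
  | succ m ih =>
    set c := f.coeff 0 with hc
    set g := f - C c * (X ^ 2 + 1) ^ (m + 1) with hg
    have hgs : PalSym (m + 1) g := by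
      have := (palSym_C c).mul (palSym_X_sq_add_one_pow (F := F) (m + 1))
      rw [zero_add] at this
      exact hf.sub this
    have hg0 : g.coeff 0 = 0 := by
      simp [hg, hc, coeff_zero_eq_eval_zero]
    obtain ⟨k, hk⟩ := X_dvd_iff.2 hg0
    have hkg : ∀ i, k.coeff i = g.coeff (i + 1) := fun i => by rw [hk, coeff_X_mul]
    have hks : PalSym m k := by
      constructor
      · rw [natDegree_le_iff_coeff_eq_zero]
        intro N hN
        rw [hkg]
        rcases (Nat.succ_le_of_lt hN).eq_or_lt with h | h
        · have : N + 1 = 2 * (m + 1) := by omega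
          rw [this, hgs.coeff_two_mul, hg0]
        · exact coeff_eq_zero_of_natDegree_lt (lt_of_le_of_lt hgs.1 (by omega))
      · ext i
        rw [coeff_reflect]
        rcases le_or_gt i (2 * m) with hi | hi
        · rw [revAt_le hi, hkg, hkg]
          conv_rhs => rw [← hgs.2]
          rw [coeff_reflect, revAt_le (by omega)]
          congr 1
          omega
        · rw [revAt_eq_self_of_lt hi]
    obtain ⟨H, hHd, hH⟩ := ih hks
    refine ⟨H + C c * X ^ (m + 1), ?_, ?_⟩
    · exact (natDegree_add_le _ _).trans (max_le (by omega) (natDegree_C_mul_X_pow_le _ _))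
    · rw [palOfDegree, Finset.sum_range_succ]
      have h1 : ∑ i ∈ Finset.range (m + 1), C ((H + C c * X ^ (m + 1)).coeff i) *
          X ^ (m + 1 - i) * (X ^ 2 + 1) ^ i = X * palOfDegree m H := by
        rw [palOfDegree, Finset.mul_sum]
        refine Finset.sum_congr rfl fun i hi => ?_
        have hi := Finset.mem_range.1 hi
        rw [coeff_add, coeff_C_mul_X_pow, if_neg (by omega), add_zero,
          show m + 1 - i = (m - i) + 1 by omega]
        ring
      rw [h1, hH, ← hk, coeff_add, coeff_C_mul_X_pow, if_pos rfl,
        coeff_eq_zero_of_natDegree_lt (Nat.lt_succ_of_le hHd), hg]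
      simp

lemma exists_pal_eq {m : ℕ} {f : F[X]} (hf : f.Monic) (hdeg : f.natDegree = 2 * m)
    (hrev : f.reverse = f) : ∃ H : F[X], H.Monic ∧ H.natDegree = m ∧ pal H = f := by
  have hsym : PalSym m f := ⟨hdeg.le, by rw [← hdeg]; exact hrev⟩
  obtain ⟨H, hd, rfl⟩ := hsym.exists_palOfDegree
  have h1 : H.coeff m = 1 := by
    rw [← coeff_zero_palOfDegree, ← hsym.coeff_two_mul, ← hdeg]
    exact hf
  have hd' : H.natDegree = m :=
    le_antisymm hd (le_natDegree_of_ne_zero (by rw [h1]; exact one_ne_zero))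
  exact ⟨H, by rw [Monic, leadingCoeff, hd', h1], hd', by rw [pal, hd']⟩

lemma coeff_zero_eq_one_of_irreducible {g : F[X]} (hi : Irreducible g)
    (hs : IsStarSymm g) (hd : 2 ≤ g.natDegree) : g.coeff 0 = 1 := by
  have h1 : g.reverse.eval 1 = g.eval 1 := by
    have : Invertible (1 : F) := invertibleOne
    have := eval₂_reverse_mul_pow (RingHom.id F) 1 g
    simpa [eval₂_id] using this
  have h2 : g.eval 1 ≠ 0 := fun h => by
    have : g.natDegree = 1 :=
      natDegree_eq_of_degree_eq_some (degree_eq_one_of_irreducible_of_root hi h)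
    omega
  rw [hs.2, eval_mul, eval_C] at h1
  exact mul_right_cancel₀ h2 (h1.trans (one_mul _).symm)

/-- A factorisation of a palindromic polynomial `pal P` into a palindromic `g` and a cofactor comes
from a factorisation of `P`. -/
lemma exists_factorization_of_dvd_pal {P g : F[X]} (hP : P.Monic) (hg : g.Monic)
    (hrev : g.reverse = g) {d : ℕ} (hd : g.natDegree = 2 * d) (hdvd : g ∣ pal P) :
    ∃ Q R : F[X], Q.Monic ∧ R.Monic ∧ P = Q * R ∧ pal Q = g := by
  obtain ⟨k, hk⟩ := hdvd
  obtain ⟨hm, hdeg⟩ := monic_pal hP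
  have hkm : k.Monic := hg.of_mul_monic_left (hk ▸ hm)
  have hkr : k.reverse = k := by
    have h1 := (isStarSymm_iff_of_coeff_zero ((coeff_zero_pal P).trans hP)).1 (isStarSymm_pal hP)
    rw [hk, reverse_mul_of_domain, hrev] at h1
    exact mul_left_cancel₀ hg.ne_zero h1
  have hkd : k.natDegree = 2 * (P.natDegree - d) := by
    rw [hk, hg.natDegree_mul hkm, hd] at hdeg
    omega
  obtain ⟨Q, hQ, -, hQg⟩ := exists_pal_eq hg hd hrev
  obtain ⟨R, hR, -, hRk⟩ := exists_pal_eq hkm hkd hkr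
  refine ⟨Q, R, hQ, hR, pal_injOn hP (hQ.mul hR) ?_, hQg⟩
  rw [pal_mul hQ.ne_zero hR.ne_zero, hQg, hRk, hk]

lemma irreducible_of_irreducible_pal {Q : F[X]} (hQ : Q.Monic) (hi : Irreducible (pal Q)) :
    Irreducible Q := by
  rw [hQ.irreducible_iff_natDegree']
  refine ⟨fun h => hi.1 (by rw [h, pal_one]; exact isUnit_one), fun f g hf hg hfg hmem => ?_⟩
  rw [Finset.mem_Ioc] at hmem
  rw [← hfg, pal_mul hf.ne_zero hg.ne_zero] at hi
  have hdeg : f.natDegree + g.natDegree = Q.natDegree := by rw [← hf.natDegree_mul hg, hfg]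
  rcases hi.2 rfl with h | h
  · have h1 := natDegree_eq_zero_of_isUnit h
    rw [(monic_pal hf).2] at h1
    omega
  · have h1 := natDegree_eq_zero_of_isUnit h
    rw [(monic_pal hg).2] at h1
    omega

end Palindromic

section StarFactors

variable {F : Type} [Field F]

open UniqueFactorizationMonoid in
open scoped Classical in
lemma starFactorCount_mul {f g : F[X]} (hf : f ≠ 0) (hg : g ≠ 0) (k : ℕ) :
    starFactorCount (f * g) k = starFactorCount f k + starFactorCount g k := by
  rw [starFactorCount, normalizedFactors_mul hf hg, Multiset.filter_add, Multiset.card_add]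
  rfl

open UniqueFactorizationMonoid in
open scoped Classical in
lemma starFactorCount_irreducible {g : F[X]} (hg : g.Monic) (hi : Irreducible g) (k : ℕ) :
    starFactorCount g k = if IsStarSymm g ∧ g.natDegree = k then 1 else 0 := by
  rw [starFactorCount, normalizedFactors_irreducible hi, hg.normalize_eq_self,
    Multiset.filter_singleton]
  simp only [hg, hi, true_and]
  split_ifs <;> rfl

open UniqueFactorizationMonoid in
open scoped Classical in
lemma exists_dvd_of_starFactorCount_ne_zero {f : F[X]} {k : ℕ} (h : starFactorCount f k ≠ 0) :
    ∃ g : F[X], g.Monic ∧ Irreducible g ∧ IsStarSymm g ∧ g.natDegree = k ∧ g ∣ f := by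
  obtain ⟨g, hg⟩ := Multiset.card_pos_iff_exists_mem.1 (Nat.pos_of_ne_zero h)
  rw [Multiset.mem_filter] at hg
  exact ⟨g, hg.2.1, hg.2.2.1, hg.2.2.2.1, hg.2.2.2.2, dvd_of_mem_normalizedFactors hg.1⟩

lemma starFactorCount_eq_zero {f : F[X]} (hf : f ≠ 0) {k : ℕ} (h : f.natDegree < k) :
    starFactorCount f k = 0 := by
  by_contra hne
  obtain ⟨g, -, -, -, hd, hdvd⟩ := exists_dvd_of_starFactorCount_ne_zero hne
  have := natDegree_le_of_dvd hdvd hf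
  omega

open scoped Classical in
/-- The irreducible factors of `pal p`, for `p` irreducible: `pal p` is counted if and only if it is
irreducible. -/
lemma starFactorCount_pal_irreducible {p : F[X]} (hp : p.Monic) (hi : Irreducible p) {d : ℕ}
    (hd : 1 ≤ d) :
    starFactorCount (pal p) (2 * d) =
      if Irreducible (pal p) ∧ p.natDegree = d then 1 else 0 := by
  obtain ⟨hm, hdeg⟩ := monic_pal hp
  by_cases hpi : Irreducible (pal p)
  · rw [starFactorCount_irreducible hm hpi]
    refine if_congr ?_ rfl rfl
    simp only [isStarSymm_pal hp, hpi, true_and, hdeg]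
    omega
  · rw [if_neg (fun h => hpi h.1)]
    by_contra hne
    obtain ⟨g, hg, hgi, hgs, hgd, hdvd⟩ := exists_dvd_of_starFactorCount_ne_zero hne
    have hg0 := coeff_zero_eq_one_of_irreducible hgi hgs (by omega)
    obtain ⟨Q, R, hQ, hR, hQR, hpQ⟩ :=
      exists_factorization_of_dvd_pal hp hg ((isStarSymm_iff_of_coeff_zero hg0).1 hgs) hgd hdvd
    have hQi : Irreducible Q := irreducible_of_irreducible_pal hQ (hpQ ▸ hgi)
    have hRu : IsUnit R := ((hi.2 hQR).resolve_left hQi.1)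
    rw [hR.eq_one_of_isUnit hRu, mul_one] at hQR
    exact hpi (by rw [hQR, hpQ]; exact hgi)

variable [Fintype F]

open scoped Classical in
/-- The monic irreducible `P` of degree `d` for which `pal P` is irreducible. -/
noncomputable def inert (F : Type) [Field F] [Fintype F] (d : ℕ) : Finset F[X] :=
  (monicFin F d).filter fun P => Irreducible P ∧ Irreducible (pal P)

open scoped Classical in
lemma mem_inert {d : ℕ} {P : F[X]} :
    P ∈ inert F d ↔ P.Monic ∧ P.natDegree = d ∧ Irreducible P ∧ Irreducible (pal P) := by
  rw [inert, Finset.mem_filter, mem_monicFin, and_assoc]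

open scoped Classical in
lemma starFactorCount_pal {d : ℕ} (hd : 1 ≤ d) {H : F[X]} (hH : H.Monic) :
    starFactorCount (pal H) (2 * d) = primeCount (inert F d) H := by
  induction hn : H.natDegree using Nat.strong_induction_on generalizing H with
  | _ n ih =>
    by_cases h1 : H = 1
    · subst h1
      rw [pal_one, starFactorCount_eq_zero one_ne_zero (by rw [natDegree_one]; omega), primeCount]
      simp
    · obtain ⟨p, hp, hi, G, rfl⟩ := exists_monic_irreducible_factor H
        (fun h => h1 (hH.eq_one_of_isUnit h))
      have hG := hp.of_mul_monic_left hH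
      have hlt : G.natDegree < n := by
        rw [hp.natDegree_mul hG] at hn
        have := hi.natDegree_pos
        omega
      rw [pal_mul hi.ne_zero hG.ne_zero, starFactorCount_mul (monic_pal hp).1.ne_zero
        (monic_pal hG).1.ne_zero, primeCount_mul _ hi.ne_zero hG.ne_zero, ih _ hlt hG rfl,
        starFactorCount_pal_irreducible hp hi hd, primeCount_irreducible _ hp hi]
      congr 1
      refine if_congr ?_ rfl rfl
      rw [mem_inert]
      tauto

end StarFactors

section InertCount

variable {F : Type} [Field F] [Fintype F]

lemma isStarSymm_of_dvd {g : F[X]} {d : ℕ} (hg : g.Monic)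
    (hdvd : g ∣ X ^ (Fintype.card F ^ d + 1) - 1) : IsStarSymm g := by
  have hroot : ∀ k, aeval (AdjoinRoot.root g ^ Fintype.card F ^ k) g = 0 := by
    intro k
    induction k with
    | zero => simp [AdjoinRoot.aeval_eq]
    | succ k ih =>
      have := aeval_algHom_apply (FiniteField.frobeniusAlgHom F (AdjoinRoot g))
        (AdjoinRoot.root g ^ Fintype.card F ^ k) g
      rw [ih, map_zero, FiniteField.coe_frobeniusAlgHom] at this
      rwa [pow_succ, pow_mul]
  have hinv : AdjoinRoot.root g * AdjoinRoot.root g ^ Fintype.card F ^ d = 1 := by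
    have := AdjoinRoot.mk_eq_zero.2 hdvd
    rw [← AdjoinRoot.aeval_eq] at this
    simpa [sub_eq_zero, pow_succ'] using this
  let hI : Invertible (AdjoinRoot.root g ^ Fintype.card F ^ d) :=
    ⟨AdjoinRoot.root g, hinv, by rw [mul_comm, hinv]⟩
  have hrev : g ∣ g.reverse := by
    rw [← AdjoinRoot.mk_eq_zero, ← AdjoinRoot.aeval_eq]
    exact (eval₂_reverse_eq_zero_iff (algebraMap F (AdjoinRoot g))
      (AdjoinRoot.root g ^ Fintype.card F ^ d) g).2 (hroot d)
  have h0 : g.coeff 0 ≠ 0 := by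
    obtain ⟨k, hk⟩ := hdvd
    have := congrArg (eval 0) hk
    rw [eval_mul, ← coeff_zero_eq_eval_zero g] at this
    intro h
    simp [h] at this
  refine ⟨h0, ?_⟩
  have := eq_leadingCoeff_mul_of_monic_of_dvd_of_natDegree_le hg hrev (reverse_natDegree_le g)
  rwa [reverse_leadingCoeff, trailingCoeff,
    natTrailingDegree_eq_zero.2 (Or.inr h0)] at this

lemma natDegree_eq_or_le_of_dvd {g : F[X]} {d : ℕ} (hd : 2 ≤ d) (hi : Irreducible g)
    (hdvd : g ∣ X ^ (Fintype.card F ^ d + 1) - 1) :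
    g.natDegree = 2 * d ∨ g.natDegree ≤ 2 * d / 3 := by
  have hdeg : g.natDegree ∣ 2 * d := by
    rw [hi.natDegree_dvd_iff_dvd_X_pow_card_pow_sub_X, Nat.card_eq_fintype_card]
    have h1 : 1 ≤ Fintype.card F ^ d := Nat.one_le_pow _ _ Fintype.card_pos
    have h2 : Fintype.card F ^ (2 * d) =
        (Fintype.card F ^ d + 1) * (Fintype.card F ^ d - 1) + 1 := by
      obtain ⟨c, hc⟩ := Nat.exists_eq_add_of_le h1
      rw [mul_comm, pow_mul, hc, Nat.add_sub_cancel_left]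
      ring
    have h3 := sub_dvd_pow_sub_pow (X ^ (Fintype.card F ^ d + 1) : F[X]) 1
      (Fintype.card F ^ d - 1)
    rw [one_pow, ← pow_mul] at h3
    have h4 : (X ^ Fintype.card F ^ (2 * d) - X : F[X]) =
        (X ^ ((Fintype.card F ^ d + 1) * (Fintype.card F ^ d - 1)) - 1) * X := by
      rw [h2]
      ring
    rw [h4]
    exact (hdvd.trans h3).mul_right X
  have hne : g.natDegree ≠ d := by
    intro h
    have h1 := (hi.natDegree_dvd_iff_dvd_X_pow_card_pow_sub_X (n := d)).1 (by rw [h])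
    rw [Nat.card_eq_fintype_card] at h1
    have h2 : g ∣ (X - C 1) * (X + C 1) := by
      have := dvd_sub (h1.mul_left X) hdvd
      rw [← dvd_neg] at this
      convert this using 1
      rw [C_1]
      ring
    rcases hi.prime.dvd_or_dvd h2 with h3 | h3
    · have := natDegree_le_of_dvd h3 (X_sub_C_ne_zero 1)
      rw [natDegree_X_sub_C] at this
      omega
    · have := natDegree_le_of_dvd h3 (X_add_C_ne_zero 1)
      rw [natDegree_X_add_C] at this
      omega
  obtain ⟨c, hc⟩ := hdeg
  rcases Nat.lt_or_ge c 3 with h | h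
  · interval_cases c <;> omega
  · right
    rw [Nat.le_div_iff_mul_le (by norm_num), hc]
    exact Nat.mul_le_mul_left _ h

lemma exists_pal_eq_of_irreducible {g : F[X]} (hg : g.Monic) (hi : Irreducible g)
    (hs : IsStarSymm g) {d : ℕ} (hd : 1 ≤ d) (hdeg : g.natDegree = 2 * d) :
    ∃ Q ∈ inert F d, pal Q = g := by
  have h0 := coeff_zero_eq_one_of_irreducible hi hs (by omega)
  obtain ⟨Q, hQ, hQd, rfl⟩ := exists_pal_eq hg hdeg ((isStarSymm_iff_of_coeff_zero h0).1 hs)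
  exact ⟨Q, mem_inert.2 ⟨hQ, hQd, irreducible_of_irreducible_pal hQ hi, hi⟩, rfl⟩

open UniqueFactorizationMonoid in
open scoped Classical in
lemma card_pow_add_one_le {d : ℕ} (hd : 2 ≤ d) :
    Fintype.card F ^ d + 1 ≤
      2 * d * (inert F d).card + ∑ k ∈ Finset.Icc 1 (2 * d / 3), Fintype.card F ^ k := by
  set T : F[X] := X ^ (Fintype.card F ^ d + 1) - 1 with hT
  have hmon : T.Monic := monic_X_pow_sub_C (1 : F) (Nat.succ_ne_zero _)
  have hdegT : T.natDegree = Fintype.card F ^ d + 1 := natDegree_X_pow_sub_C (r := (1 : F))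
  have hsep : T.Separable := by
    rw [hT, X_pow_sub_one_separable_iff]
    have : (Fintype.card F : F) = 0 := FiniteField.cast_card_eq_zero F
    simp [this, zero_pow (by omega : d ≠ 0)]
  have hnd := (squarefree_iff_nodup_normalizedFactors hmon.ne_zero).1 hsep.squarefree
  set S := (normalizedFactors T).toFinset with hS
  have hmem : ∀ g ∈ S, g.Monic ∧ Irreducible g ∧ g ∣ T := fun g hg => by
    rw [hS, Multiset.mem_toFinset] at hg
    have hi := irreducible_of_normalized_factor g hg
    refine ⟨?_, hi, dvd_of_mem_normalizedFactors hg⟩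
    rw [← normalize_normalized_factor g hg]
    exact monic_normalize hi.ne_zero
  have hsum : ∑ g ∈ S, g.natDegree = T.natDegree := by
    rw [← natDegree_prod_of_monic S (fun g => g) fun g hg => (hmem g hg).1, hS,
      Finset.prod_eq_multiset_prod, Multiset.toFinset_val, hnd.dedup, Multiset.map_id',
      natDegree_eq_of_degree_eq (degree_eq_degree_of_associated
        (prod_normalizedFactors hmon.ne_zero))]
  rw [← hdegT, ← hsum, ← Finset.sum_filter_add_sum_filter_not S (fun g => g.natDegree = 2 * d)]
  refine add_le_add ?_ ?_
  · rw [Finset.sum_congr rfl fun g hg => (Finset.mem_filter.1 hg).2, Finset.sum_const,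
      smul_eq_mul, mul_comm]
    refine Nat.mul_le_mul_left _ ((Finset.card_le_card fun g hg => ?_).trans
      (Finset.card_image_le (f := pal)))
    obtain ⟨hgS, hgd⟩ := Finset.mem_filter.1 hg
    obtain ⟨h1, h2, h3⟩ := hmem g hgS
    exact Finset.mem_image.2
      (exists_pal_eq_of_irreducible h1 h2 (isStarSymm_of_dvd h1 h3) (by omega) hgd)
  · rw [← Finset.sum_fiberwise_of_maps_to (g := natDegree) (t := Finset.Icc 1 (2 * d / 3))]
    · refine Finset.sum_le_sum fun k hk => ?_
      refine sum_natDegree_le_card_pow (by have := (Finset.mem_Icc.1 hk).1; omega) fun p hp => ?_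
      simp only [Finset.mem_filter] at hp
      exact ⟨(hmem p hp.1.1).1, (hmem p hp.1.1).2.1, dvd_of_eq hp.2⟩
    · intro g hg
      obtain ⟨hgS, hgd⟩ := Finset.mem_filter.1 hg
      obtain ⟨h1, h2, h3⟩ := hmem g hgS
      exact Finset.mem_Icc.2 ⟨h2.natDegree_pos,
        (natDegree_eq_or_le_of_dvd hd h2 h3).resolve_left hgd⟩

lemma sum_Icc_pow_le {q : ℕ} (hq : 2 ≤ q) (M : ℕ) :
    ∑ k ∈ Finset.Icc 1 M, q ^ k ≤ 2 * q ^ M := by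
  induction M with
  | zero => simp
  | succ M ih =>
    rw [Finset.sum_Icc_succ_top (by omega), pow_succ]
    nlinarith [Nat.mul_le_mul_left (q ^ M) hq]

lemma card_inert_lower_bound (d : ℕ) (hd : Even d) (hpos : 0 < d) :
    (Fintype.card F : ℝ) ^ d * (1 - 6 / d) ≤ 2 * d * (inert F d).card := by
  have hq : 2 ≤ Fintype.card F := Fintype.one_lt_card
  have hd2 : 2 ≤ d := by obtain ⟨e, rfl⟩ := hd; omega
  have h1 := (card_pow_add_one_le (F := F) hd2).trans
    (Nat.add_le_add_left (sum_Icc_pow_le hq (2 * d / 3)) _)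
  obtain ⟨j, hj⟩ := Nat.exists_eq_add_of_le (show 2 * d / 3 ≤ d by omega)
  have h2 : d ≤ 3 * Fintype.card F ^ j := by
    have := Nat.lt_two_pow_self (n := j)
    have := Nat.pow_le_pow_left hq j
    omega
  have h3 : 2 * Fintype.card F ^ (2 * d / 3) * d ≤ 6 * Fintype.card F ^ d := by
    conv_rhs => rw [hj, pow_add]
    nlinarith [Nat.mul_le_mul_left (Fintype.card F ^ (2 * d / 3)) h2]
  have h1' : (Fintype.card F : ℝ) ^ d + 1 ≤
      2 * d * (inert F d).card + 2 * Fintype.card F ^ (2 * d / 3) := mod_cast h1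
  have h3' : 2 * (Fintype.card F : ℝ) ^ (2 * d / 3) * d ≤ 6 * (Fintype.card F : ℝ) ^ d :=
    mod_cast h3
  have hd0 : (0 : ℝ) < d := mod_cast hpos
  rw [← le_div_iff₀ hd0] at h3'
  calc (Fintype.card F : ℝ) ^ d * (1 - 6 / d)
      = (Fintype.card F : ℝ) ^ d - 6 * (Fintype.card F : ℝ) ^ d / d := by ring
    _ ≤ _ := by linarith

end InertCount

section Reduction

variable {F : Type} [Field F]

lemma IsStarSymm.eval_self_inverse {f : F[X]} (hf : IsStarSymm f) {x : F} (hx : x * x = 1) :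
    f.coeff 0 * f.eval x * x ^ f.natDegree = f.eval x := by
  have : Invertible x := ⟨x, hx, hx⟩
  have h := eval₂_reverse_mul_pow (RingHom.id F) x f
  rw [invOf_eq_right_inv hx, hf.2] at h
  simpa [eval₂_id] using h

lemma IsStarSymm.eval_neg_eq_zero {f : F[X]} (hf : IsStarSymm f) (hodd : Odd f.natDegree)
    (ha : f.coeff 0 * f.coeff 0 = 1) : f.eval (-f.coeff 0) = 0 := by
  set a := f.coeff 0 with ha'
  have hpow : ∀ i j : ℕ, Odd (i + j) → (-a) ^ j = (-a) * (-a) ^ i := fun i j hij => by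
    have h2 : (-a) ^ 2 = 1 := by rw [neg_sq, sq, ha]
    rcases Nat.even_or_odd' i with ⟨k, rfl | rfl⟩ <;> rcases Nat.even_or_odd' j with ⟨l, rfl | rfl⟩
    · grind
    · simp [pow_succ, pow_mul, h2]
    · rw [pow_succ, pow_mul, pow_mul, h2, one_pow, one_pow, one_mul, ← sq, h2]
    · grind
  rw [eval_eq_sum_range]
  refine Finset.sum_involution (fun i _ => f.natDegree - i) ?_ ?_ ?_ ?_
  · intro i hi
    have hi : i ≤ f.natDegree := Nat.lt_succ_iff.1 (Finset.mem_range.1 hi)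
    have hc : f.coeff (f.natDegree - i) = a * f.coeff i := by
      rw [← revAt_le hi, ← coeff_reverse, hf.2, coeff_C_mul]
    rw [hc, hpow i (f.natDegree - i) (by rwa [Nat.add_sub_cancel' hi])]
    linear_combination -(f.coeff i * (-a) ^ i) * ha
  · intro i hi _ h
    have hi : i ≤ f.natDegree := Nat.lt_succ_iff.1 (Finset.mem_range.1 hi)
    obtain ⟨k, hk⟩ := hodd
    omega
  · intro i _
    exact Finset.mem_range.2 (by omega)
  · intro i hi
    have hi := Finset.mem_range.1 hi
    omega

lemma isStarSymm_X_add_C {a : F} (ha : a * a = 1) : IsStarSymm (X + C a) := by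
  have h0 : a ≠ 0 := by rintro rfl; simp at ha
  refine ⟨by simpa using h0, ?_⟩
  have hX : (X : F[X]).reverse = 1 := by
    rw [← one_mul X, reverse_mul_X, ← C_1, reverse_C]
  rw [reverse_add_C, hX]
  simp only [natDegree_X, pow_one, coeff_add, coeff_X_zero, coeff_C_zero, zero_add]
  rw [mul_add, ← C_mul, ha, C_1, add_comm]

lemma isStarSymm_one : IsStarSymm (1 : F[X]) :=
  (isStarSymm_iff_of_coeff_zero coeff_one_zero).2 (by rw [← C_1, reverse_C])

lemma IsStarSymm.mul {f g : F[X]} (hf : IsStarSymm f) (hg : IsStarSymm g) :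
    IsStarSymm (f * g) := by
  refine ⟨by rw [mul_coeff_zero]; exact mul_ne_zero hf.1 hg.1, ?_⟩
  rw [reverse_mul_of_domain, hf.2, hg.2, mul_coeff_zero, C_mul]
  ring

/-- The *-symmetric polynomials of degree `n` with constant coefficient `a` have a common
*-symmetric factor with constant coefficient `a`, with a cofactor of even degree. -/
lemma exists_common_factor {n : ℕ} (hn : 2 ≤ n) {a : F} (ha : a = 1 ∨ a = -1) :
    ∃ (e : F[X]) (m : ℕ), e.Monic ∧ e.natDegree ≤ 2 ∧ n = 2 * m + e.natDegree ∧
      e.coeff 0 = a ∧ IsStarSymm e ∧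
      ∀ f : F[X], IsStarSymm f → f.natDegree = n → f.coeff 0 = a → e ∣ f := by
  have haa : a * a = 1 := by rcases ha with rfl | rfl <;> ring
  rcases Nat.even_or_odd' n with ⟨m, rfl | rfl⟩
  · by_cases h1 : a = 1
    · subst h1
      exact ⟨1, m, monic_one, by simp, by simp, by simp, isStarSymm_one,
        fun f _ _ _ => one_dvd f⟩
    · have h2 : a = -1 := ha.resolve_left h1
      have hm : ((X + C 1) * (X + C (-1)) : F[X]).Monic := (monic_X_add_C 1).mul (monic_X_add_C _)
      have hd : ((X + C 1) * (X + C (-1)) : F[X]).natDegree = 2 := by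
        rw [(monic_X_add_C _).natDegree_mul (monic_X_add_C _), natDegree_X_add_C,
          natDegree_X_add_C]
      refine ⟨(X + C 1) * (X + C (-1)), m - 1, hm, hd.le, by omega, by simp [h2],
        (isStarSymm_X_add_C (by ring)).mul (isStarSymm_X_add_C (by ring)), fun f hf hfd hfa => ?_⟩
      have hroot : ∀ x : F, x * x = 1 → X - C x ∣ f := fun x hx => by
        have := hf.eval_self_inverse hx
        rw [hfd, pow_mul, sq, hx, one_pow, mul_one, hfa] at this
        refine dvd_iff_isRoot.2 ((mul_eq_zero.1 (?_ : (a - 1) * f.eval x = 0)).resolve_left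
          (sub_ne_zero.2 h1))
        linear_combination this
      refine IsCoprime.mul_dvd ?_ ?_ ?_
      · rw [← sub_neg_eq_add, ← C_neg, ← sub_neg_eq_add X, ← C_neg]
        refine isCoprime_X_sub_C_of_isUnit_sub (IsUnit.mk0 _ (sub_ne_zero.2 ?_))
        rw [neg_neg, ← h2]
        exact h1
      · simpa using hroot (-1) (by ring)
      · simpa [sub_eq_add_neg] using hroot 1 (by ring)
  · refine ⟨X + C a, m, monic_X_add_C a, by simp, by simp, by simp, isStarSymm_X_add_C haa,
      fun f hf hfd hfa => ?_⟩
    have := hf.eval_neg_eq_zero ⟨m, hfd⟩ (by rw [hfa, haa])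
    rw [hfa] at this
    simpa using dvd_iff_isRoot.2 this

lemma exists_eq_mul_pal {e f : F[X]} (he : e.Monic) (hes : IsStarSymm e) (hf : f.Monic)
    (hfs : IsStarSymm f) (h0 : f.coeff 0 = e.coeff 0) {m : ℕ}
    (hdeg : f.natDegree = 2 * m + e.natDegree) (hdvd : e ∣ f) :
    ∃ H : F[X], H.Monic ∧ H.natDegree = m ∧ e * pal H = f := by
  obtain ⟨h, rfl⟩ := hdvd
  have hm : h.Monic := he.of_mul_monic_left hf
  have hd : h.natDegree = 2 * m := by rw [he.natDegree_mul hm] at hdeg; omega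
  have hrev : h.reverse = h := by
    have h1 := hfs.2
    rw [h0, reverse_mul_of_domain, hes.2, mul_assoc] at h1
    exact mul_left_cancel₀ he.ne_zero (mul_left_cancel₀ (C_ne_zero.2 hes.1) h1)
  obtain ⟨H, hH, hHd, rfl⟩ := exists_pal_eq hm hd hrev
  exact ⟨H, hH, hHd, rfl⟩

lemma mul_pal_mem {e H : F[X]} (he : e.Monic) (hes : IsStarSymm e) (hH : H.Monic) :
    (e * pal H).Monic ∧ IsStarSymm (e * pal H) ∧
      (e * pal H).natDegree = 2 * H.natDegree + e.natDegree ∧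
      (e * pal H).coeff 0 = e.coeff 0 := by
  obtain ⟨hm, hd⟩ := monic_pal hH
  refine ⟨he.mul hm, hes.mul (isStarSymm_pal hH), ?_, ?_⟩
  · rw [he.natDegree_mul hm, hd, add_comm]
  · rw [mul_coeff_zero, coeff_zero_pal, hH, mul_one]

end Reduction

section Conclusion

variable {F : Type} [Field F] [Fintype F]

lemma card_pow_le_ncard {e : F[X]} (he : e.Monic) (hes : IsStarSymm e) (m : ℕ) :
    Fintype.card F ^ m ≤ {f : F[X] | f.Monic ∧ IsStarSymm f ∧
      f.natDegree = 2 * m + e.natDegree ∧ f.coeff 0 = e.coeff 0}.ncard := by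
  have hinj : Set.InjOn (fun H => e * pal H) (monicFin F m : Set F[X]) := fun G hG H hH h =>
    pal_injOn (mem_monicFin.1 hG).1 (mem_monicFin.1 hH).1 (mul_left_cancel₀ he.ne_zero h)
  rw [← card_monicFin, ← Set.ncard_coe_finset, ← hinj.ncard_image]
  refine Set.ncard_le_ncard ?_ ((finite_monic_natDegree_eq F (2 * m + e.natDegree)).subset
    fun f hf => ⟨hf.1, hf.2.2.1⟩)
  rintro _ ⟨H, hH, rfl⟩
  obtain ⟨hm, rfl⟩ := mem_monicFin.1 hH
  exact mul_pal_mem he hes hm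

open scoped Classical in
lemma ncard_even_le {e : F[X]} (he : e.Monic) (hes : IsStarSymm e) (hd : e.natDegree ≤ 2)
    {m n : ℕ} (hn : n = 2 * m + e.natDegree)
    (hdvd : ∀ f : F[X], IsStarSymm f → f.natDegree = n → f.coeff 0 = e.coeff 0 → e ∣ f) :
    ({f : F[X] | f.Monic ∧ IsStarSymm f ∧ f.natDegree = n ∧ f.coeff 0 = e.coeff 0 ∧
      ∀ k : ℕ, 1 ≤ k → 2 * k ≤ n → 4 ∣ k → Even (starFactorCount f k)}.ncard : ℝ) ≤
      ∑ H ∈ monicFin F m, signProj (inert F) (fun _ => 1) (evenUpTo m) H := by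
  set good := (monicFin F m).filter
    fun H => ∀ d ∈ evenUpTo m, Even (primeCount (inert F d) H) with hgood
  have hsub : {f : F[X] | f.Monic ∧ IsStarSymm f ∧ f.natDegree = n ∧ f.coeff 0 = e.coeff 0 ∧
      ∀ k : ℕ, 1 ≤ k → 2 * k ≤ n → 4 ∣ k → Even (starFactorCount f k)} ⊆
      (good.image fun H => e * pal H : Finset F[X]) := by
    rintro f ⟨hf, hfs, hfd, hf0, hev⟩
    obtain ⟨H, hH, hHd, rfl⟩ :=
      exists_eq_mul_pal he hes hf hfs hf0 (hfd.trans hn) (hdvd f hfs hfd hf0)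
    refine Finset.mem_coe.2 (Finset.mem_image_of_mem _ (Finset.mem_filter.2
      ⟨mem_monicFin.2 ⟨hH, hHd⟩, fun d hd => ?_⟩))
    obtain ⟨j, hj, rfl⟩ := Finset.mem_image.1 hd
    obtain ⟨hj1, hj2⟩ := Finset.mem_Icc.1 hj
    have h := hev (2 * (2 * j)) (by omega) (by omega) ⟨j, by ring⟩
    rwa [starFactorCount_mul he.ne_zero (monic_pal hH).1.ne_zero,
      starFactorCount_eq_zero he.ne_zero (by omega), zero_add,
      starFactorCount_pal (by omega) hH] at h
  calc _ ≤ (good.card : ℝ) := by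
        have := (Set.ncard_le_ncard hsub (Finset.finite_toSet _)).trans_eq
          (Set.ncard_coe_finset _)
        exact mod_cast this.trans Finset.card_image_le
    _ = ∑ H ∈ good, signProj (inert F) (fun _ => 1) (evenUpTo m) H := by
        rw [Finset.card_eq_sum_ones, Nat.cast_sum]
        refine Finset.sum_congr rfl fun H hH => ?_
        rw [signProj, Finset.prod_eq_one fun d hd => ?_, Nat.cast_one]
        rw [primeSign, ((Finset.mem_filter.1 hH).2 d hd).neg_one_pow]
        norm_num
    _ ≤ _ := Finset.sum_le_sum_of_subset_of_nonneg (Finset.filter_subset _ _)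
        fun H _ _ => signProj_nonneg (fun _ => Or.inl rfl) _ _

lemma rpow_mul_log_bound {m n : ℕ} (hm : 1 ≤ m) (hn2 : 2 ≤ n) (hmn : m ≤ n)
    (hn : n ≤ 4 * m) :
    ((m : ℝ) / 4) ^ (-(1 / 4) : ℝ) * (2 + Real.log m) ≤
      8 * ((n : ℝ) ^ (-(1 / 4) : ℝ) * Real.log n) := by
  have hn0 : (0 : ℝ) < n := by positivity
  have hm0 : (0 : ℝ) < m := by positivity
  have hmn' : (m : ℝ) ≤ n := mod_cast hmn
  have hn' : (n : ℝ) ≤ 4 * m := mod_cast hn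
  have h1 : ((m : ℝ) / 4) ^ (-(1 / 4) : ℝ) ≤ 2 * (n : ℝ) ^ (-(1 / 4) : ℝ) := by
    calc ((m : ℝ) / 4) ^ (-(1 / 4) : ℝ) ≤ ((n : ℝ) / 16) ^ (-(1 / 4) : ℝ) :=
          Real.rpow_le_rpow_of_nonpos (by positivity) (by linarith) (by norm_num)
      _ = 2 * (n : ℝ) ^ (-(1 / 4) : ℝ) := by
          rw [Real.div_rpow hn0.le (by norm_num), show (16 : ℝ) = 2 ^ (4 : ℝ) by norm_num,
            ← Real.rpow_mul (by norm_num)]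
          norm_num [Real.rpow_neg_one]
          ring
  have h2 : 2 + Real.log m ≤ 4 * Real.log n := by
    have := Real.log_le_log hm0 hmn'
    have := Real.log_le_log (by norm_num) (show (2 : ℝ) ≤ n from mod_cast hn2)
    have := Real.log_two_gt_d9
    linarith
  have h3 : 0 ≤ 2 + Real.log m := by
    have := Real.log_nonneg (show (1 : ℝ) ≤ m from mod_cast hm)
    linarith
  calc _ ≤ (2 * (n : ℝ) ^ (-(1 / 4) : ℝ)) * (4 * Real.log n) :=
        mul_le_mul h1 h2 h3 (by positivity)
    _ = _ := by ring

lemma one_le_mul_rpow_mul_log_two :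
    1 ≤ 16 * Real.exp 4 * (2 : ℝ) ^ (-(1 / 4) : ℝ) * Real.log 2 := by
  have h1 : (1 : ℝ) ≤ Real.exp 4 := Real.one_le_exp (by norm_num)
  have h2 : (1 / 2 : ℝ) ≤ (2 : ℝ) ^ (-(1 / 4) : ℝ) := by
    calc (1 / 2 : ℝ) = (2 : ℝ) ^ (-1 : ℝ) := by rw [Real.rpow_neg_one]; norm_num
      _ ≤ _ := Real.rpow_le_rpow_of_exponent_le (by norm_num) (by norm_num)
  have h3 : (1 / 2 : ℝ) ≤ Real.log 2 := by have := Real.log_two_gt_d9; linarith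
  calc (1 : ℝ) ≤ 16 * 1 * (1 / 2) * (1 / 2) := by norm_num
    _ ≤ _ := by gcongr

end Conclusion

/-- **Counting *-symmetric polynomials all of whose counts of *-symmetric irreducible factors
in degrees divisible by 4 are even.**
Let `N` be the number of *-symmetric monic polynomials of degree `n` over a finite field with
`q` elements with constant coefficient `a = ±1`. Then the number of such polynomials `f` such
that, for every `k ∈ [1, n/2]` divisible by `4`, `f` has an even number of *-symmetric monic
irreducible factors of degree `k` (with multiplicity), is `≤ C N n^{-1/4} log n`. -/
theorem stmt14 : ∃ C : ℝ, 0 < C ∧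
    ∀ (F : Type) [Field F] [Fintype F], ∀ (q n : ℕ) (a : F),
      Fintype.card F = q → 2 ≤ n → (a = 1 ∨ a = -1) →
      ({f : F[X] | f.Monic ∧ IsStarSymm f ∧ f.natDegree = n ∧ f.coeff 0 = a ∧
          ∀ k : ℕ, 1 ≤ k → 2 * k ≤ n → 4 ∣ k → Even (starFactorCount f k)}.ncard : ℝ) ≤
        C * ({f : F[X] | f.Monic ∧ IsStarSymm f ∧ f.natDegree = n ∧
              f.coeff 0 = a}.ncard : ℝ) * (n : ℝ) ^ (-(1 / 4) : ℝ) * Real.log n := by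
 
  refine ⟨16 * Real.exp 4, by positivity, fun F _ _ q n a _ hn ha => ?_⟩
  obtain ⟨e, m, he, hed, hnm, rfl, hes, hdvd⟩ := exists_common_factor hn ha
  set N : ℕ := {f : F[X] | f.Monic ∧ IsStarSymm f ∧ f.natDegree = n ∧
    f.coeff 0 = e.coeff 0}.ncard with hN
  rcases Nat.eq_zero_or_pos m with rfl | hm
  · obtain rfl : n = 2 := by omega
    have hle : _ ≤ N := Set.ncard_le_ncard
      (fun f (hf : f ∈ {f : F[X] | f.Monic ∧ IsStarSymm f ∧ f.natDegree = 2 ∧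
        f.coeff 0 = e.coeff 0 ∧
        ∀ k : ℕ, 1 ≤ k → 2 * k ≤ 2 → 4 ∣ k → Even (starFactorCount f k)}) =>
        ⟨hf.1, hf.2.1, hf.2.2.1, hf.2.2.2.1⟩)
      ((finite_monic_natDegree_eq F 2).subset fun f hf => ⟨hf.1, hf.2.2.1⟩)
    refine (Nat.cast_le.2 hle).trans ?_
    have := mul_le_mul_of_nonneg_left one_le_mul_rpow_mul_log_two (Nat.cast_nonneg (α := ℝ) N)
    push_cast
    linarith
  · have hqN : (Fintype.card F : ℝ) ^ m ≤ N := by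
      have := card_pow_le_ncard he hes m
      rw [← hnm] at this
      exact mod_cast this
    calc _ ≤ ∑ H ∈ monicFin F m, signProj (inert F) (fun _ => 1) (evenUpTo m) H :=
          ncard_even_le he hes hed hnm hdvd
      _ ≤ 2 * Real.exp 4 * (Fintype.card F : ℝ) ^ m * ((m : ℝ) / 4) ^ (-(1 / 4) : ℝ) *
            (2 + Real.log m) :=
          sum_signProj_evenUpTo_le
            (fun d p hp => ⟨(mem_inert.1 hp).1, (mem_inert.1 hp).2.2.1, (mem_inert.1 hp).2.1⟩)
            card_inert_lower_bound hm
      _ = 2 * Real.exp 4 * (Fintype.card F : ℝ) ^ m *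
            (((m : ℝ) / 4) ^ (-(1 / 4) : ℝ) * (2 + Real.log m)) := by ring
      _ ≤ 2 * Real.exp 4 * N * (8 * ((n : ℝ) ^ (-(1 / 4) : ℝ) * Real.log n)) := by
          refine mul_le_mul (by gcongr) ?_ ?_ (by positivity)
          · exact rpow_mul_log_bound hm hn (by omega) (by omega)
          · have := Real.log_natCast_nonneg m
            positivity
      _ = _ := by ring
end

section
/- Let F be a finite field with q elements. For a nonzero polynomial f over F let Ω(f) be the number of monic irreducible factors of f counted with multiplicity, and let λ(f) = (−1)^{Ω(f)}. For n ≥ 0 let Q(n) be the set of *-symmetric monic polynomials f of degree n over F with constant coefficient 1 such that f(1) ≠ 0 and f(−1) ≠ 0, and let P*(n) be the set of all *-symmetric monic polynomials of degree n over F. Then ∑_{f ∈ Q(n)} λ(f) equals 1 if n = 0, equals −1 if n = 2, and equals 0 for all other n. Moreover, ∑_{f ∈ P*(n)} λ(f) equals 1 if n = 0; equals −1 if n = 1 and q is even; equals 0 if n > 1 and q is even; and equals 2·(−1)^n if n ≥ 1 and q is odd. -/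
open Polynomial

open scoped Classical in
/-- `Ω(f)`: the number of monic irreducible factors of `f`, counted with multiplicity. -/
noncomputable def bigOmega {F : Type} [Field F] (f : F[X]) : ℕ :=
  Multiset.card (UniqueFactorizationMonoid.normalizedFactors f)

open scoped Classical in
/-- The Liouville function `λ(f) = (-1)^{Ω(f)}` for polynomials. -/
noncomputable def liouville {F : Type} [Field F] (f : F[X]) : ℤ :=
  (-1) ^ bigOmega f

/-- `Q(n)`: the set of *-symmetric monic polynomials of degree `n` with constant coefficient
`1` not vanishing at `1` or `-1`. -/
def Qset (F : Type) [Field F] (n : ℕ) : Set F[X] :=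
  {f | f.Monic ∧ IsStarSymm f ∧ f.natDegree = n ∧ f.coeff 0 = 1 ∧
    f.eval 1 ≠ 0 ∧ f.eval (-1) ≠ 0}

/-- `P*(n)`: the set of all *-symmetric monic polynomials of degree `n`. -/
def PstarSet (F : Type) [Field F] (n : ℕ) : Set F[X] :=
  {f | f.Monic ∧ IsStarSymm f ∧ f.natDegree = n}

section Finiteness

variable {F : Type} [Field F] [Finite F]

theorem finite_setOf_natDegree_le (n : ℕ) : {f : F[X] | f.natDegree ≤ n}.Finite := by
  have : Finite (degreeLT F (n + 1)) := Module.finite_of_finite F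
  refine (Set.toFinite (degreeLT F (n + 1) : Set F[X])).subset fun f hf => ?_
  rw [SetLike.mem_coe, mem_degreeLT]
  exact (natDegree_le_iff_degree_le.mp hf).trans_lt (by exact_mod_cast Nat.lt_succ_self n)

theorem finite_setOf_dvd {k : F[X]} (hk : k ≠ 0) : {d : F[X] | d ∣ k}.Finite :=
  (finite_setOf_natDegree_le k.natDegree).subset fun _ hd => natDegree_le_of_dvd hd hk

end Finiteness

section GeneratingFunction

variable {F : Type} [Field F]

/-- The generating function `∑ₙ (∑_{f ∈ K, δ(f) = n} w(f)) Xⁿ` of a weight `w` on a set `K` of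
polynomials graded by `δ`. -/
noncomputable def genFun (δ : F[X] → ℕ) (K : Set F[X]) (w : F[X] → ℤ) : PowerSeries ℤ :=
  PowerSeries.mk fun n => ∑ᶠ f ∈ {f | f ∈ K ∧ δ f = n}, w f

theorem coeff_genFun (δ : F[X] → ℕ) (K : Set F[X]) (w : F[X] → ℤ) (n : ℕ) :
    PowerSeries.coeff n (genFun δ K w) = ∑ᶠ f ∈ {f | f ∈ K ∧ δ f = n}, w f :=
  PowerSeries.coeff_mk _ _

theorem genFun_congr {δ : F[X] → ℕ} {K : Set F[X]} {w w' : F[X] → ℤ}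
    (h : ∀ f ∈ K, w f = w' f) : genFun δ K w = genFun δ K w' := by
  ext n
  rw [coeff_genFun, coeff_genFun]
  exact finsum_mem_congr rfl fun f hf => h f hf.1

/-- Sieving out the multiples of `M` from a set graded by `δ`. -/
theorem genFun_inter {δ : F[X] → ℕ} {K : Set F[X]} {w : F[X] → ℤ}
    (hfin : ∀ n, {f | f ∈ K ∧ δ f = n}.Finite) {T : Set F[X]} {M : F[X]} (hM : M ≠ 0) {c : ℤ}
    (hMK : ∀ g ∈ K, M * g ∈ K ∧ M * g ∉ T) (hdvd : ∀ f ∈ K, f ∉ T → ∃ g ∈ K, f = M * g)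
    (hδ : ∀ g ∈ K, δ (M * g) = δ g + 1) (hw : ∀ g ∈ K, w (M * g) = c * w g) :
    genFun δ (K ∩ T) w = (1 - PowerSeries.C c * PowerSeries.X) * genFun δ K w := by
  have hsplit (n : ℕ) : ∑ᶠ f ∈ {f | f ∈ K ∩ T ∧ δ f = n}, w f
      + ∑ᶠ f ∈ {f | (f ∈ K ∧ f ∉ T) ∧ δ f = n}, w f = ∑ᶠ f ∈ {f | f ∈ K ∧ δ f = n}, w f := by
    rw [← finsum_mem_inter_add_sdiff T (hfin n)]
    congr 1 <;> exact finsum_mem_congr (Set.ext fun f => and_right_comm) fun _ _ => rfl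
  have hzero : {f | (f ∈ K ∧ f ∉ T) ∧ δ f = 0} = ∅ := by
    ext f
    simp only [Set.mem_ofPred_eq, Set.mem_empty_iff_false, iff_false]
    rintro ⟨⟨hf, hT⟩, h0⟩
    obtain ⟨g, hg, rfl⟩ := hdvd f hf hT
    rw [hδ g hg] at h0
    omega
  have hsucc (n : ℕ) : {f | (f ∈ K ∧ f ∉ T) ∧ δ f = n + 1}
      = (M * ·) '' {f | f ∈ K ∧ δ f = n} := by
    ext f
    constructor
    · rintro ⟨⟨hf, hT⟩, h0⟩
      obtain ⟨g, hg, rfl⟩ := hdvd f hf hT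
      rw [hδ g hg] at h0
      exact ⟨g, ⟨hg, by omega⟩, rfl⟩
    · rintro ⟨g, ⟨hg, rfl⟩, rfl⟩
      exact ⟨hMK g hg, hδ g hg⟩
  ext n
  rw [sub_mul, one_mul, mul_assoc, map_sub, PowerSeries.coeff_C_mul, coeff_genFun, coeff_genFun,
    ← hsplit n]
  cases n with
  | zero => simp [hzero]
  | succ n =>
    rw [PowerSeries.coeff_succ_X_mul, coeff_genFun, hsucc,
      finsum_mem_image (mul_right_injective₀ hM).injOn, mul_finsum_mem,
      finsum_mem_congr rfl fun g hg => hw g hg.1]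
    ring

end GeneratingFunction

section Liouville

variable {F : Type} [Field F]

theorem liouville_mul {f g : F[X]} (hf : f ≠ 0) (hg : g ≠ 0) :
    liouville (f * g) = liouville f * liouville g := by
  classical
  unfold liouville bigOmega
  rw [UniqueFactorizationMonoid.normalizedFactors_mul hf hg, Multiset.card_add, pow_add]

theorem liouville_one : liouville (1 : F[X]) = 1 := by
  classical
  unfold liouville bigOmega
  simp

theorem liouville_irreducible {p : F[X]} (hp : Irreducible p) : liouville p = -1 := by
  classical
  unfold liouville bigOmega
  simp [UniqueFactorizationMonoid.normalizedFactors_irreducible hp]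

end Liouville

section Reciprocal

variable {F : Type} [Field F]

/-- The reciprocal polynomial `f*(X) = Xⁿ f(1/X) / f(0)` of `f`. -/
noncomputable def recip (f : F[X]) : F[X] :=
  C (f.coeff 0)⁻¹ * f.reverse

theorem recip_mul (f g : F[X]) : recip (f * g) = recip f * recip g := by
  rw [recip, recip, recip, reverse_mul_of_domain, mul_coeff_zero, mul_inv, C_mul]
  ring

theorem natDegree_reverse_of_coeff_zero_ne_zero {f : F[X]} (h : f.coeff 0 ≠ 0) :
    f.reverse.natDegree = f.natDegree := by
  rw [reverse_natDegree, natTrailingDegree_eq_zero.mpr (Or.inr h), Nat.sub_zero]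

theorem natDegree_recip {f : F[X]} (h : f.coeff 0 ≠ 0) : (recip f).natDegree = f.natDegree := by
  rw [recip, natDegree_C_mul (inv_ne_zero h), natDegree_reverse_of_coeff_zero_ne_zero h]

theorem reverse_reverse_of_coeff_zero_ne_zero {f : F[X]} (h : f.coeff 0 ≠ 0) :
    f.reverse.reverse = f := by
  conv_lhs => rw [reverse, natDegree_reverse_of_coeff_zero_ne_zero h, reverse, reflect_reflect]

theorem reverse_C_mul (c : F) (f : F[X]) : (C c * f).reverse = C c * f.reverse := by
  rw [reverse_mul_of_domain, reverse_C]

theorem monic_recip {f : F[X]} (h : f.coeff 0 ≠ 0) : (recip f).Monic := by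
  have : f.trailingCoeff = f.coeff 0 := by
    rw [trailingCoeff, natTrailingDegree_eq_zero.mpr (Or.inr h)]
  rw [Monic, recip, leadingCoeff_mul, leadingCoeff_C, reverse_leadingCoeff, this,
    inv_mul_cancel₀ h]

theorem coeff_zero_recip {f : F[X]} (hf : f.Monic) : (recip f).coeff 0 = (f.coeff 0)⁻¹ := by
  rw [recip, coeff_C_mul, coeff_zero_reverse, hf.leadingCoeff, mul_one]

theorem recip_recip {f : F[X]} (hf : f.Monic) (h : f.coeff 0 ≠ 0) : recip (recip f) = f := by
  rw [recip, coeff_zero_recip hf, inv_inv, recip, reverse_C_mul,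
    reverse_reverse_of_coeff_zero_ne_zero h, ← mul_assoc, ← C_mul, mul_inv_cancel₀ h, C_1, one_mul]

theorem reverse_eq_C_mul_recip {f : F[X]} (h : f.coeff 0 ≠ 0) :
    f.reverse = C (f.coeff 0) * recip f := by
  rw [recip, ← mul_assoc, ← C_mul, mul_inv_cancel₀ h, C_1, one_mul]

theorem irreducible_recip {p : F[X]} (hp : Irreducible p) (hm : p.Monic) (h : p.coeff 0 ≠ 0) :
    Irreducible (recip p) := by
  have h' : (recip p).coeff 0 ≠ 0 := by rw [coeff_zero_recip hm]; exact inv_ne_zero h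
  rw [(monic_recip h).irreducible_iff_natDegree]
  refine ⟨fun h1 => ?_, fun f g hf hg hfg => ?_⟩
  · have := hp.natDegree_pos
    rw [← natDegree_recip h, h1, natDegree_one] at this
    exact this.false
  · have hfg0 := h'
    rw [← hfg, mul_coeff_zero] at hfg0
    have hf0 := left_ne_zero_of_mul hfg0
    have hg0 := right_ne_zero_of_mul hfg0
    have := (hm.irreducible_iff_natDegree.mp hp).2 (recip f) (recip g) (monic_recip hf0)
      (monic_recip hg0) (by rw [← recip_mul, hfg, recip_recip hm h])
    rwa [natDegree_recip hf0, natDegree_recip hg0] at this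

theorem eval_reverse {a : F} (ha : a * a = 1) (f : F[X]) :
    f.reverse.eval a * a ^ f.natDegree = f.eval a := by
  let _ : Invertible a := ⟨a, ha, ha⟩
  exact eval₂_reverse_mul_pow (RingHom.id F) a f

theorem eval_reverse_eq_zero_iff {a : F} (ha : a * a = 1) (f : F[X]) :
    f.reverse.eval a = 0 ↔ f.eval a = 0 := by
  have h0 : a ≠ 0 := left_ne_zero_of_mul (ha ▸ one_ne_zero)
  rw [← eval_reverse ha f, mul_eq_zero, or_iff_left (pow_ne_zero _ h0)]

/-- A polynomial of odd degree that is (skew-)palindromic with sign `-a` vanishes at `a = ±1`. -/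
theorem eval_eq_zero_of_reverse_eq {a : F} (ha : a * a = 1) {f : F[X]} (hodd : Odd f.natDegree)
    (h : f.reverse = C (-a) * f) : f.eval a = 0 := by
  have hc (i : ℕ) (hi : i ≤ f.natDegree) : f.coeff (f.natDegree - i) = -a * f.coeff i := by
    rw [← revAt_le hi, ← coeff_reverse, h, coeff_C_mul]
  have hpow (i : ℕ) (hi : i ≤ f.natDegree) : a * a ^ (f.natDegree - i) = a ^ i := by
    obtain ⟨t, ht⟩ := hodd
    have hsq (j : ℕ) : a ^ (2 * j) = 1 := by rw [pow_mul, pow_two, ha, one_pow]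
    have h0 : a ^ i ≠ 0 := pow_ne_zero _ (left_ne_zero_of_mul (ha ▸ one_ne_zero))
    apply mul_left_cancel₀ h0
    rw [← pow_succ', ← pow_add, ← pow_add, show i + (f.natDegree - i + 1) = 2 * (t + 1) by omega,
      ← two_mul, hsq, hsq]
  rw [eval_eq_sum_range]
  refine Finset.sum_involution (fun i _ => f.natDegree - i) ?_ ?_ ?_ ?_
  · intro i hi
    rw [Finset.mem_range_succ_iff] at hi
    rw [hc i hi, ← hpow i hi]
    ring
  · intro i hi _ heq
    rw [Finset.mem_range_succ_iff] at hi
    obtain ⟨t, ht⟩ := hodd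
    omega
  · intro i _
    rw [Finset.mem_range_succ_iff]
    omega
  · intro i hi
    rw [Finset.mem_range_succ_iff] at hi
    omega

theorem reverse_X_sub_C {a : F} (ha : a * a = 1) : (X - C a).reverse = C (-a) * (X - C a) := by
  rw [sub_eq_add_neg, ← C_neg, reverse_add_C, ← one_mul X, reverse_mul_X, ← C_1, reverse_C,
    natDegree_C_mul_X _ one_ne_zero, mul_add, ← C_mul, neg_mul_neg, ha, C_1]
  simp
  ring

end Reciprocal

section SelfReciprocal

variable {F : Type} [Field F]

/-- The monic polynomials with constant coefficient `1` that are palindromic and do not vanish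
at `±1`. -/
def palindromicCore (F : Type) [Field F] : Set F[X] :=
  {f | f.Monic ∧ f.reverse = f ∧ f.eval 1 ≠ 0 ∧ f.eval (-1) ≠ 0}

theorem coeff_zero_of_mem_palindromicCore {f : F[X]} (hf : f ∈ palindromicCore F) :
    f.coeff 0 = 1 := by
  rw [← hf.2.1, coeff_zero_reverse, hf.1.leadingCoeff]

theorem recip_of_mem_palindromicCore {f : F[X]} (hf : f ∈ palindromicCore F) : recip f = f := by
  rw [recip, coeff_zero_of_mem_palindromicCore hf, inv_one, C_1, one_mul, hf.2.1]

theorem even_natDegree_of_mem_palindromicCore {f : F[X]} (hf : f ∈ palindromicCore F) :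
    Even f.natDegree := by
  by_contra h
  rw [Nat.not_even_iff_odd] at h
  exact hf.2.2.2 (eval_eq_zero_of_reverse_eq (by ring) h (by rw [neg_neg, C_1, one_mul, hf.2.1]))

theorem one_mem_palindromicCore : (1 : F[X]) ∈ palindromicCore F := by
  refine ⟨monic_one, ?_, by simp, by simp⟩
  rw [← C_1, reverse_C]

theorem mul_mem_palindromicCore {f g : F[X]} (hf : f ∈ palindromicCore F)
    (hg : g ∈ palindromicCore F) : f * g ∈ palindromicCore F := by
  refine ⟨hf.1.mul hg.1, by rw [reverse_mul_of_domain, hf.2.1, hg.2.1], ?_, ?_⟩ <;>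
    rw [eval_mul]
  · exact mul_ne_zero hf.2.2.1 hg.2.2.1
  · exact mul_ne_zero hf.2.2.2 hg.2.2.2

theorem mem_palindromicCore_of_mul {f g : F[X]} (hf : f ∈ palindromicCore F)
    (hfg : f * g ∈ palindromicCore F) : g ∈ palindromicCore F := by
  obtain ⟨hm, hr, h1, h2⟩ := hfg
  rw [reverse_mul_of_domain, hf.2.1] at hr
  rw [eval_mul] at h1 h2
  exact ⟨hf.1.of_mul_monic_left hm, mul_left_cancel₀ hf.1.ne_zero hr,
    right_ne_zero_of_mul h1, right_ne_zero_of_mul h2⟩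

theorem eval_recip_eq_zero_iff {a : F} (ha : a * a = 1) {f : F[X]} (h : f.coeff 0 ≠ 0) :
    (recip f).eval a = 0 ↔ f.eval a = 0 := by
  rw [recip, eval_C_mul, mul_eq_zero, or_iff_right (inv_ne_zero h), eval_reverse_eq_zero_iff ha]

theorem mul_recip_mem_palindromicCore {h : F[X]} (hm : h.Monic) (h0 : h.coeff 0 ≠ 0)
    (h1 : h.eval 1 ≠ 0) (h2 : h.eval (-1) ≠ 0) : h * recip h ∈ palindromicCore F := by
  refine ⟨hm.mul (monic_recip h0), ?_, ?_, ?_⟩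
  · have h0' : (recip h).coeff 0 ≠ 0 := by rw [coeff_zero_recip hm]; exact inv_ne_zero h0
    rw [reverse_mul_of_domain, reverse_eq_C_mul_recip h0, reverse_eq_C_mul_recip h0',
      recip_recip hm h0, coeff_zero_recip hm, mul_mul_mul_comm, ← C_mul, mul_inv_cancel₀ h0, C_1,
      one_mul, mul_comm]
  all_goals rw [eval_mul]
  · exact mul_ne_zero h1 (mt (eval_recip_eq_zero_iff (by ring) h0).mp h1)
  · exact mul_ne_zero h2 (mt (eval_recip_eq_zero_iff (by ring) h0).mp h2)

theorem mem_palindromicCore_of_recip_eq {p : F[X]} (hm : p.Monic) (h0 : p.coeff 0 ≠ 0)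
    (hr : recip p = p) (h1 : p.eval 1 ≠ 0) (h2 : p.eval (-1) ≠ 0) : p ∈ palindromicCore F := by
  have hrev : p.reverse = C (p.coeff 0) * p := by
    conv_lhs => rw [reverse_eq_C_mul_recip h0, hr]
  have h := eval_reverse (one_mul (1 : F)) p
  rw [one_pow, mul_one, hrev, eval_C_mul] at h
  rw [mul_left_eq_self₀, or_iff_left h1] at h
  exact ⟨hm, by rw [hrev, h, C_1, one_mul], h1, h2⟩

theorem coeff_zero_ne_zero_of_mul_recip_ne_zero {h : F[X]} (hh : h * recip h ≠ 0) :
    h.coeff 0 ≠ 0 := by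
  intro h0
  simp [recip, h0] at hh

theorem isCoprime_recip {p : F[X]} (hp : Irreducible p) (hm : p.Monic) (h0 : p.coeff 0 ≠ 0)
    (hr : recip p ≠ p) : IsCoprime p (recip p) := by
  rw [hp.coprime_iff_not_dvd]
  intro hdvd
  have hass := (hp.dvd_irreducible_iff_associated (irreducible_recip hp hm h0)).mp hdvd
  exact hr (eq_of_monic_of_associated hm (monic_recip h0) hass).symm

theorem recip_dvd_recip {f g : F[X]} (h : f ∣ g) : recip f ∣ recip g := by
  obtain ⟨c, rfl⟩ := h
  exact recip_mul f c ▸ dvd_mul_right _ _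

theorem mul_recip_dvd {p d : F[X]} (hp : Irreducible p) (hm : p.Monic) (h0 : p.coeff 0 ≠ 0)
    (hr : recip p ≠ p) (hd : d ∈ palindromicCore F) (h : p ∣ d) : p * recip p ∣ d :=
  (isCoprime_recip hp hm h0 hr).mul_dvd h
    (recip_of_mem_palindromicCore hd ▸ recip_dvd_recip h)

/-- The building blocks of `palindromicCore F` are self-reciprocal irreducible polynomials and
products of a reciprocal pair of distinct irreducible polynomials. -/
theorem exists_dvd_of_mem_palindromicCore {k : F[X]} (hk : k ∈ palindromicCore F) (hk1 : k ≠ 1) :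
    ∃ p : F[X], Irreducible p ∧ p.Monic ∧ p.coeff 0 ≠ 0 ∧
      ((recip p = p ∧ p ∈ palindromicCore F ∧ p ∣ k) ∨
        (recip p ≠ p ∧ p * recip p ∈ palindromicCore F ∧ p * recip p ∣ k)) := by
  obtain ⟨p, hm, hp, hpk⟩ :=
    exists_monic_irreducible_factor k (mt hk.1.isUnit_iff.mp hk1)
  have heval (a : F) (ha : k.eval a ≠ 0) : p.eval a ≠ 0 :=
    fun h => ha (eval_eq_zero_of_dvd_of_eval_eq_zero hpk h)
  have h0 : p.coeff 0 ≠ 0 := by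
    rw [coeff_zero_eq_eval_zero]
    apply heval
    rw [← coeff_zero_eq_eval_zero, coeff_zero_of_mem_palindromicCore hk]
    exact one_ne_zero
  have h1 := heval 1 hk.2.2.1
  have h2 := heval (-1) hk.2.2.2
  refine ⟨p, hp, hm, h0, ?_⟩
  by_cases hr : recip p = p
  · exact Or.inl ⟨hr, mem_palindromicCore_of_recip_eq hm h0 hr h1 h2, hpk⟩
  · exact Or.inr ⟨hr, mul_recip_mem_palindromicCore hm h0 h1 h2,
      mul_recip_dvd hp hm h0 hr hk hpk⟩

end SelfReciprocal

section DivisorSum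

variable {F : Type} [Field F]

/-- The sum of the Liouville function over the divisors of `k` in `palindromicCore F`. -/
noncomputable def liouvilleDivisorSum (k : F[X]) : ℤ :=
  ∑ᶠ d ∈ {d | d ∈ palindromicCore F ∧ d ∣ k}, liouville d

/-- The sum of the Liouville function over the divisors of `k` in `palindromicCore F` that are
not multiples of `P`. -/
noncomputable def liouvilleDivisorSumNot (P k : F[X]) : ℤ :=
  ∑ᶠ d ∈ {d | d ∈ palindromicCore F ∧ d ∣ k ∧ ¬P ∣ d}, liouville d

theorem liouvilleDivisorSumNot_of_not_dvd {P k : F[X]} (h : ¬P ∣ k) :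
    liouvilleDivisorSumNot P k = liouvilleDivisorSum k :=
  finsum_mem_congr (Set.ext fun _ => ⟨fun hd => ⟨hd.1, hd.2.1⟩,
    fun hd => ⟨hd.1, hd.2, fun hPd => h (hPd.trans hd.2)⟩⟩) fun _ _ => rfl

theorem liouvilleDivisorSumNot_mul {P : F[X]}
    (hco : ∀ d ∈ palindromicCore F, ¬P ∣ d → IsCoprime d P) (k : F[X]) :
    liouvilleDivisorSumNot P (P * k) = liouvilleDivisorSumNot P k :=
  finsum_mem_congr (Set.ext fun d =>
    ⟨fun hd => ⟨hd.1, (hco d hd.1 hd.2.2).dvd_of_dvd_mul_left hd.2.1, hd.2.2⟩,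
      fun hd => ⟨hd.1, hd.2.1.mul_left P, hd.2.2⟩⟩) fun _ _ => rfl

theorem liouvilleDivisorSum_mul [Finite F] {P k : F[X]} (hP : P ∈ palindromicCore F)
    (hco : ∀ d ∈ palindromicCore F, ¬P ∣ d → IsCoprime d P) (hk : k ≠ 0) :
    liouvilleDivisorSum (P * k)
      = liouvilleDivisorSumNot P k + liouville P * liouvilleDivisorSum k := by
  have hP0 := hP.1.ne_zero
  have hfin : {d | d ∈ palindromicCore F ∧ d ∣ P * k}.Finite :=
    (finite_setOf_dvd (mul_ne_zero hP0 hk)).subset fun d hd => hd.2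
  rw [liouvilleDivisorSum, ← finsum_mem_inter_add_sdiff {d | P ∣ d} hfin, add_comm,
    ← liouvilleDivisorSumNot_mul hco]
  congr 1
  · exact finsum_mem_congr (Set.ext fun d => and_assoc) fun _ _ => rfl
  · have himage : {d | d ∈ palindromicCore F ∧ d ∣ P * k} ∩ {d | P ∣ d}
        = (P * ·) '' {d | d ∈ palindromicCore F ∧ d ∣ k} := by
      ext d
      constructor
      · rintro ⟨⟨hd, hdk⟩, e, rfl⟩
        exact ⟨e, ⟨mem_palindromicCore_of_mul hP hd, (mul_dvd_mul_iff_left hP0).mp hdk⟩, rfl⟩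
      · rintro ⟨e, ⟨he, hek⟩, rfl⟩
        exact ⟨⟨mul_mem_palindromicCore hP he, mul_dvd_mul_left P hek⟩, dvd_mul_right P e⟩
    rw [himage, finsum_mem_image (mul_right_injective₀ hP0).injOn, liouvilleDivisorSum,
      mul_finsum_mem]
    exact finsum_mem_congr rfl fun d hd => liouville_mul hP0 hd.1.1.ne_zero

end DivisorSum

section NormForm

variable {F : Type} [Field F]

/-- The monic polynomials `h` with `h * h* = k`. -/
def recipNormFiber (k : F[X]) : Set F[X] :=
  {h | h.Monic ∧ h * recip h = k}

theorem finite_recipNormFiber [Finite F] {k : F[X]} (hk : k ≠ 0) : (recipNormFiber k).Finite :=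
  (finite_setOf_dvd hk).subset fun _ hh => ⟨_, hh.2.symm⟩

theorem ncard_recipNormFiber_inter_dvd {p : F[X]} (hm : p.Monic) (h0 : p.coeff 0 ≠ 0) (k : F[X]) :
    (recipNormFiber (p * recip p * k) ∩ {h | p ∣ h}).ncard = (recipNormFiber k).ncard := by
  have himage : recipNormFiber (p * recip p * k) ∩ {h | p ∣ h} = (p * ·) '' recipNormFiber k := by
    ext h
    constructor
    · rintro ⟨⟨hh, hhk⟩, e, rfl⟩
      refine ⟨e, ⟨hm.of_mul_monic_left hh, ?_⟩, rfl⟩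
      rw [recip_mul, mul_mul_mul_comm] at hhk
      exact mul_left_cancel₀ (hm.mul (monic_recip h0)).ne_zero hhk
    · rintro ⟨e, ⟨he, rfl⟩, rfl⟩
      exact ⟨⟨hm.mul he, by rw [recip_mul, mul_mul_mul_comm]⟩, dvd_mul_right p e⟩
  rw [himage, Set.ncard_image_of_injective _ (mul_right_injective₀ hm.ne_zero)]

theorem dvd_or_recip_dvd {p h k : F[X]} (hp : Irreducible p) (hk : k ≠ 0)
    (hh : h ∈ recipNormFiber k) (hpk : p ∣ k) : p ∣ h ∨ recip p ∣ h := by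
  rw [← hh.2] at hpk hk
  refine (hp.prime.dvd_or_dvd hpk).imp_right fun h' => ?_
  rw [← recip_recip hh.1 (coeff_zero_ne_zero_of_mul_recip_ne_zero hk)]
  exact recip_dvd_recip h'

theorem recipNormFiber_subset_dvd {p k : F[X]} (hp : Irreducible p) (hm : p.Monic)
    (hr : recip p = p) (hk : k ≠ 0) :
    recipNormFiber (p * k) ⊆ {h | p ∣ h} := fun h hh => by
  have := dvd_or_recip_dvd hp (mul_ne_zero hm.ne_zero hk) hh (dvd_mul_right p k)
  rwa [hr, or_self] at this

theorem ncard_recipNormFiber_self_mul_of_not_dvd {p k : F[X]} (hp : Irreducible p) (hm : p.Monic)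
    (hr : recip p = p) (hk : k ≠ 0) (hpk : ¬p ∣ k) :
    (recipNormFiber (p * k)).ncard = 0 := by
  suffices recipNormFiber (p * k) = ∅ by rw [this, Set.ncard_empty]
  refine Set.eq_empty_of_forall_notMem fun h hh => hpk ?_
  obtain ⟨e, rfl⟩ := recipNormFiber_subset_dvd hp hm hr hk hh
  have := hh.2
  rw [recip_mul, hr, mul_assoc] at this
  rw [← mul_left_cancel₀ hm.ne_zero this, mul_left_comm]
  exact dvd_mul_right _ _

theorem ncard_recipNormFiber_self_mul_self_mul {p k : F[X]} (hp : Irreducible p) (hm : p.Monic)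
    (h0 : p.coeff 0 ≠ 0) (hr : recip p = p) (hk : k ≠ 0) :
    (recipNormFiber (p * (p * k))).ncard = (recipNormFiber k).ncard := by
  rw [← ncard_recipNormFiber_inter_dvd hm h0 k, hr, ← mul_assoc, Set.inter_eq_left.mpr]
  rw [mul_assoc]
  exact recipNormFiber_subset_dvd hp hm hr (mul_ne_zero hm.ne_zero hk)

theorem ncard_recipNormFiber_pair_mul [Finite F] {p k : F[X]} (hp : Irreducible p) (hm : p.Monic)
    (h0 : p.coeff 0 ≠ 0) (hr : recip p ≠ p) (hk : k ≠ 0) :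
    (recipNormFiber (p * recip p * k)).ncard
        + (recipNormFiber (p * recip p * k) ∩ {h | p * recip p ∣ h}).ncard
      = 2 * (recipNormFiber k).ncard := by
  set P := p * recip p
  have hm' := monic_recip h0
  have h0' : (recip p).coeff 0 ≠ 0 := by rw [coeff_zero_recip hm]; exact inv_ne_zero h0
  have hk' : P * k ≠ 0 := mul_ne_zero (hm.mul hm').ne_zero hk
  have hfin := finite_recipNormFiber hk'
  have hB := ncard_recipNormFiber_inter_dvd hm' h0' k
  rw [recip_recip hm h0, mul_comm (recip p)] at hB
  have hunion : recipNormFiber (P * k) = recipNormFiber (P * k) ∩ {h | p ∣ h}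
      ∪ recipNormFiber (P * k) ∩ {h | recip p ∣ h} := by
    rw [← Set.inter_union_distrib_left, eq_comm, Set.inter_eq_left]
    exact fun h hh => dvd_or_recip_dvd hp hk' hh ((dvd_mul_right _ _).mul_right k)
  have hinter : recipNormFiber (P * k) ∩ {h | P ∣ h} = (recipNormFiber (P * k) ∩ {h | p ∣ h})
      ∩ (recipNormFiber (P * k) ∩ {h | recip p ∣ h}) := by
    rw [← Set.inter_inter_distrib_left]
    congr 1
    ext h
    exact ⟨fun h' => ⟨dvd_of_mul_right_dvd h', dvd_of_mul_left_dvd h'⟩,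
      fun h' => (isCoprime_recip hp hm h0 hr).mul_dvd h'.1 h'.2⟩
  conv_lhs => rw [hinter]; lhs; rw [hunion]
  rw [Set.ncard_union_add_ncard_inter _ _ (hfin.inter_of_left _) (hfin.inter_of_left _), hB,
    ncard_recipNormFiber_inter_dvd hm h0, two_mul]

theorem ncard_recipNormFiber_pair_mul_of_not_dvd [Finite F] {p k : F[X]} (hp : Irreducible p)
    (hm : p.Monic) (h0 : p.coeff 0 ≠ 0) (hr : recip p ≠ p) (hP : p * recip p ∈ palindromicCore F)
    (hk : k ≠ 0) (hpk : ¬p * recip p ∣ k) :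
    (recipNormFiber (p * recip p * k)).ncard = 2 * (recipNormFiber k).ncard := by
  rw [← ncard_recipNormFiber_pair_mul hp hm h0 hr hk, left_eq_add]
  suffices recipNormFiber (p * recip p * k) ∩ {h | p * recip p ∣ h} = ∅ by
    rw [this, Set.ncard_empty]
  refine Set.eq_empty_of_forall_notMem ?_
  rintro _ ⟨hh, e, rfl⟩
  have := hh.2
  rw [recip_mul (p * recip p), recip_of_mem_palindromicCore hP, mul_assoc] at this
  apply hpk
  rw [← mul_left_cancel₀ hP.1.ne_zero this, mul_left_comm]
  exact dvd_mul_right _ _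

theorem ncard_recipNormFiber_pair_mul_pair_mul [Finite F] {p k : F[X]} (hp : Irreducible p)
    (hm : p.Monic) (h0 : p.coeff 0 ≠ 0) (hr : recip p ≠ p) (hP : p * recip p ∈ palindromicCore F)
    (hk : k ≠ 0) :
    (recipNormFiber (p * recip p * (p * recip p * k))).ncard + (recipNormFiber k).ncard
      = 2 * (recipNormFiber (p * recip p * k)).ncard := by
  rw [← ncard_recipNormFiber_pair_mul hp hm h0 hr (mul_ne_zero hP.1.ne_zero hk)]
  have hP0 : (p * recip p).coeff 0 ≠ 0 := by
    rw [coeff_zero_of_mem_palindromicCore hP]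
    exact one_ne_zero
  have := ncard_recipNormFiber_inter_dvd hP.1 hP0 k
  rw [recip_of_mem_palindromicCore hP, mul_assoc (p * recip p)] at this
  rw [this]

/-- The identity `∑_{d ∣ k} λ(d) = #{h : h h* = k}` on `palindromicCore F`. -/
theorem liouvilleDivisorSum_eq_ncard [Finite F] {k : F[X]} (hk : k ∈ palindromicCore F) :
    liouvilleDivisorSum k = (recipNormFiber k).ncard := by
  induction hn : k.natDegree using Nat.strong_induction_on generalizing k with
  | _ n ih =>
  subst hn
  by_cases hk1 : k = 1
  · subst hk1
    have hD : {d | d ∈ palindromicCore F ∧ d ∣ 1} = {1} := by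
      ext d
      exact ⟨fun hd => hd.1.1.isUnit_iff.mp (isUnit_of_dvd_one hd.2),
        by rintro rfl; exact ⟨one_mem_palindromicCore, dvd_rfl⟩⟩
    have hR : recipNormFiber (1 : F[X]) = {1} := by
      ext h
      refine ⟨fun hh => hh.1.isUnit_iff.mp (IsUnit.of_mul_eq_one _ hh.2), ?_⟩
      rintro rfl
      exact ⟨monic_one, by rw [one_mul, recip_of_mem_palindromicCore one_mem_palindromicCore]⟩
    rw [liouvilleDivisorSum, hD, hR, finsum_mem_singleton, liouville_one, Set.ncard_singleton,
      Nat.cast_one]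
  have ih' {P g : F[X]} (hP : P ∈ palindromicCore F) (hP1 : 0 < P.natDegree) (e : F[X])
      (hg : g = P * e) (hgk : g ∈ palindromicCore F) (hle : g.natDegree ≤ k.natDegree) :
      e ∈ palindromicCore F ∧ e.natDegree < k.natDegree ∧
        liouvilleDivisorSum e = (recipNormFiber e).ncard := by
    subst hg
    have he := mem_palindromicCore_of_mul hP hgk
    rw [hP.1.natDegree_mul he.1] at hle
    exact ⟨he, by omega, ih _ (by omega) he rfl⟩
  obtain ⟨p, hp, hm, h0, ⟨hr, hP, e, rfl⟩ | ⟨hr, hP, e, rfl⟩⟩ :=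
    exists_dvd_of_mem_palindromicCore hk hk1
  · obtain ⟨he, helt, heq⟩ := ih' hP hp.natDegree_pos e rfl hk le_rfl
    have hco (d : F[X]) (_ : d ∈ palindromicCore F) (hd : ¬p ∣ d) : IsCoprime d p :=
      ((hp.coprime_iff_not_dvd).mpr hd).symm
    rw [liouvilleDivisorSum_mul hP hco he.1.ne_zero, liouville_irreducible hp]
    by_cases hpe : p ∣ e
    · obtain ⟨c, rfl⟩ := hpe
      obtain ⟨hc, -, hceq⟩ := ih' hP hp.natDegree_pos c rfl he helt.le
      rw [liouvilleDivisorSumNot_mul hco, ncard_recipNormFiber_self_mul_self_mul hp hm h0 hr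
        hc.1.ne_zero, liouvilleDivisorSum_mul hP hco hc.1.ne_zero, liouville_irreducible hp, hceq]
      ring
    · rw [liouvilleDivisorSumNot_of_not_dvd hpe,
        ncard_recipNormFiber_self_mul_of_not_dvd hp hm hr he.1.ne_zero hpe]
      simp
  · have hPpos : 0 < (p * recip p).natDegree := by
      rw [hm.natDegree_mul (monic_recip h0)]
      have := hp.natDegree_pos
      omega
    obtain ⟨he, helt, heq⟩ := ih' hP hPpos e rfl hk le_rfl
    have hco (d : F[X]) (hd : d ∈ palindromicCore F) (hPd : ¬p * recip p ∣ d) :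
        IsCoprime d (p * recip p) := by
      have hpd : ¬p ∣ d := mt (mul_recip_dvd hp hm h0 hr hd) hPd
      have hpd' : ¬recip p ∣ d := fun h => hpd <| by
        have := recip_dvd_recip h
        rwa [recip_recip hm h0, recip_of_mem_palindromicCore hd] at this
      exact (((hp.coprime_iff_not_dvd).mpr hpd).symm).mul_right
        (((irreducible_recip hp hm h0).coprime_iff_not_dvd.mpr hpd').symm)
    have hlP : liouville (p * recip p) = 1 := by
      rw [liouville_mul hm.ne_zero (monic_recip h0).ne_zero, liouville_irreducible hp,
        liouville_irreducible (irreducible_recip hp hm h0)]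
      norm_num
    rw [liouvilleDivisorSum_mul hP hco he.1.ne_zero, hlP]
    by_cases hpe : p * recip p ∣ e
    · obtain ⟨c, rfl⟩ := hpe
      obtain ⟨hc, -, hceq⟩ := ih' hP hPpos c rfl he helt.le
      have hR := ncard_recipNormFiber_pair_mul_pair_mul hp hm h0 hr hP hc.1.ne_zero
      have hD := liouvilleDivisorSum_mul hP hco hc.1.ne_zero
      rw [hlP] at hD
      rw [liouvilleDivisorSumNot_mul hco]
      zify at hR
      linarith
    · rw [liouvilleDivisorSumNot_of_not_dvd hpe,
        ncard_recipNormFiber_pair_mul_of_not_dvd hp hm h0 hr hP he.1.ne_zero hpe, heq]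
      push_cast
      ring

end NormForm

section Convolution

variable {F : Type} [Field F]

/-- Half of the degree, the natural grading of palindromic polynomials of even degree. -/
def halfDegree (f : F[X]) : ℕ :=
  f.natDegree / 2

theorem two_mul_halfDegree {f : F[X]} (hf : f ∈ palindromicCore F) :
    2 * halfDegree f = f.natDegree :=
  Nat.two_mul_div_two_of_even (even_natDegree_of_mem_palindromicCore hf)

theorem halfDegree_mul {f g : F[X]} (hf : f ∈ palindromicCore F) (hg : g ∈ palindromicCore F) :
    halfDegree (f * g) = halfDegree f + halfDegree g := by
  have := two_mul_halfDegree (mul_mem_palindromicCore hf hg)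
  rw [hf.1.natDegree_mul hg.1, ← two_mul_halfDegree hf, ← two_mul_halfDegree hg] at this
  omega

theorem finite_natDegree_eq [Finite F] (K : Set F[X]) (n : ℕ) :
    {f | f ∈ K ∧ f.natDegree = n}.Finite :=
  (finite_setOf_natDegree_le n).subset fun _ hf => hf.2.le

theorem finite_halfDegree_eq [Finite F] (K : Set F[X]) (n : ℕ) :
    {f | f ∈ K ∧ halfDegree f = n}.Finite :=
  (finite_setOf_natDegree_le (2 * n + 1)).subset fun f hf => by
    have := hf.2
    rw [halfDegree] at this
    change f.natDegree ≤ 2 * n + 1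
    omega

theorem genFun_liouville_mul_genFun_one [Finite F] :
    genFun halfDegree (palindromicCore F) liouville * genFun halfDegree (palindromicCore F) 1
      = genFun halfDegree (palindromicCore F) liouvilleDivisorSum := by
  classical
  ext n
  let S (m : ℕ) : Finset F[X] := (finite_halfDegree_eq (palindromicCore F) m).toFinset
  have hS (m : ℕ) (f : F[X]) : f ∈ S m ↔ f ∈ palindromicCore F ∧ halfDegree f = m :=
    Set.Finite.mem_toFinset _
  have hcoeff (m : ℕ) (w : F[X] → ℤ) :
      PowerSeries.coeff m (genFun halfDegree (palindromicCore F) w) = ∑ f ∈ S m, w f := by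
    rw [coeff_genFun, finsum_mem_eq_finite_toFinset_sum]
  let D (k : F[X]) : Finset F[X] := if hk : k = 0 then ∅ else
    ((finite_setOf_dvd hk).subset fun d (hd : d ∈ palindromicCore F ∧ d ∣ k) => hd.2).toFinset
  have hD {k : F[X]} (hk : k ≠ 0) (d : F[X]) : d ∈ D k ↔ d ∈ palindromicCore F ∧ d ∣ k := by
    simp only [D, dif_neg hk]
    exact Set.Finite.mem_toFinset _
  have hsum : ∀ k ∈ S n, liouvilleDivisorSum k = ∑ d ∈ D k, liouville d := fun k hk => by
    have hk0 := ((hS n k).mp hk).1.1.ne_zero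
    simp only [D, dif_neg hk0]
    rw [liouvilleDivisorSum, finsum_mem_eq_finite_toFinset_sum]
  rw [PowerSeries.coeff_mul, hcoeff, Finset.sum_congr rfl hsum, Finset.sum_sigma']
  simp only [hcoeff, Finset.sum_mul_sum, ← Finset.sum_product', Pi.one_apply, mul_one]
  rw [Finset.sum_sigma']
  refine Finset.sum_nbij' (fun x => ⟨x.2.1 * x.2.2, x.2.1⟩)
    (fun x => ⟨(halfDegree x.2, halfDegree (x.1 / x.2)), (x.2, x.1 / x.2)⟩) ?_ ?_ ?_ ?_ ?_
  · rintro ⟨⟨i, j⟩, d, e⟩ hx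
    simp only [Finset.mem_sigma, Finset.mem_product, hS] at hx ⊢
    obtain ⟨hij, ⟨hd, rfl⟩, he, rfl⟩ := hx
    have hde := mul_mem_palindromicCore hd he
    exact ⟨⟨hde, (halfDegree_mul hd he).trans (Finset.HasAntidiagonal.mem_antidiagonal.mp hij)⟩,
      (hD hde.1.ne_zero d).mpr ⟨hd, dvd_mul_right _ _⟩⟩
  · rintro ⟨k, d⟩ hx
    simp only [Finset.mem_sigma, Finset.mem_product, hS] at hx ⊢
    obtain ⟨⟨hk, hkn⟩, hdk⟩ := hx
    obtain ⟨hd, e, rfl⟩ := (hD hk.1.ne_zero d).mp hdk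
    have he := mem_palindromicCore_of_mul hd hk
    rw [mul_div_cancel_left₀ _ hd.1.ne_zero]
    exact ⟨Finset.HasAntidiagonal.mem_antidiagonal.mpr ((halfDegree_mul hd he).symm.trans hkn),
      ⟨hd, trivial⟩, he, trivial⟩
  · rintro ⟨⟨i, j⟩, d, e⟩ hx
    simp only [Finset.mem_sigma, Finset.mem_product, hS] at hx
    obtain ⟨-, ⟨hd, rfl⟩, he, rfl⟩ := hx
    simp only [mul_div_cancel_left₀ _ hd.1.ne_zero]
  · rintro ⟨k, d⟩ hx
    simp only [Finset.mem_sigma, hS] at hx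
    obtain ⟨⟨hk, hkn⟩, hdk⟩ := hx
    obtain ⟨hd, e, rfl⟩ := (hD hk.1.ne_zero d).mp hdk
    simp only [mul_div_cancel_left₀ _ hd.1.ne_zero]
  · intro x _
    rfl

/-- The polynomials that vanish at no point of `s`. -/
def nonvanishing (s : Finset F) : Set F[X] :=
  {f | ∀ b ∈ s, f.eval b ≠ 0}

theorem genFun_ncard_recipNormFiber [Finite F] {s : Finset F}
    (hs : ∀ b, b ∈ s ↔ b = 0 ∨ b = 1 ∨ b = -1) :
    genFun halfDegree (palindromicCore F) (fun k => ((recipNormFiber k).ncard : ℤ))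
      = genFun natDegree ({f | f.Monic} ∩ nonvanishing s) 1 := by
  classical
  ext n
  rw [coeff_genFun, coeff_genFun, finsum_mem_eq_finite_toFinset_sum _ (finite_halfDegree_eq _ n),
    finsum_mem_eq_finite_toFinset_sum _ (finite_natDegree_eq _ n),
    ← Finset.sum_fiberwise_of_maps_to
      (s := (finite_natDegree_eq ({f | f.Monic} ∩ nonvanishing s) n).toFinset)
      (g := fun h => h * recip h)
      (t := (finite_halfDegree_eq (palindromicCore F) n).toFinset)]
  · refine Finset.sum_congr rfl fun k hk => ?_
    rw [Set.Finite.mem_toFinset] at hk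
    obtain ⟨hk, rfl⟩ := hk
    simp only [Pi.one_apply, Finset.sum_const, nsmul_eq_mul, mul_one, Nat.cast_inj]
    rw [← Set.ncard_coe_finset]
    congr 1
    ext h
    simp only [Finset.coe_filter, Set.Finite.mem_toFinset]
    refine ⟨fun ⟨hh, hhk⟩ => ⟨⟨⟨hh, ?_⟩, ?_⟩, hhk⟩, fun hh => ⟨hh.1.1.1, hh.2⟩⟩
    · have h0 := coeff_zero_ne_zero_of_mul_recip_ne_zero (hhk ▸ hk.1.ne_zero)
      have heval (a : F) (ha : k.eval a ≠ 0) : h.eval a ≠ 0 :=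
        fun hz => ha (eval_eq_zero_of_dvd_of_eval_eq_zero ⟨_, hhk.symm⟩ hz)
      intro b hb
      rcases (hs b).mp hb with rfl | rfl | rfl
      · rwa [← coeff_zero_eq_eval_zero]
      · exact heval _ hk.2.2.1
      · exact heval _ hk.2.2.2
    · have h0 := coeff_zero_ne_zero_of_mul_recip_ne_zero (hhk ▸ hk.1.ne_zero)
      rw [halfDegree, ← hhk, hh.natDegree_mul (monic_recip h0), natDegree_recip h0]
      omega
  · intro h hh
    rw [Set.Finite.mem_toFinset] at hh ⊢
    obtain ⟨⟨hh, hv⟩, rfl⟩ := hh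
    have h0 : h.coeff 0 ≠ 0 := by
      rw [coeff_zero_eq_eval_zero]
      exact hv 0 ((hs 0).mpr (Or.inl rfl))
    refine ⟨mul_recip_mem_palindromicCore hh h0 (hv 1 ((hs 1).mpr (Or.inr (Or.inl rfl))))
      (hv (-1) ((hs (-1)).mpr (Or.inr (Or.inr rfl)))), ?_⟩
    rw [halfDegree, hh.natDegree_mul (monic_recip h0), natDegree_recip h0]
    omega

end Convolution

section Counting

variable {F : Type} [Field F]

theorem genFun_inter_nonvanishing {δ : F[X] → ℕ} {K : Set F[X]} {w : F[X] → ℤ}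
    (hfin : ∀ (K : Set F[X]) (n : ℕ), {f | f ∈ K ∧ δ f = n}.Finite) {M : F → F[X]} {c : ℤ}
    {s : Finset F}
    (hM : ∀ a ∈ s, ∀ b, (M a).eval b = 0 ↔ b = a)
    (hMK : ∀ a ∈ s, ∀ g, M a * g ∈ K ↔ g ∈ K)
    (hdvd : ∀ a ∈ s, ∀ f ∈ K, f.eval a = 0 → M a ∣ f)
    (hδ : ∀ a ∈ s, ∀ g ∈ K, δ (M a * g) = δ g + 1)
    (hw : ∀ a ∈ s, ∀ g ∈ K, w (M a * g) = c * w g) :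
    genFun δ (K ∩ nonvanishing s) w
      = (1 - PowerSeries.C c * PowerSeries.X) ^ s.card * genFun δ K w := by
  classical
  induction s using Finset.induction_on with
  | empty =>
    rw [Finset.card_empty, pow_zero, one_mul, Set.inter_eq_left.mpr]
    exact fun f _ b hb => absurd hb (Finset.notMem_empty b)
  | insert a s ha ih =>
    rw [Finset.forall_mem_insert] at hM hMK hdvd hδ hw
    have hMa : M a ≠ 0 := fun h => by
      have := (hM.1 (a + 1)).mp (by rw [h, eval_zero])
      exact one_ne_zero (left_eq_add.mp this.symm)
    have hMs (g : F[X]) : M a * g ∈ nonvanishing s ↔ g ∈ nonvanishing s := by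
      refine forall₂_congr fun b hb => ?_
      have : (M a).eval b ≠ 0 := fun h => ha ((hM.1 b).mp h ▸ hb)
      rw [eval_mul, mul_ne_zero_iff, and_iff_right this]
    have hset : K ∩ nonvanishing (insert a s)
        = K ∩ nonvanishing s ∩ {f | f.eval a ≠ 0} := by
      ext f
      refine ⟨fun hf => ⟨⟨hf.1, fun b hb => hf.2 b (Finset.mem_insert_of_mem hb)⟩,
        hf.2 a (Finset.mem_insert_self a s)⟩, fun hf => ⟨hf.1.1, ?_⟩⟩
      exact (Finset.forall_mem_insert _ _ _).mpr ⟨hf.2, hf.1.2⟩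
    rw [hset, Finset.card_insert_of_notMem ha, pow_succ', mul_assoc,
      ← ih hM.2 hMK.2 hdvd.2 hδ.2 hw.2]
    refine genFun_inter (hfin _) hMa (fun g hg => ⟨⟨(hMK.1 g).mpr hg.1, (hMs g).mpr hg.2⟩, ?_⟩)
      (fun f hf hfa => ?_) (fun g hg => hδ.1 g hg.1) (fun g hg => hw.1 g hg.1)
    · intro h
      exact h (by rw [eval_mul, (hM.1 a).mpr rfl, zero_mul])
    · obtain ⟨g, rfl⟩ := hdvd.1 f hf.1 (not_not.mp hfa)
      exact ⟨g, ⟨(hMK.1 g).mp hf.1, (hMs g).mp hf.2⟩, rfl⟩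

theorem genFun_monic_inter_nonvanishing [Finite F] (s : Finset F) :
    genFun natDegree ({f | f.Monic} ∩ nonvanishing s) 1
      = (1 - PowerSeries.X) ^ s.card * genFun natDegree {f : F[X] | f.Monic} 1 := by
  have h := genFun_inter_nonvanishing (δ := natDegree) (K := {f : F[X] | f.Monic}) (w := 1)
    finite_natDegree_eq (M := fun a => X - C a) (c := 1) (s := s)
    (fun a _ b => by rw [eval_sub, eval_X, eval_C, sub_eq_zero])
    (fun a _ g => ⟨fun h => (monic_X_sub_C a).of_mul_monic_left h,
      fun h => (monic_X_sub_C a).mul h⟩)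
    (fun a _ f _ h => dvd_iff_isRoot.mpr h)
    (fun a _ g hg => by
      rw [(monic_X_sub_C a).natDegree_mul hg, natDegree_X_sub_C, add_comm])
    (fun a _ g _ => by simp)
  rwa [map_one, one_mul] at h

/-- The monic palindromic polynomials of even degree. -/
def evenPalindromic (F : Type) [Field F] : Set F[X] :=
  {f | f.Monic ∧ f.reverse = f ∧ Even f.natDegree}

theorem palindromicCore_eq {s : Finset F} (hs : ∀ b, b ∈ s ↔ b = 1 ∨ b = -1) :
    palindromicCore F = evenPalindromic F ∩ nonvanishing s := by
  ext f
  constructor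
  · intro hf
    refine ⟨⟨hf.1, hf.2.1, even_natDegree_of_mem_palindromicCore hf⟩, fun b hb => ?_⟩
    rcases (hs b).mp hb with rfl | rfl
    exacts [hf.2.2.1, hf.2.2.2]
  · rintro ⟨hf, hv⟩
    exact ⟨hf.1, hf.2.1, hv 1 ((hs 1).mpr (Or.inl rfl)), hv (-1) ((hs (-1)).mpr (Or.inr rfl))⟩

theorem reverse_X_sub_C_sq_mul {a : F} (ha : a * a = 1) (g : F[X]) :
    ((X - C a) ^ 2 * g).reverse = (X - C a) ^ 2 * g.reverse := by
  rw [reverse_mul_of_domain, pow_two, reverse_mul_of_domain, reverse_X_sub_C ha,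
    mul_mul_mul_comm, ← C_mul, neg_mul_neg, ha, C_1, one_mul]

theorem X_sub_C_sq_mul_mem_evenPalindromic_iff {a : F} (ha : a * a = 1) (g : F[X]) :
    (X - C a) ^ 2 * g ∈ evenPalindromic F ↔ g ∈ evenPalindromic F := by
  have hm : ((X - C a) ^ 2).Monic := (monic_X_sub_C a).pow 2
  have hdeg (h : g.Monic) : Even ((X - C a) ^ 2 * g).natDegree ↔ Even g.natDegree := by
    rw [hm.natDegree_mul h, natDegree_pow, natDegree_X_sub_C, Nat.even_add]
    simp
  have hrev : ((X - C a) ^ 2 * g).reverse = (X - C a) ^ 2 * g ↔ g.reverse = g := by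
    rw [reverse_X_sub_C_sq_mul ha, mul_right_inj' hm.ne_zero]
  constructor
  · rintro ⟨h1, h2, h3⟩
    have h1' := hm.of_mul_monic_left h1
    exact ⟨h1', hrev.mp h2, (hdeg h1').mp h3⟩
  · rintro ⟨h1, h2, h3⟩
    exact ⟨hm.mul h1, hrev.mpr h2, (hdeg h1).mpr h3⟩

theorem X_sub_C_sq_dvd_of_mem_evenPalindromic {a : F} (ha : a * a = 1) {f : F[X]}
    (hf : f ∈ evenPalindromic F) (h : f.eval a = 0) : (X - C a) ^ 2 ∣ f := by
  obtain ⟨g, rfl⟩ := dvd_iff_isRoot.mpr h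
  obtain ⟨hm, hr, he⟩ := hf
  have hg : g.Monic := (monic_X_sub_C a).of_mul_monic_left hm
  rw [(monic_X_sub_C a).natDegree_mul hg, natDegree_X_sub_C, Nat.even_add] at he
  have hodd : Odd g.natDegree := by
    rw [← Nat.not_even_iff_odd]
    simpa using he
  rw [pow_two]
  refine mul_dvd_mul_left _ (dvd_iff_isRoot.mpr (eval_eq_zero_of_reverse_eq ha hodd ?_))
  rw [reverse_mul_of_domain, reverse_X_sub_C ha, mul_right_comm, mul_comm,
    mul_right_inj' (X_sub_C_ne_zero a)] at hr
  conv_rhs => rw [← hr]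
  rw [← mul_assoc, ← C_mul, neg_mul_neg, ha, C_1, one_mul]

theorem genFun_palindromicCore_one [Finite F] {s : Finset F}
    (hs : ∀ b, b ∈ s ↔ b = 1 ∨ b = -1) :
    genFun halfDegree (palindromicCore F) 1
      = (1 - PowerSeries.X) ^ s.card * genFun halfDegree (evenPalindromic F) 1 := by
  have hsq : ∀ a ∈ s, a * a = 1 := fun a ha => by
    rcases (hs a).mp ha with rfl | rfl <;> ring
  rw [palindromicCore_eq hs]
  have h := genFun_inter_nonvanishing (δ := halfDegree) (K := evenPalindromic F) (w := 1)
    finite_halfDegree_eq (M := fun a => (X - C a) ^ 2) (c := 1) (s := s)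
    (fun a _ b => by rw [eval_pow, eval_sub, eval_X, eval_C, sq_eq_zero_iff, sub_eq_zero])
    (fun a ha g => X_sub_C_sq_mul_mem_evenPalindromic_iff (hsq a ha) g)
    (fun a ha f hf h => X_sub_C_sq_dvd_of_mem_evenPalindromic (hsq a ha) hf h)
    (fun a _ g hg => by
      rw [halfDegree, ((monic_X_sub_C a).pow 2).natDegree_mul hg.1, natDegree_pow,
        natDegree_X_sub_C, halfDegree]
      omega)
    (fun a _ g _ => by simp)
  rwa [map_one, one_mul] at h

/-- There are as many monic palindromic polynomials of degree `2n` as monic ones of degree `n`. -/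
theorem genFun_evenPalindromic_one :
    genFun halfDegree (evenPalindromic F) 1 = genFun natDegree {f : F[X] | f.Monic} 1 := by
  ext n
  rw [coeff_genFun, coeff_genFun]
  let e (f : F[X]) : F[X] := ∑ i ∈ Finset.range (n + 1), monomial i (f.coeff (n + i))
  have hdeg {f : F[X]} (hf : f ∈ evenPalindromic F ∧ halfDegree f = n) :
      f.natDegree = 2 * n := by
    rw [← hf.2, halfDegree, Nat.two_mul_div_two_of_even hf.1.2.2]
  have he {f : F[X]} (hf : f ∈ evenPalindromic F ∧ halfDegree f = n) (i : ℕ) :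
      (e f).coeff i = f.coeff (n + i) := by
    simp only [e, finsetSum_coeff, coeff_monomial, Finset.sum_ite_eq', Finset.mem_range]
    split_ifs with hi
    · rfl
    · rw [coeff_eq_zero_of_natDegree_lt]
      rw [hdeg hf]
      omega
  refine finsum_mem_eq_of_bijOn e ⟨fun f hf => ?_, fun f hf g hg hfg => ?_, fun g hg => ?_⟩
    fun _ _ => rfl
  · have hle : (e f).natDegree ≤ n := natDegree_le_iff_coeff_eq_zero.mpr fun i hi => by
      rw [he hf, coeff_eq_zero_of_natDegree_lt]
      rw [hdeg hf]
      omega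
    have h1 : (e f).coeff n = 1 := by
      rw [he hf, ← two_mul, ← hdeg hf]
      exact hf.1.1
    exact ⟨monic_of_natDegree_le_of_coeff_eq_one n hle h1,
      natDegree_eq_of_le_of_coeff_ne_zero hle (h1 ▸ one_ne_zero)⟩
  · have hup (j : ℕ) (hj : n ≤ j) : f.coeff j = g.coeff j := by
      obtain ⟨i, rfl⟩ := Nat.exists_eq_add_of_le hj
      rw [← he hf, ← he hg, hfg]
    ext j
    by_cases hj : n ≤ j
    · exact hup j hj
    · rw [← hf.1.2.1, ← hg.1.2.1, coeff_reverse, coeff_reverse, hdeg hf, hdeg hg,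
        revAt_le (by omega), hup _ (by omega)]
  · obtain ⟨hgm, hgn⟩ := hg
    let f : F[X] := ∑ j ∈ Finset.range (2 * n + 1), monomial j (g.coeff (j - n + (n - j)))
    have hf (j : ℕ) : f.coeff j = if j < 2 * n + 1 then g.coeff (j - n + (n - j)) else 0 := by
      simp only [f, finsetSum_coeff, coeff_monomial, Finset.sum_ite_eq', Finset.mem_range]
    have hle : f.natDegree ≤ 2 * n := natDegree_le_iff_coeff_eq_zero.mpr fun i hi => by
      rw [hf, if_neg (by omega)]
    have h1 : f.coeff (2 * n) = 1 := by
      rw [hf, if_pos (by omega), show 2 * n - n + (n - 2 * n) = n by omega, ← hgn]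
      exact hgm
    have hfn : f.natDegree = 2 * n :=
      natDegree_eq_of_le_of_coeff_ne_zero hle (h1 ▸ one_ne_zero)
    have hfmem : f ∈ evenPalindromic F ∧ halfDegree f = n := by
      refine ⟨⟨monic_of_natDegree_le_of_coeff_eq_one _ hle h1, ?_, hfn ▸ even_two_mul n⟩, ?_⟩
      · ext j
        rw [coeff_reverse, hfn]
        by_cases hj : j ≤ 2 * n
        · rw [revAt_le hj, hf, hf, if_pos (by omega), if_pos (by omega)]
          congr 1
          omega
        · rw [revAt_eq_self_of_lt (by omega)]
      · rw [halfDegree, hfn]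
        omega
    refine ⟨f, hfmem, ?_⟩
    ext i
    rw [he hfmem, hf]
    split_ifs with hi
    · congr 1
      omega
    · rw [coeff_eq_zero_of_natDegree_lt (by omega)]

theorem genFun_monic_one_ne_zero : genFun natDegree {f : F[X] | f.Monic} 1 ≠ 0 := by
  intro h
  have h0 := congrArg (PowerSeries.coeff 0) h
  have hset : {f : F[X] | f ∈ {f : F[X] | f.Monic} ∧ f.natDegree = 0} = {1} := by
    ext f
    refine ⟨fun hf => (hf.1.natDegree_eq_zero).mp hf.2, ?_⟩
    rintro rfl
    exact ⟨monic_one, natDegree_one⟩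
  rw [coeff_genFun, hset, finsum_mem_singleton] at h0
  simp at h0

theorem genFun_halfDegree_liouville [Finite F] :
    genFun halfDegree (palindromicCore F) liouville = 1 - PowerSeries.X := by
  classical
  have hX : (1 - PowerSeries.X : PowerSeries ℤ) ≠ 0 := fun h => by
    simpa using congrArg (PowerSeries.coeff 0) h
  have hs (b : F) : b ∈ ({1, -1} : Finset F) ↔ b = 1 ∨ b = -1 := by simp
  have hs0 (b : F) : b ∈ ({0, 1, -1} : Finset F) ↔ b = 0 ∨ b = 1 ∨ b = -1 := by simp
  have hC := genFun_palindromicCore_one hs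
  rw [genFun_evenPalindromic_one] at hC
  have hC0 : genFun halfDegree (palindromicCore F) 1 ≠ 0 := by
    rw [hC]
    exact mul_ne_zero (pow_ne_zero _ hX) genFun_monic_one_ne_zero
  apply mul_right_cancel₀ hC0
  rw [genFun_liouville_mul_genFun_one, genFun_congr fun k hk => liouvilleDivisorSum_eq_ncard hk,
    genFun_ncard_recipNormFiber hs0, genFun_monic_inter_nonvanishing,
    Finset.card_insert_of_notMem (by simp), pow_succ', mul_assoc, ← hC]

theorem genFun_natDegree_liouville [Finite F] :
    genFun natDegree (palindromicCore F) liouville = 1 - PowerSeries.X ^ 2 := by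
  ext n
  rw [coeff_genFun]
  have hcoeff : PowerSeries.coeff n (1 - PowerSeries.X ^ 2 : PowerSeries ℤ)
      = (if n = 0 then 1 else 0) - if n = 2 then 1 else 0 := by
    rw [map_sub, PowerSeries.coeff_one, PowerSeries.coeff_X_pow]
  rw [hcoeff]
  obtain ⟨m, rfl | rfl⟩ := n.even_or_odd'
  · have hset : {f | f ∈ palindromicCore F ∧ f.natDegree = 2 * m}
        = {f | f ∈ palindromicCore F ∧ halfDegree f = m} :=
      Set.ext fun f => and_congr_right fun hf => by
        rw [← two_mul_halfDegree hf]
        omega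
    rw [hset, ← coeff_genFun, genFun_halfDegree_liouville, map_sub, PowerSeries.coeff_one,
      PowerSeries.coeff_X]
    congr 1 <;> exact if_congr (by omega) rfl rfl
  · have hset : {f | f ∈ palindromicCore F ∧ f.natDegree = 2 * m + 1} = ∅ :=
      Set.eq_empty_of_forall_notMem fun f hf => by
        have := two_mul_halfDegree hf.1
        rw [hf.2] at this
        omega
    rw [hset, finsum_mem_empty, if_neg (by omega), if_neg (by omega), sub_zero]

end Counting

section StarSymmetric

variable {F : Type} [Field F]

/-- The monic *-symmetric polynomials. -/
def monicStarSymm (F : Type) [Field F] : Set F[X] :=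
  {f | f.Monic ∧ IsStarSymm f}

theorem recip_eq_of_isStarSymm {f : F[X]} (hf : IsStarSymm f) : recip f = f := by
  rw [recip, hf.2, ← mul_assoc, ← C_mul, inv_mul_cancel₀ hf.1, C_1, one_mul]

theorem palindromicCore_eq_monicStarSymm_inter {s : Finset F} (hs : ∀ b, b ∈ s ↔ b = 1 ∨ b = -1) :
    palindromicCore F = monicStarSymm F ∩ nonvanishing s := by
  ext f
  constructor
  · intro hf
    have h0 := coeff_zero_of_mem_palindromicCore hf
    refine ⟨⟨hf.1, h0 ▸ one_ne_zero, by rw [h0, C_1, one_mul, hf.2.1]⟩, fun b hb => ?_⟩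
    rcases (hs b).mp hb with rfl | rfl
    exacts [hf.2.2.1, hf.2.2.2]
  · rintro ⟨⟨hm, hf⟩, hv⟩
    exact mem_palindromicCore_of_recip_eq hm hf.1 (recip_eq_of_isStarSymm hf)
      (hv 1 ((hs 1).mpr (Or.inl rfl))) (hv (-1) ((hs (-1)).mpr (Or.inr rfl)))

theorem X_sub_C_mul_mem_monicStarSymm_iff {a : F} (ha : a * a = 1) (g : F[X]) :
    (X - C a) * g ∈ monicStarSymm F ↔ g ∈ monicStarSymm F := by
  have hm := monic_X_sub_C a
  have ha0 : -a ≠ 0 := neg_ne_zero.mpr (left_ne_zero_of_mul (ha ▸ one_ne_zero))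
  have h0 : ((X - C a) * g).coeff 0 = -a * g.coeff 0 := by
    rw [mul_coeff_zero, coeff_sub, coeff_X_zero, coeff_C_zero, zero_sub]
  refine and_congr ⟨hm.of_mul_monic_left, hm.mul⟩ (and_congr ?_ ?_)
  · rw [h0, mul_ne_zero_iff, and_iff_right ha0]
  · rw [h0, reverse_mul_of_domain, reverse_X_sub_C ha, C_mul, mul_mul_mul_comm,
      mul_assoc, mul_assoc, mul_right_inj' (C_ne_zero.mpr ha0)]
    rw [mul_right_inj' hm.ne_zero]

theorem one_add_X_pow_mul_genFun_liouville [Finite F] {s : Finset F}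
    (hs : ∀ b, b ∈ s ↔ b = 1 ∨ b = -1) :
    (1 + PowerSeries.X) ^ s.card * genFun natDegree (monicStarSymm F) liouville
      = 1 - PowerSeries.X ^ 2 := by
  have hsq : ∀ a ∈ s, a * a = 1 := fun a ha => by
    rcases (hs a).mp ha with rfl | rfl <;> ring
  have h := genFun_inter_nonvanishing (δ := natDegree) (K := monicStarSymm F) (w := liouville)
    finite_natDegree_eq (M := fun a => X - C a) (c := -1) (s := s)
    (fun a _ b => by rw [eval_sub, eval_X, eval_C, sub_eq_zero])
    (fun a ha g => X_sub_C_mul_mem_monicStarSymm_iff (hsq a ha) g)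
    (fun a _ f _ h => dvd_iff_isRoot.mpr h)
    (fun a _ g hg => by
      rw [(monic_X_sub_C a).natDegree_mul hg.1, natDegree_X_sub_C, add_comm])
    (fun a _ g hg => by
      rw [liouville_mul (X_sub_C_ne_zero a) hg.1.ne_zero,
        liouville_irreducible (irreducible_X_sub_C a)])
  rw [← palindromicCore_eq_monicStarSymm_inter hs, genFun_natDegree_liouville, map_neg, map_one,
    neg_one_mul, sub_neg_eq_add] at h
  exact h.symm

theorem Qset_eq (n : ℕ) : Qset F n = {f | f ∈ palindromicCore F ∧ f.natDegree = n} := by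
  ext f
  constructor
  · rintro ⟨hm, hs, hn, h0, h1, h2⟩
    exact ⟨mem_palindromicCore_of_recip_eq hm hs.1 (recip_eq_of_isStarSymm hs) h1 h2, hn⟩
  · rintro ⟨hf, hn⟩
    have h0 := coeff_zero_of_mem_palindromicCore hf
    exact ⟨hf.1, ⟨h0 ▸ one_ne_zero, by rw [h0, C_1, one_mul, hf.2.1]⟩, hn, h0, hf.2.2⟩

theorem PstarSet_eq (n : ℕ) : PstarSet F n = {f | f ∈ monicStarSymm F ∧ f.natDegree = n} :=
  Set.ext fun _ => and_assoc.symm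

theorem finsum_Qset_liouville [Finite F] (n : ℕ) :
    ∑ᶠ f ∈ Qset F n, liouville f = (if n = 0 then 1 else 0) - if n = 2 then 1 else 0 := by
  rw [Qset_eq, ← coeff_genFun, genFun_natDegree_liouville, map_sub, PowerSeries.coeff_one,
    PowerSeries.coeff_X_pow]

theorem finsum_PstarSet_liouville_of_even [Fintype F] (hq : Even (Fintype.card F)) (n : ℕ) :
    ∑ᶠ f ∈ PstarSet F n, liouville f = (if n = 0 then 1 else 0) - if n = 1 then 1 else 0 := by
  have hchar : ringChar F = 2 := FiniteField.even_card_iff_char_two.mpr (Nat.even_iff.mp hq)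
  have : CharP F 2 := ringChar.of_eq hchar
  have h := one_add_X_pow_mul_genFun_liouville (s := {(1 : F)})
    (fun b => by rw [Finset.mem_singleton, CharTwo.neg_eq, or_self])
  have hX : (1 + PowerSeries.X : PowerSeries ℤ) ≠ 0 := fun h => by
    simpa using congrArg (PowerSeries.coeff 0) h
  have hgen : genFun natDegree (monicStarSymm F) liouville = 1 - PowerSeries.X := by
    apply mul_left_cancel₀ hX
    rw [Finset.card_singleton, pow_one] at h
    rw [h]
    ring
  rw [PstarSet_eq, ← coeff_genFun, hgen, map_sub, PowerSeries.coeff_one, PowerSeries.coeff_X]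

theorem finsum_PstarSet_liouville_of_odd [Fintype F] (hq : Odd (Fintype.card F)) (n : ℕ) :
    ∑ᶠ f ∈ PstarSet F n, liouville f = if n = 0 then 1 else 2 * (-1) ^ n := by
  classical
  have hchar : ringChar F ≠ 2 := fun h =>
    Nat.not_even_iff_odd.mpr hq (Nat.even_iff.mpr (FiniteField.even_card_iff_char_two.mp h))
  have h := one_add_X_pow_mul_genFun_liouville (s := ({1, -1} : Finset F)) (fun b => by simp)
  rw [Finset.card_pair (Ring.neg_one_ne_one_of_char_ne_two hchar).symm] at h
  have hX : (1 + PowerSeries.X : PowerSeries ℤ) ≠ 0 := fun h => by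
    simpa using congrArg (PowerSeries.coeff 0) h
  have hgen : (1 + PowerSeries.X) * genFun natDegree (monicStarSymm F) liouville
      = 1 - PowerSeries.X := by
    apply mul_left_cancel₀ hX
    rw [← mul_assoc, ← pow_two, h]
    ring
  rw [PstarSet_eq, ← coeff_genFun]
  rw [add_mul, one_mul] at hgen
  induction n with
  | zero => simpa using congrArg (PowerSeries.coeff 0) hgen
  | succ n ih =>
    have hn := congrArg (PowerSeries.coeff (n + 1)) hgen
    rw [map_add, PowerSeries.coeff_succ_X_mul, ih, map_sub, PowerSeries.coeff_one,
      PowerSeries.coeff_X, if_neg n.succ_ne_zero] at hn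
    rw [if_neg n.succ_ne_zero, eq_sub_of_add_eq hn]
    cases n with
    | zero => simp
    | succ n =>
      rw [if_neg (by omega), if_neg (by omega), pow_succ _ (n + 1)]
      ring

end StarSymmetric

/-- **Parity of the number of irreducible factors of *-symmetric polynomials.**
`∑_{f ∈ Q(n)} λ(f)` equals `1` if `n = 0`, `-1` if `n = 2`, and `0` otherwise; and
`∑_{f ∈ P*(n)} λ(f)` equals `1` if `n = 0`, `-1` if `n = 1` and `q` even, `0` if `n > 1` and
`q` even, and `2·(-1)ⁿ` if `n ≥ 1` and `q` odd. -/
theorem stmt15 (F : Type) [Field F] [Fintype F] (q : ℕ) (hq : Fintype.card F = q) (n : ℕ) :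
    ((n = 0 → ∑ᶠ f ∈ Qset F n, liouville f = 1) ∧
     (n = 2 → ∑ᶠ f ∈ Qset F n, liouville f = -1) ∧
     (n ≠ 0 → n ≠ 2 → ∑ᶠ f ∈ Qset F n, liouville f = 0)) ∧
    ((n = 0 → ∑ᶠ f ∈ PstarSet F n, liouville f = 1) ∧
     (n = 1 → Even q → ∑ᶠ f ∈ PstarSet F n, liouville f = -1) ∧
     (1 < n → Even q → ∑ᶠ f ∈ PstarSet F n, liouville f = 0) ∧
     (1 ≤ n → Odd q → ∑ᶠ f ∈ PstarSet F n, liouville f = 2 * (-1) ^ n)) := by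
  simp only [finsum_Qset_liouville]
  subst hq
  refine ⟨⟨?_, ?_, ?_⟩, ?_, ?_, ?_, ?_⟩
  · rintro rfl
    simp
  · rintro rfl
    simp
  · intro h0 h2
    simp [h0, h2]
  · rintro rfl
    obtain hq | hq := Nat.even_or_odd (Fintype.card F)
    · simp [finsum_PstarSet_liouville_of_even hq]
    · simp [finsum_PstarSet_liouville_of_odd hq]
  · rintro rfl hq
    simp [finsum_PstarSet_liouville_of_even hq]
  · intro hn hq
    rw [finsum_PstarSet_liouville_of_even hq, if_neg (by omega), if_neg (by omega), sub_zero]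
  · intro hn hq
    rw [finsum_PstarSet_liouville_of_odd hq, if_neg (by omega)]
end

section
/- There are absolute constants c, C > 0 with the following property. Let F be a finite field with q elements, let n ≥ 2 and let k be an integer with 1 ≤ k ≤ n/(10·log n). Let a ∈ F^×, let f be a uniformly random monic polynomial of degree n over F with constant coefficient a, let I_k be the set of monic irreducible polynomials over F of degree ≤ k other than X, and let E_k be the event that f is divisible by no element of I_k. Then |P(E_k) − ∏_{g ∈ I_k} (1 − q^{−deg g})| ≤ C·e^{−c·n/k}. -/
open Polynomial

/-- The sum, over the `j`-element subsets of `I`, of the products of the weights `p`. -/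
noncomputable def subsetSum {ι : Type*} (I : Finset ι) (p : ι → ℝ) (j : ℕ) : ℝ :=
  ∑ S ∈ I.powersetCard j, ∏ g ∈ S, p g

theorem subsetSum_zero {ι : Type*} (I : Finset ι) (p : ι → ℝ) : subsetSum I p 0 = 1 := by
  simp [subsetSum]

theorem subsetSum_insert_succ {ι : Type*} [DecidableEq ι] {I : Finset ι} {g : ι} (hg : g ∉ I)
    (p : ι → ℝ) (j : ℕ) :
    subsetSum (insert g I) p (j + 1) = subsetSum I p (j + 1) + p g * subsetSum I p j := by
  unfold subsetSum
  rw [Finset.powersetCard_succ_insert hg, Finset.sum_union, Finset.sum_image, Finset.mul_sum]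
  · congr 1
    refine Finset.sum_congr rfl fun S hS ↦ Finset.prod_insert fun h ↦ hg ?_
    exact (Finset.mem_powersetCard.1 hS).1 h
  · intro S hS T hT h
    have hS' : g ∉ S := fun h ↦ hg ((Finset.mem_powersetCard.1 hS).1 h)
    have hT' : g ∉ T := fun h ↦ hg ((Finset.mem_powersetCard.1 hT).1 h)
    rw [← Finset.erase_insert hS', ← Finset.erase_insert hT', h]
  · rw [Finset.disjoint_left]
    intro S hS hS'
    obtain ⟨T, -, rfl⟩ := Finset.mem_image.1 hS'
    exact hg ((Finset.mem_powersetCard.1 hS).1 (Finset.mem_insert_self _ _))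

/-- A weighted form of the Bonferroni inequalities. -/
theorem abs_prod_one_sub_sub_le {ι : Type*} (I : Finset ι) (p : ι → ℝ)
    (h0 : ∀ g, 0 ≤ p g) (h1 : ∀ g ∈ I, p g ≤ 1) (r : ℕ) :
    |∏ g ∈ I, (1 - p g) - ∑ j ∈ Finset.range r, (-1) ^ j * subsetSum I p j| ≤
      subsetSum I p r := by
  classical
  induction I using Finset.induction_on generalizing r with
  | empty =>
    cases r with
    | zero => simp [subsetSum]
    | succ r =>
      have h (j : ℕ) : subsetSum ∅ p (j + 1) = 0 := by
        rw [subsetSum, Finset.powersetCard_eq_empty.2 (by simp), Finset.sum_empty]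
      simp [Finset.sum_range_succ', h, subsetSum_zero]
  | insert g I hg ih =>
    have ih' := ih fun g hg ↦ h1 g (Finset.mem_insert_of_mem hg)
    cases r with
    | zero =>
      have h2 : ∀ x ∈ insert g I, 0 ≤ 1 - p x := fun x hx ↦ by linarith [h1 x hx]
      rw [Finset.sum_range_zero, sub_zero, subsetSum_zero,
        abs_of_nonneg (Finset.prod_nonneg h2)]
      exact Finset.prod_le_one h2 fun x _ ↦ by linarith [h0 x]
    | succ r =>
      have key : ∏ x ∈ insert g I, (1 - p x)
            - ∑ j ∈ Finset.range (r + 1), (-1) ^ j * subsetSum (insert g I) p j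
          = (∏ x ∈ I, (1 - p x) - ∑ j ∈ Finset.range (r + 1), (-1) ^ j * subsetSum I p j)
            - p g * (∏ x ∈ I, (1 - p x)
              - ∑ j ∈ Finset.range r, (-1) ^ j * subsetSum I p j) := by
        have h : ∑ j ∈ Finset.range r, (-1) ^ (j + 1) * subsetSum (insert g I) p (j + 1)
            = ∑ j ∈ Finset.range r, (-1) ^ (j + 1) * subsetSum I p (j + 1)
              - p g * ∑ j ∈ Finset.range r, (-1) ^ j * subsetSum I p j := by
          rw [Finset.mul_sum, ← Finset.sum_sub_distrib]
          refine Finset.sum_congr rfl fun j _ ↦ ?_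
          rw [subsetSum_insert_succ hg]
          ring
        rw [Finset.prod_insert hg, Finset.sum_range_succ', Finset.sum_range_succ', h,
          subsetSum_zero, subsetSum_zero]
        ring
      rw [key, subsetSum_insert_succ hg]
      refine (abs_sub _ _).trans (add_le_add (ih' _) ?_)
      rw [abs_mul, abs_of_nonneg (h0 g)]
      exact mul_le_mul_of_nonneg_left (ih' _) (h0 g)

theorem subsetSum_le_exp {ι : Type*} (I : Finset ι) (p : ι → ℝ) (h0 : ∀ g, 0 ≤ p g) (r : ℕ) :
    subsetSum I p r ≤ Real.exp (Real.exp 1 * ∑ g ∈ I, p g - r) := by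
  have h : Real.exp 1 ^ r * subsetSum I p r ≤ ∏ g ∈ I, (1 + Real.exp 1 * p g) := by
    rw [Finset.prod_one_add, subsetSum, Finset.mul_sum]
    calc ∑ S ∈ I.powersetCard r, Real.exp 1 ^ r * ∏ g ∈ S, p g
        = ∑ S ∈ I.powersetCard r, ∏ g ∈ S, Real.exp 1 * p g := by
          refine Finset.sum_congr rfl fun S hS ↦ ?_
          rw [Finset.prod_mul_distrib, Finset.prod_const, (Finset.mem_powersetCard.1 hS).2]
      _ ≤ _ := Finset.sum_le_sum_of_subset_of_nonneg
          (fun S hS ↦ Finset.mem_powerset.2 (Finset.mem_powersetCard.1 hS).1)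
          fun S _ _ ↦ Finset.prod_nonneg fun g _ ↦ mul_nonneg (Real.exp_pos _).le (h0 g)
  have h2 : ∏ g ∈ I, (1 + Real.exp 1 * p g) ≤ Real.exp (Real.exp 1 * ∑ g ∈ I, p g) := by
    rw [Finset.mul_sum]
    exact Real.prod_one_add_le_exp_sum I fun g ↦ mul_nonneg (Real.exp_pos 1).le (h0 g)
  rw [Real.exp_sub, le_div_iff₀ (Real.exp_pos _), mul_comm]
  rw [← Real.exp_nat_mul, mul_one] at h
  exact h.trans h2

/-- The monic polynomials of degree `n` with constant coefficient `a`. -/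
def monicsWithConst (F : Type*) [Field F] (n : ℕ) (a : F) : Set F[X] :=
  {f | f.Monic ∧ f.natDegree = n ∧ f.coeff 0 = a}

theorem ncard_monicsWithConst (F : Type*) [Field F] [Fintype F] (m : ℕ) (a : F) :
    (monicsWithConst F (m + 1) a).ncard = Fintype.card F ^ m := by
  have hcard : Nat.card (degreeLT F m) = Fintype.card F ^ m := by
    rw [Nat.card_congr (degreeLTEquiv F m).toEquiv]
    simp
  rw [← hcard, ← Nat.card_coe_set_eq]
  symm
  refine Nat.card_congr (Equiv.ofBijective (fun h ↦ ⟨X * (X ^ m + (h : F[X])) + C a, ?_⟩) ⟨?_, ?_⟩)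
  · have hd := mem_degreeLT.1 h.2
    have hm : (X ^ m + (h : F[X])).Monic := monic_X_pow_add hd
    have hn : (X ^ m + (h : F[X])).natDegree = m := by
      rw [natDegree_eq_of_degree_eq_some]
      rw [degree_add_eq_left_of_degree_lt] <;> simp [hd]
    have hn' : (X * (X ^ m + (h : F[X]))).natDegree = m + 1 := by
      rw [natDegree_X_mul hm.ne_zero, hn]
    have hlt : (C a).degree < (X * (X ^ m + (h : F[X]))).degree := by
      rw [degree_eq_natDegree (mul_ne_zero X_ne_zero hm.ne_zero), hn']
      exact degree_C_le.trans_lt (by exact_mod_cast Nat.succ_pos m)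
    refine ⟨(monic_X.mul hm).add_of_left hlt, ?_, by simp⟩
    rw [natDegree_add_C, hn']
  · intro h h' e
    have e' := Subtype.ext_iff.1 e
    simp only [add_left_inj, mul_eq_mul_left_iff, X_ne_zero, or_false, add_right_inj] at e'
    exact Subtype.ext e'
  · rintro ⟨f, hf, hn, rfl⟩
    have hdeg : f.divX.natDegree = m := by rw [natDegree_divX_eq_natDegree_tsub_one, hn]; rfl
    have hmon : f.divX.Monic := by
      rw [Monic, leadingCoeff, hdeg, coeff_divX, ← hn]; exact hf
    refine ⟨⟨f.divX - X ^ m, mem_degreeLT.2 ?_⟩, ?_⟩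
    · have hlt := degree_sub_lt_left (p := f.divX) (q := X ^ m)
        (by rw [degree_eq_natDegree hmon.ne_zero, hdeg, degree_X_pow]) hmon.ne_zero
        (by rw [hmon.leadingCoeff, leadingCoeff_X_pow])
      rwa [degree_eq_natDegree hmon.ne_zero, hdeg] at hlt
    · refine Subtype.ext ?_
      simp only [add_sub_cancel]
      exact X_mul_divX_add f

theorem ncard_monicsWithConst_dvd {F : Type*} [Field F] {D : F[X]} (hD : D.Monic)
    (hD0 : D.coeff 0 ≠ 0) (m : ℕ) (a : F) :
    {f ∈ monicsWithConst F (D.natDegree + m) a | D ∣ f}.ncard =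
      (monicsWithConst F m (a / D.coeff 0)).ncard := by
  rw [← Set.ncard_image_of_injective (monicsWithConst F m (a / D.coeff 0))
    (mul_right_injective₀ hD.ne_zero)]
  congr 1
  ext f
  constructor
  · rintro ⟨⟨hf, hn, h0⟩, h, rfl⟩
    have hh : h.Monic := hD.of_mul_monic_left hf
    rw [hD.natDegree_mul hh] at hn
    refine ⟨h, ⟨hh, by omega, ?_⟩, rfl⟩
    rw [eq_div_iff hD0, ← h0, mul_coeff_zero, mul_comm]
  · rintro ⟨h, ⟨hh, hn, h0⟩, rfl⟩
    refine ⟨⟨hD.mul hh, ?_, ?_⟩, dvd_mul_right _ _⟩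
    · rw [hD.natDegree_mul hh, hn]
    · rw [mul_coeff_zero, h0, mul_div_cancel₀ _ hD0]

theorem finite_natDegree_le (F : Type*) [Field F] [Fintype F] (n : ℕ) :
    {f : F[X] | f.natDegree ≤ n}.Finite := by
  have : Finite (degreeLT F (n + 1)) := Finite.of_equiv _ (degreeLTEquiv F (n + 1)).toEquiv.symm
  refine (Set.toFinite (degreeLT F (n + 1) : Set F[X])).subset fun f hf ↦ ?_
  rw [SetLike.mem_coe, mem_degreeLT]
  exact degree_le_natDegree.trans_lt (by exact_mod_cast Nat.lt_succ_of_le hf)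

theorem isCoprime_of_monic_irreducible {F : Type*} [Field F] {g h : F[X]} (hg : g.Monic)
    (hgi : Irreducible g) (hh : h.Monic) (hhi : Irreducible h) (hne : g ≠ h) : IsCoprime g h :=
  hgi.coprime_iff_not_dvd.2 fun hd ↦
    hne (eq_of_monic_of_associated hg hh (hgi.associated_of_dvd hhi hd))

theorem prod_dvd_iff_of_monic_irreducible {F : Type*} [Field F] {S : Finset F[X]}
    (hS : ∀ g ∈ S, g.Monic ∧ Irreducible g) (f : F[X]) : ∏ g ∈ S, g ∣ f ↔ ∀ g ∈ S, g ∣ f :=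
  ⟨fun h _ hg ↦ (Finset.dvd_prod_of_mem _ hg).trans h,
    Finset.prod_dvd_of_coprime fun _ hg _ hh hne ↦ isCoprime_of_monic_irreducible
      (hS _ hg).1 (hS _ hg).2 (hS _ hh).1 (hS _ hh).2 hne⟩

theorem card_mul_le_of_monic_irreducible {F : Type*} [Field F] [Fintype F] {d : ℕ} (hd : d ≠ 0)
    {S : Finset F[X]} (hS : ∀ g ∈ S, g.Monic ∧ Irreducible g) (hSd : ∀ g ∈ S, g.natDegree = d) :
    S.card * d ≤ Fintype.card F ^ d := by
  have h1 : 1 < Fintype.card F ^ d := Nat.one_lt_pow hd Fintype.one_lt_card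
  have hdvd : ∏ g ∈ S, g ∣ X ^ (Fintype.card F ^ d) - X := by
    refine (prod_dvd_iff_of_monic_irreducible hS _).2 fun g hg ↦ ?_
    rw [← Nat.card_eq_fintype_card]
    exact (hS g hg).2.natDegree_dvd_iff_dvd_X_pow_card_pow_sub_X.1 (hSd g hg).dvd
  have h2 := natDegree_le_of_dvd hdvd (FiniteField.X_pow_card_sub_X_ne_zero F h1)
  rwa [FiniteField.X_pow_card_sub_X_natDegree_eq F h1,
    natDegree_prod_of_monic _ _ fun g hg ↦ (hS g hg).1, Finset.sum_congr rfl hSd,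
    Finset.sum_const, smul_eq_mul] at h2

theorem sum_inv_pow_natDegree_le {F : Type*} [Field F] [Fintype F] {k : ℕ}
    {I : Finset F[X]} (hI : ∀ g ∈ I, g.Monic ∧ Irreducible g) (hk : ∀ g ∈ I, g.natDegree ≤ k) :
    ∑ g ∈ I, ((Fintype.card F : ℝ) ^ g.natDegree)⁻¹ ≤ 1 + Real.log k := by
  classical
  have hq : (0 : ℝ) < Fintype.card F := by exact_mod_cast Fintype.card_pos
  refine le_trans ?_ (harmonic_le_one_add_log k)
  rw [harmonic_eq_sum_Icc, Rat.cast_sum, ← Finset.sum_fiberwise_of_maps_to (g := natDegree)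
    (t := Finset.Icc 1 k) fun g hg ↦ Finset.mem_Icc.2 ⟨(hI g hg).2.natDegree_pos, hk g hg⟩]
  refine Finset.sum_le_sum fun d hd ↦ ?_
  have hd1 := (Finset.mem_Icc.1 hd).1
  have hd0 : (0 : ℝ) < d := by exact_mod_cast hd1
  have hc := card_mul_le_of_monic_irreducible (S := I.filter fun g ↦ g.natDegree = d)
    (by omega : d ≠ 0) (fun g hg ↦ hI g (Finset.mem_filter.1 hg).1)
    fun g hg ↦ (Finset.mem_filter.1 hg).2
  rw [Finset.sum_congr rfl fun g hg ↦ by rw [(Finset.mem_filter.1 hg).2], Finset.sum_const,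
    nsmul_eq_mul]
  push_cast
  rw [← div_eq_mul_inv, div_le_iff₀ (by positivity), inv_mul_eq_div, le_div_iff₀ hd0]
  exact_mod_cast hc

/-- If `r * k < n`, the probability that `f` has no irreducible factor in `I` differs from the
expected Euler product by at most twice the `r`-th Bonferroni term. -/
theorem abs_sieve_sub_prod_le (F : Type*) [Field F] [Fintype F] (n k r : ℕ) (a : F)
    (hr : r * k < n) (I : Finset F[X])
    (hI : ∀ g, g ∈ I ↔ g.Monic ∧ Irreducible g ∧ g.natDegree ≤ k ∧ g ≠ X) :
    |(({f ∈ monicsWithConst F n a | ∀ g ∈ I, ¬ g ∣ f}.ncard : ℝ) /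
          ((monicsWithConst F n a).ncard : ℝ)) -
        ∏ g ∈ I, (1 - ((Fintype.card F : ℝ) ^ g.natDegree)⁻¹)| ≤
      2 * subsetSum I (fun g ↦ ((Fintype.card F : ℝ) ^ g.natDegree)⁻¹) r := by
  classical
  have hq1 : (1 : ℝ) ≤ Fintype.card F := by exact_mod_cast Fintype.card_pos
  have hfin : (monicsWithConst F n a).Finite :=
    (finite_natDegree_le F n).subset fun f hf ↦ hf.2.1.le
  set Ω := hfin.toFinset with hΩ
  have hΩc : (Ω.card : ℝ) = (Fintype.card F : ℝ) ^ (n - 1) := by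
    rw [hΩ, ← Set.ncard_eq_toFinset_card _ hfin]
    obtain ⟨m, rfl⟩ : ∃ m, n = m + 1 := ⟨n - 1, by omega⟩
    rw [ncard_monicsWithConst]
    simp
  have hΩpos : (0 : ℝ) < Ω.card := by rw [hΩc]; positivity
  set p : F[X] → ℝ := fun g ↦ ((Fintype.card F : ℝ) ^ g.natDegree)⁻¹ with hp
  let χ : F[X] → F[X] → ℝ := fun f g ↦ if g ∣ f then 1 else 0
  have hevent : (({f ∈ monicsWithConst F n a | ∀ g ∈ I, ¬ g ∣ f}.ncard : ℝ))
      = ∑ f ∈ Ω, ∏ g ∈ I, (1 - χ f g) := by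
    have : {f ∈ monicsWithConst F n a | ∀ g ∈ I, ¬ g ∣ f}
        = (Ω.filter fun f ↦ ∀ g ∈ I, ¬ g ∣ f : Finset F[X]) := by
      ext f; simp [hΩ]
    rw [this, Set.ncard_coe_finset, Finset.card_filter, Nat.cast_sum]
    refine Finset.sum_congr rfl fun f _ ↦ ?_
    split_ifs with h
    · rw [Finset.prod_congr rfl fun g hg ↦ by rw [show χ f g = 0 from if_neg (h g hg)]]
      simp
    · push Not at h
      obtain ⟨g, hg, hgf⟩ := h
      rw [Finset.prod_eq_zero hg (by simp [χ, hgf]), Nat.cast_zero]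
  have hmoment : ∀ j ≤ r, ∑ f ∈ Ω, subsetSum I (χ f) j = Ω.card * subsetSum I p j := by
    intro j hj
    unfold subsetSum
    rw [Finset.sum_comm, Finset.mul_sum]
    refine Finset.sum_congr rfl fun S hS ↦ ?_
    obtain ⟨hSI, hSc⟩ := Finset.mem_powersetCard.1 hS
    have hSi : ∀ g ∈ S, g.Monic ∧ Irreducible g := fun g hg ↦
      ⟨((hI g).1 (hSI hg)).1, ((hI g).1 (hSI hg)).2.1⟩
    have hD : (∏ g ∈ S, g).Monic := monic_prod_of_monic _ _ fun g hg ↦ (hSi g hg).1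
    have hD0 : (∏ g ∈ S, g).coeff 0 ≠ 0 := by
      rw [coeff_zero_prod, Finset.prod_ne_zero_iff]
      intro g hg h
      refine ((hI g).1 (hSI hg)).2.2.2 ?_
      exact (eq_of_monic_of_associated monic_X (hSi g hg).1
        (irreducible_X.associated_of_dvd (hSi g hg).2 (X_dvd_iff.2 h))).symm
    have hdeg : (∏ g ∈ S, g).natDegree = ∑ g ∈ S, g.natDegree :=
      natDegree_prod_of_monic _ _ fun g hg ↦ (hSi g hg).1
    have hlt : (∏ g ∈ S, g).natDegree < n := by
      rw [hdeg]
      calc ∑ g ∈ S, g.natDegree ≤ S.card • k :=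
            Finset.sum_le_card_nsmul _ _ _ fun g hg ↦ ((hI g).1 (hSI hg)).2.2.1
        _ ≤ r * k := by rw [smul_eq_mul, hSc]; exact Nat.mul_le_mul_right _ hj
        _ < n := hr
    have hcount : ∑ f ∈ Ω, ∏ g ∈ S, χ f g
        = ({f ∈ monicsWithConst F n a | (∏ g ∈ S, g) ∣ f}.ncard : ℝ) := by
      have : {f ∈ monicsWithConst F n a | (∏ g ∈ S, g) ∣ f}
          = (Ω.filter fun f ↦ (∏ g ∈ S, g) ∣ f : Finset F[X]) := by
        ext f; simp [hΩ]
      rw [this, Set.ncard_coe_finset, Finset.card_filter, Nat.cast_sum]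
      refine Finset.sum_congr rfl fun f _ ↦ ?_
      split_ifs with h
      · rw [prod_dvd_iff_of_monic_irreducible hSi] at h
        rw [Nat.cast_one]
        exact Finset.prod_eq_one fun g hg ↦ if_pos (h g hg)
      · rw [prod_dvd_iff_of_monic_irreducible hSi] at h
        push Not at h
        obtain ⟨g, hg, hgf⟩ := h
        rw [Finset.prod_eq_zero hg (if_neg hgf), Nat.cast_zero]
    obtain ⟨m, hm⟩ : ∃ m, n = (∏ g ∈ S, g).natDegree + (m + 1) :=
      ⟨n - (∏ g ∈ S, g).natDegree - 1, by omega⟩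
    have hc := ncard_monicsWithConst_dvd hD hD0 (m + 1) a
    rw [← hm, ncard_monicsWithConst] at hc
    rw [hcount, hc, hΩc, hp, Finset.prod_inv_distrib, Finset.prod_pow_eq_pow_sum, ← hdeg,
      ← div_eq_mul_inv, eq_div_iff (by positivity), Nat.cast_pow, ← pow_add]
    congr 1
    omega
  have hA : |∑ f ∈ Ω, ∏ g ∈ I, (1 - χ f g)
      - Ω.card * ∑ j ∈ Finset.range r, (-1) ^ j * subsetSum I p j|
      ≤ Ω.card * subsetSum I p r := by
    have h1 : Ω.card * ∑ j ∈ Finset.range r, (-1) ^ j * subsetSum I p j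
        = ∑ f ∈ Ω, ∑ j ∈ Finset.range r, (-1) ^ j * subsetSum I (χ f) j := by
      rw [Finset.sum_comm, Finset.mul_sum]
      refine Finset.sum_congr rfl fun j hj ↦ ?_
      rw [← Finset.mul_sum, hmoment j (Finset.mem_range.1 hj).le]
      ring
    rw [h1, ← Finset.sum_sub_distrib, ← hmoment r le_rfl]
    refine (Finset.abs_sum_le_sum_abs _ _).trans (Finset.sum_le_sum fun f _ ↦ ?_)
    refine abs_prod_one_sub_sub_le I (χ f) (fun g ↦ ?_) (fun g _ ↦ ?_) r
    · simp only [χ]; split_ifs <;> norm_num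
    · simp only [χ]; split_ifs <;> norm_num
  have hB := abs_prod_one_sub_sub_le I p (fun g ↦ by positivity)
    (fun g _ ↦ inv_le_one_of_one_le₀ (one_le_pow₀ hq1)) r
  have hA' : |(∑ f ∈ Ω, ∏ g ∈ I, (1 - χ f g)) / Ω.card
      - ∑ j ∈ Finset.range r, (-1) ^ j * subsetSum I p j| ≤ subsetSum I p r := by
    rw [div_sub' hΩpos.ne', abs_div, abs_of_pos hΩpos, div_le_iff₀ hΩpos, mul_comm _ (Ω.card : ℝ)]
    exact hA
  rw [hevent, Set.ncard_eq_toFinset_card _ hfin]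
  rw [abs_sub_comm] at hB
  refine (abs_sub_le _ (∑ j ∈ Finset.range r, (-1) ^ j * subsetSum I p j) _).trans ?_
  linarith

/-- **Polynomials without low-degree factors (Brun–Hooley-type sieve bound).**
Let `f` be a uniformly random monic polynomial of degree `n` over a finite field with `q`
elements with constant coefficient `a ≠ 0`, let `I_k` be the set of monic irreducible
polynomials of degree `≤ k` other than `X` (where `1 ≤ k ≤ n/(10 log n)`), and let `E_k` be
the event that `f` has no factor in `I_k`.  Then
`|P(E_k) - ∏_{g ∈ I_k} (1 - q^{-deg g})| ≤ C e^{-c n/k}`. -/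
theorem stmt16 : ∃ c : ℝ, 0 < c ∧ ∃ C : ℝ, 0 < C ∧
    ∀ (F : Type) [Field F] [Fintype F], ∀ (q n k : ℕ) (a : F),
      Fintype.card F = q → 2 ≤ n → 1 ≤ k → (k : ℝ) ≤ (n : ℝ) / (10 * Real.log n) → a ≠ 0 →
      |(({f : F[X] | f.Monic ∧ f.natDegree = n ∧ f.coeff 0 = a ∧
            ∀ g : F[X], g.Monic → Irreducible g → g.natDegree ≤ k → g ≠ Polynomial.X →
              ¬ g ∣ f}.ncard : ℝ) /
          ({f : F[X] | f.Monic ∧ f.natDegree = n ∧ f.coeff 0 = a}.ncard : ℝ)) -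
        ∏ᶠ g ∈ {g : F[X] | g.Monic ∧ Irreducible g ∧ g.natDegree ≤ k ∧ g ≠ Polynomial.X},
          (1 - ((q : ℝ) ^ g.natDegree)⁻¹)| ≤ C * Real.exp (-c * n / k) := by
  refine ⟨1 / 2, by norm_num, 2 * Real.exp 1, by positivity, ?_⟩
  rintro F _ _ _ n k a rfl hn hk hkn -
  have hIfin : {g : F[X] | g.Monic ∧ Irreducible g ∧ g.natDegree ≤ k ∧ g ≠ X}.Finite :=
    (finite_natDegree_le F k).subset fun g hg ↦ hg.2.2.1
  have hI : ∀ g, g ∈ hIfin.toFinset ↔ g.Monic ∧ Irreducible g ∧ g.natDegree ≤ k ∧ g ≠ X :=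
    fun g ↦ hIfin.mem_toFinset
  set I := hIfin.toFinset
  have hE : {f : F[X] | f.Monic ∧ f.natDegree = n ∧ f.coeff 0 = a ∧
      ∀ g : F[X], g.Monic → Irreducible g → g.natDegree ≤ k → g ≠ X → ¬ g ∣ f}
      = {f ∈ monicsWithConst F n a | ∀ g ∈ I, ¬ g ∣ f} := by
    ext f
    simp only [monicsWithConst, Set.mem_ofPred_eq, hI, and_imp, and_assoc]
  have hr : (n - 1) / k * k < n := by
    have := Nat.div_mul_le_self (n - 1) k
    omega
  have hmain := abs_sieve_sub_prod_le F n k ((n - 1) / k) a hr I hI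
  rw [hE, finprod_mem_eq_finite_toFinset_prod _ hIfin]
  refine hmain.trans ?_
  have hk0 : (0 : ℝ) < k := by exact_mod_cast hk
  have hn0 : (0 : ℝ) < n := by exact_mod_cast (by omega : 0 < n)
  have hsum := sum_inv_pow_natDegree_le (fun g hg ↦ ⟨((hI g).1 hg).1, ((hI g).1 hg).2.1⟩)
    fun g hg ↦ ((hI g).1 hg).2.2.1
  have hlog2 : Real.log 2 ≤ Real.log n :=
    Real.log_le_log (by norm_num) (by exact_mod_cast hn)
  have hL : Real.exp 1 ≤ 10 * Real.log n := by
    linarith [Real.log_two_gt_d9, Real.exp_one_lt_d9]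
  have hL0 : 0 < 10 * Real.log n := (Real.exp_pos 1).trans_le hL
  have hlogk : 1 + Real.log k ≤ Real.log n := by
    have h1 : (k : ℝ) * Real.exp 1 ≤ n := by
      rw [le_div_iff₀ hL0] at hkn
      exact (mul_le_mul_of_nonneg_left hL hk0.le).trans hkn
    have h2 := Real.log_le_log (by positivity) h1
    rw [Real.log_mul hk0.ne' (Real.exp_pos 1).ne', Real.log_exp] at h2
    linarith
  have hu : 10 * Real.log n ≤ n / k := by
    rw [le_div_iff₀ hk0]
    rw [le_div_iff₀ hL0] at hkn
    linarith
  have hr' : (n : ℝ) / k - 1 ≤ ((n - 1) / k : ℕ) := by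
    rw [sub_le_iff_le_add, div_le_iff₀ hk0]
    have h := Nat.lt_div_mul_add (a := n - 1) (b := k) (by omega)
    have h' : n ≤ ((n - 1) / k + 1) * k := by rw [add_mul]; omega
    exact_mod_cast h'
  rw [mul_assoc, ← Real.exp_add]
  refine mul_le_mul_of_nonneg_left ((subsetSum_le_exp I _ (fun g ↦ by positivity) _).trans
    (Real.exp_le_exp.2 ?_)) (by norm_num)
  have h3 : Real.exp 1 * ∑ g ∈ I, ((Fintype.card F : ℝ) ^ g.natDegree)⁻¹ ≤ 5 * Real.log n :=
    mul_le_mul (by linarith [Real.exp_one_lt_d9]) (hsum.trans hlogk)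
      (Finset.sum_nonneg fun g _ ↦ by positivity) (by norm_num)
  have h4 : -(1 / 2) * (n : ℝ) / k = -(1 / 2) * (n / k) := by ring
  rw [h4]
  linarith
end

section
/- Let F be a finite field, let n ≥ 2, and assume (n, |F|) is not (2, 2) or (2, 3). Let A, B ∈ GL_n(F) be semisimple matrices, i.e., matrices whose minimal polynomial over F is squarefree (equivalently, which are diagonalizable over an algebraic closure of F). Then A and B have the same characteristic polynomial if and only if there exists S ∈ SL_n(F) (a matrix of determinant 1) with B = S·A·S⁻¹. -/
open Polynomial

namespace SemisimpleConj

section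

variable {F : Type*} [Field F]

/-- An irreducible factor `p` of the characteristic polynomial of `f` makes `p(f)` singular. -/
lemma exists_aeval_apply_eq_zero {V : Type*} [AddCommGroup V] [Module F V]
    [FiniteDimensional F V] (f : Module.End F V) {p : F[X]} (hp : Irreducible p)
    (hpf : p ∣ f.charpoly) : ∃ v : V, v ≠ 0 ∧ aeval f p v = 0 := by
  have : Fact (Irreducible p) := ⟨hp⟩
  by_contra! hinj
  have hunit : IsUnit (aeval f p) := by
    rw [LinearMap.isUnit_iff_ker_eq_bot, LinearMap.ker_eq_bot']
    intro v hv
    by_contra h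
    exact hinj v h hv
  have hunit' := hunit.map (Module.End.baseChangeHom F (AdjoinRoot p) V)
  rw [← Polynomial.aeval_algHom_apply, ← Polynomial.aeval_map_algebraMap (AdjoinRoot p)] at hunit'
  have hroot : Module.End.HasEigenvalue
      (Module.End.baseChangeHom F (AdjoinRoot p) V f) (AdjoinRoot.root p) := by
    rw [Module.End.hasEigenvalue_iff_isRoot_charpoly]
    change IsRoot (f.baseChange (AdjoinRoot p)).charpoly _
    rw [LinearMap.charpoly_baseChange]
    exact (AdjoinRoot.isRoot_root p).dvd (Polynomial.map_dvd _ hpf)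
  obtain ⟨x, hx⟩ := hroot.exists_hasEigenvector
  refine hx.2 ((LinearMap.ker_eq_bot'.mp ((LinearMap.isUnit_iff_ker_eq_bot _).mp hunit')) x ?_)
  rw [Module.End.aeval_apply_of_hasEigenvector hx, show eval (AdjoinRoot.root p)
    (p.map (algebraMap F (AdjoinRoot p))) = 0 from AdjoinRoot.isRoot_root p, zero_smul]

/-- The cyclic subspace generated by a nonzero vector killed by `p(f)`, `p` irreducible, is
isomorphic to `F[X] / (p)`, with `f` acting as multiplication by the root. -/
lemma exists_adjoinRoot_equiv {V : Type*} [AddCommGroup V] [Module F V]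
    (f : Module.End F V) {p : F[X]} (hp : Irreducible p) {v : V} (hv : v ≠ 0)
    (hpv : aeval f p v = 0) :
    ∃ (R : Submodule F V) (e : AdjoinRoot p ≃ₗ[F] R),
      ∀ x, (e (AdjoinRoot.root p * x) : V) = f (e x) := by
  let ψ : F[X] →ₗ[F] V := (LinearMap.applyₗ v) ∘ₗ (aeval f).toLinearMap
  have hψ (q : F[X]) : ψ q = aeval f q v := rfl
  let m : F[X] →ₗ[F] AdjoinRoot p := (AdjoinRoot.mkₐ p).toLinearMap
  have hm (q : F[X]) : m q = AdjoinRoot.mk p q := rfl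
  have hsurj : Function.Surjective m := AdjoinRoot.mk_surjective
  have hker : LinearMap.ker m = LinearMap.ker ψ := by
    ext q
    rw [LinearMap.mem_ker, LinearMap.mem_ker, hm, AdjoinRoot.mk_eq_zero, hψ]
    constructor
    · rintro ⟨r, rfl⟩
      rw [mul_comm, map_mul, Module.End.mul_apply, hpv, map_zero]
    · intro hq
      by_contra hpq
      obtain ⟨a, b, hab⟩ := (hp.coprime_iff_not_dvd).mpr hpq
      apply hv
      have := congrArg (fun r => aeval f r v) hab
      simpa [hpv, hq] using this.symm
  let e : AdjoinRoot p ≃ₗ[F] LinearMap.range ψ :=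
    (m.quotKerEquivOfSurjective hsurj).symm.trans
      ((Submodule.quotEquivOfEq _ _ hker).trans ψ.quotKerEquivRange)
  have he (q : F[X]) : (e (AdjoinRoot.mk p q) : V) = aeval f q v := by
    have h : (m.quotKerEquivOfSurjective hsurj).symm (AdjoinRoot.mk p q) =
        Submodule.Quotient.mk q := by
      rw [LinearEquiv.symm_apply_eq]
      rfl
    simp only [e, LinearEquiv.trans_apply, h]
    rfl
  refine ⟨_, e, fun x => ?_⟩
  obtain ⟨q, rfl⟩ := AdjoinRoot.mk_surjective x
  rw [← AdjoinRoot.mk_X, ← map_mul, he, he, map_mul, aeval_X, Module.End.mul_apply]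

/-- A semisimple endomorphism splits off a block `F[X] / (p)` for each irreducible factor `p` of
its characteristic polynomial. -/
lemma exists_split {V : Type*} [AddCommGroup V] [Module F V]
    [FiniteDimensional F V] {f : Module.End F V} (hf : f.IsSemisimple) {p : F[X]}
    (hp : Irreducible p) (hpf : p ∣ f.charpoly) :
    ∃ (W : Submodule F V) (g : Module.End F W) (e : V ≃ₗ[F] AdjoinRoot p × W),
      g.IsSemisimple ∧
        e.conj f = (LinearMap.mulLeft F (AdjoinRoot.root p)).prodMap g := by
  obtain ⟨v, hv, hpv⟩ := exists_aeval_apply_eq_zero f hp hpf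
  obtain ⟨R, e, he⟩ := exists_adjoinRoot_equiv f hp hv hpv
  have hR : R ∈ f.invtSubmodule := by
    rw [Module.End.mem_invtSubmodule]
    intro x hx
    have := he (e.symm ⟨x, hx⟩)
    rw [LinearEquiv.apply_symm_apply] at this
    rw [Submodule.mem_comap, ← this]
    exact Subtype.property _
  obtain ⟨W, hW, hc⟩ := Module.End.isSemisimple_iff.mp hf R hR
  let E : (AdjoinRoot p × W) ≃ₗ[F] V :=
    (e.prodCongr (LinearEquiv.refl F W)).trans (R.prodEquivOfIsCompl W hc)
  have hE (x : AdjoinRoot p × W) : E x = e x.1 + x.2 := rfl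
  refine ⟨W, f.restrict hW, E.symm, hf.restrict hW, ?_⟩
  refine LinearMap.ext fun x => ?_
  rw [LinearEquiv.conj_apply_apply, LinearEquiv.symm_symm, LinearEquiv.symm_apply_eq, hE, hE,
    map_add]
  simp only [LinearMap.prodMap_apply, LinearMap.mulLeft_apply, he]
  rfl

/-- Semisimple endomorphisms with the same characteristic polynomial are conjugate. -/
lemma exists_equiv_of_charpoly_eq (k : ℕ) : ∀ {V V' : Type*} [AddCommGroup V] [Module F V]
    [FiniteDimensional F V] [AddCommGroup V'] [Module F V'] [FiniteDimensional F V']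
    {f : Module.End F V} {f' : Module.End F V'}, Module.finrank F V ≤ k →
    f.IsSemisimple → f'.IsSemisimple → f.charpoly = f'.charpoly →
    ∃ e : V ≃ₗ[F] V', e.conj f = f' := by
  induction k with
  | zero =>
    intro V V' _ _ _ _ _ _ f f' hk _ _ hc
    have h0 : Module.finrank F V = 0 := by omega
    have h0' : Module.finrank F V' = 0 := by
      rw [← f'.charpoly_natDegree, ← hc, f.charpoly_natDegree, h0]
    have := Module.finrank_zero_iff.mp h0'
    exact ⟨LinearEquiv.ofFinrankEq V V' (h0.trans h0'.symm),
      LinearMap.ext fun x => Subsingleton.elim _ _⟩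
  | succ k ih =>
    intro V V' _ _ _ _ _ _ f f' hk hf hf' hc
    by_cases h : Module.finrank F V = 0
    · exact ih (by omega) hf hf' hc
    obtain ⟨p, hp, hpf⟩ := exists_irreducible_of_natDegree_ne_zero
      (f := f.charpoly) (by rwa [f.charpoly_natDegree])
    have : Fact (Irreducible p) := ⟨hp⟩
    have : FiniteDimensional F (AdjoinRoot p) := (AdjoinRoot.powerBasis hp.ne_zero).finite
    obtain ⟨W, g, e, hg, he⟩ := exists_split hf hp hpf
    obtain ⟨W', g', e', hg', he'⟩ := exists_split hf' hp (hc ▸ hpf)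
    have hgg : g.charpoly = g'.charpoly := by
      rw [← e.charpoly_conj, ← e'.charpoly_conj, he, he', LinearMap.charpoly_prodMap,
        LinearMap.charpoly_prodMap] at hc
      exact mul_left_cancel₀ (LinearMap.charpoly_monic _).ne_zero hc
    have hdim := e.finrank_eq
    rw [Module.finrank_prod] at hdim
    have hpos : 0 < Module.finrank F (AdjoinRoot p) := Module.finrank_pos
    obtain ⟨c, hcg⟩ := ih (by omega) hg hg' hgg
    refine ⟨e.trans (((LinearEquiv.refl F _).prodCongr c).trans e'.symm), ?_⟩
    apply e'.conj.injective
    rw [he', ← hcg]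
    refine LinearMap.ext fun x => ?_
    have hx := LinearMap.congr_fun he (((LinearEquiv.refl F _).prodCongr c).symm x)
    rw [LinearEquiv.conj_apply_apply] at hx
    simp only [LinearEquiv.conj_apply_apply, LinearEquiv.trans_apply, LinearEquiv.symm_trans_apply,
      LinearEquiv.symm_symm, LinearEquiv.apply_symm_apply, hx]
    ext <;> simp [LinearEquiv.conj_apply_apply]

/-- Over a finite field, the determinant is surjective on the centralizer of a semisimple
endomorphism. -/
lemma exists_commute_det_eq [Finite F] {V : Type*} [AddCommGroup V] [Module F V]
    [FiniteDimensional F V] [Nontrivial V] {f : Module.End F V} (hf : f.IsSemisimple) (d : F) :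
    ∃ t : Module.End F V, Commute t f ∧ LinearMap.det t = d := by
  obtain ⟨p, hp, hpf⟩ := exists_irreducible_of_natDegree_ne_zero (f := f.charpoly)
    (by rw [f.charpoly_natDegree]; exact Module.finrank_pos.ne')
  have : Fact (Irreducible p) := ⟨hp⟩
  have : FiniteDimensional F (AdjoinRoot p) := (AdjoinRoot.powerBasis hp.ne_zero).finite
  have : Finite (AdjoinRoot p) := Module.finite_of_finite F
  obtain ⟨W, g, e, -, he⟩ := exists_split hf hp hpf
  obtain ⟨a, ha⟩ := FiniteField.norm_surjective F (AdjoinRoot p) d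
  let s : Module.End F (AdjoinRoot p × W) := (LinearMap.mulLeft F a).prodMap LinearMap.id
  have hs : Commute s (e.conj f) := by
    rw [he]
    refine LinearMap.ext fun x => ?_
    simp [s, mul_left_comm]
  refine ⟨e.symm.conj s, ?_, ?_⟩
  · refine LinearMap.ext fun x => ?_
    have h := LinearMap.congr_fun hs (e x)
    simp only [Module.End.mul_apply, LinearEquiv.conj_apply_apply,
      LinearEquiv.symm_apply_apply] at h
    simp only [Module.End.mul_apply, LinearEquiv.conj_apply_apply, LinearEquiv.symm_symm, h,
      LinearEquiv.symm_apply_apply]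
  · rw [LinearEquiv.conj_apply, LinearMap.comp_assoc, LinearMap.det_conj, LinearMap.det_prodMap,
      LinearMap.det_id, mul_one]
    exact ha

end

end SemisimpleConj


/-- **Semisimple classes of `SL_n` and characteristic polynomials.**
Let `F` be a finite field, `n ≥ 2` with `(n, |F|) ∉ {(2,2), (2,3)}`, and let `A, B` be
invertible semisimple `n × n` matrices over `F` (i.e. their minimal polynomials are
squarefree).  Then `A` and `B` have the same characteristic polynomial if and only if they are
conjugate by a matrix of determinant `1`. -/
theorem stmt18 (F : Type) [Field F] [Fintype F] (n : ℕ) (hn : 2 ≤ n)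
    (hexc : ¬(n = 2 ∧ Fintype.card F = 2) ∧ ¬(n = 2 ∧ Fintype.card F = 3))
    (A B : Matrix (Fin n) (Fin n) F) (hA : IsUnit A.det) (hB : IsUnit B.det)
    (hAs : Squarefree (minpoly F A)) (hBs : Squarefree (minpoly F B)) :
    A.charpoly = B.charpoly ↔
      ∃ S : Matrix (Fin n) (Fin n) F, S.det = 1 ∧ B = S * A * S⁻¹ := by
  have : NeZero n := ⟨by omega⟩
  constructor
  · intro hc
    have hss {M : Matrix (Fin n) (Fin n) F} (hM : Squarefree (minpoly F M)) :
        Module.End.IsSemisimple M.toLin' := by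
      refine Module.End.isSemisimple_of_squarefree_aeval_eq_zero hM ?_
      rw [← Matrix.minpoly_toLin', minpoly.aeval]
    obtain ⟨e, he⟩ := SemisimpleConj.exists_equiv_of_charpoly_eq _ le_rfl (hss hAs) (hss hBs)
      (by rw [Matrix.charpoly_toLin', Matrix.charpoly_toLin', hc])
    have hdet : LinearMap.det (e : (Fin n → F) →ₗ[F] (Fin n → F)) ≠ 0 := e.isUnit_det'.ne_zero
    obtain ⟨t, ht, htd⟩ := SemisimpleConj.exists_commute_det_eq (hss hAs)
      (LinearMap.det (e : (Fin n → F) →ₗ[F] (Fin n → F)))⁻¹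
    have hS : (LinearMap.toMatrix' ((e : (Fin n → F) →ₗ[F] (Fin n → F)) ∘ₗ t)).det = 1 := by
      rw [LinearMap.det_toMatrix', LinearMap.det_comp, htd, mul_inv_cancel₀ hdet]
    refine ⟨_, hS, ?_⟩
    have := Matrix.invertibleOfIsUnitDet _ (hS ▸ isUnit_one)
    rw [eq_comm, Matrix.mul_inv_eq_iff_eq_mul_of_invertible]
    apply Matrix.toLin'.injective
    rw [Matrix.toLin'_mul, Matrix.toLin'_mul, Matrix.toLin'_toMatrix']
    refine LinearMap.ext fun x => ?_
    have h1 := LinearMap.congr_fun he (e (t x))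
    have h2 := LinearMap.congr_fun ht x
    rw [LinearEquiv.conj_apply_apply, LinearEquiv.symm_apply_apply] at h1
    simp only [Module.End.mul_apply] at h2
    simp only [LinearMap.comp_apply, LinearEquiv.coe_coe]
    rw [← h1, h2]
  · rintro ⟨S, hS, rfl⟩
    have hu : IsUnit S := (Matrix.isUnit_iff_isUnit_det S).mpr (hS ▸ isUnit_one)
    obtain ⟨u, rfl⟩ := hu
    exact (Matrix.charpoly_units_conj u A).symm
end
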